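/- Let a ≥ b > 0 and c > 0 satisfy −1 < Δ < 1, where Δ := (a²+b²−c²)/(2ab). Let ζ ∈ (0,π) be defined by Δ = −cos(ζ), and let θ ∈ (0,π) be the unique solution of a·sin(θζ/π) = b·sin((1−θ/π)ζ). Then the per-site free energy f(a,b,c) exists (i.e. the iterated limit defining it converges) and f(a,b,c) = log b + ∫_{−∞}^{+∞} (1/(2t)) · [sinh((2(π−θ)/π)·ζt)/cosh(ζt)] · [sinh((π−ζ)t)/sinh(πt)] dt, where the integrand is extended continuously at t = 0. -/

import Mathlib

open MeasureTheory Filter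
open scoped Real BigOperators

noncomputable section

set_option linter.all false

namespace SixVertexFE

/-- Configurations on the `N × M` torus: each vertex `v` carries a horizontal edge
(from `v` to `v+(1,0)`) and a vertical edge (from `v` to `v+(0,1)`).
First component: `true` = the horizontal edge points East.
Second component: `true` = the vertical edge points North. -/
abbrev Cfg (N M : ℕ) := ((Fin N × Fin M) → Bool) × ((Fin N × Fin M) → Bool)

/-- the predecessor (`i - 1`) on the discrete circle `Fin N`. -/
def predF {N : ℕ} (i : Fin N) : Fin N := ⟨(i.1 + (N - 1)) % N, Nat.mod_lt _ i.pos⟩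

/-- number of edges incident to `v` that point towards `v`. -/
abbrev inArrows {N M : ℕ} (ω : Cfg N M) (v : Fin N × Fin M) : ℕ :=
  (if ω.1 (predF v.1, v.2) = true then 1 else 0) +
  (if ω.1 v = false then 1 else 0) +
  (if ω.2 (v.1, predF v.2) = true then 1 else 0) +
  (if ω.2 v = false then 1 else 0)

/-- the ice rule: exactly two incoming arrows at every vertex. -/
abbrev IsSixVertex {N M : ℕ} (ω : Cfg N M) : Prop := ∀ v, inArrows ω v = 2

/-- weight of a vertex: `c` if the two horizontal edges at `v` point in opposite
directions, `a` for all-East-all-North or all-West-all-South, `b` for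
all-East-all-South or all-West-all-North. -/
def vWeight (a b c : ℝ) {N M : ℕ} (ω : Cfg N M) (v : Fin N × Fin M) : ℝ :=
  if ω.1 (predF v.1, v.2) ≠ ω.1 v then c
  else if (ω.1 (predF v.1, v.2) = true ∧ ω.1 v = true ∧
            ω.2 (v.1, predF v.2) = true ∧ ω.2 v = true) ∨
          (ω.1 (predF v.1, v.2) = false ∧ ω.1 v = false ∧
            ω.2 (v.1, predF v.2) = false ∧ ω.2 v = false) then a
  else if (ω.1 (predF v.1, v.2) = true ∧ ω.1 v = true ∧
            ω.2 (v.1, predF v.2) = false ∧ ω.2 v = false) ∨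
          (ω.1 (predF v.1, v.2) = false ∧ ω.1 v = false ∧
            ω.2 (v.1, predF v.2) = true ∧ ω.2 v = true) then b
  else 0

/-- weight of a configuration. -/
def W (a b c : ℝ) {N M : ℕ} (ω : Cfg N M) : ℝ := ∏ v, vWeight a b c ω v

/-- partition function of the six-vertex model on the `N × M` torus. -/
def Z (N M : ℕ) (a b c : ℝ) : ℝ :=
  ∑ ω : Cfg N M, if IsSixVertex ω then W a b c ω else 0

/-- number of North-pointing vertical edges in row `j`. -/
abbrev RowCount {N M : ℕ} (ω : Cfg N M) (j : Fin M) : ℕ :=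
  (Finset.univ.filter fun i : Fin N => ω.2 (i, j) = true).card

/-- partition function restricted to configurations with exactly `n` up arrows per row. -/
def Zn (N M n : ℕ) (a b c : ℝ) : ℝ :=
  ∑ ω : Cfg N M, if IsSixVertex ω ∧ (∀ j, RowCount ω j = n) then W a b c ω else 0

/-- `F` is the per-site free energy of the six-vertex model with weights `a, b, c`:
the inner limit in `M` exists for every even `N ≥ 2`, and the resulting quantities
converge to `F` as `N → ∞` along even `N`. -/
def FreeEnergyIs (a b c F : ℝ) : Prop :=
  ∃ g : ℕ → ℝ,
    (∀ N : ℕ, Even N → 2 ≤ N →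
      Tendsto (fun M : ℕ => Real.log (Z N M a b c) / (M * N)) atTop (nhds (g N))) ∧
    Tendsto g (atTop ⊓ Filter.principal {N | Even N}) (nhds F)

/-- `L = f_N^{(n)}(a,b,c)`, the free energy of the six-vertex model in the sector
with `n` up arrows per row. -/
def SectorFE (N n : ℕ) (a b c L : ℝ) : Prop :=
  Tendsto (fun M : ℕ => Real.log (Zn N M n a b c) / (N * M)) atTop (nhds L)

end SixVertexFE

namespace SixVertexFE

/-- integrand of the free-energy formula in the regime `-1 < Δ < 1`, extended
continuously at `t = 0`. -/
def masslessIntegrand (ζ θ t : ℝ) : ℝ :=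
  if t = 0 then (π - θ) * ζ * (π - ζ) / π ^ 2
  else (1 / (2 * t)) * (Real.sinh ((2 * (π - θ) / π) * ζ * t) / Real.cosh (ζ * t)) *
    (Real.sinh ((π - ζ) * t) / Real.sinh (π * t))

/-- Algebraic Bethe ansatz, abstract form of the commutation through a product of B's. -/
theorem aba {K V ι : Type*} [Field K] [AddCommGroup V] [Module K V] [DecidableEq ι]
    (A B : K → V →ₗ[K] V) (G : Set K) (z : ι → K) (f g : K → K → K) (al : K → K) (Ω : V)
    (ψ : Finset ι → V) (hψ0 : ψ ∅ = Ω)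
    (hψ : ∀ (S : Finset ι) (j : ι), j ∉ S → ψ (insert j S) = B (z j) (ψ S))
    (hzG : ∀ j, z j ∈ G) (hinj : Function.Injective z)
    (hA : ∀ x ∈ G, ∀ j, x ≠ z j → ∀ v, A x (B (z j) v) = f (z j) x • B (z j) (A x v)
      + g (z j) x • B x (A (z j) v))
    (hB : ∀ x ∈ G, ∀ j, ∀ v, B x (B (z j) v) = B (z j) (B x v))
    (hfg : ∀ x ∈ G, ∀ j m, j ≠ m → x ≠ z j → x ≠ z m →
      f (z m) x * g (z j) x + g (z m) x * g (z j) (z m) = g (z j) x * f (z m) (z j))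
    (hΩ : ∀ x ∈ G, A x Ω = al x • Ω) :
    ∀ S : Finset ι, ∀ x ∈ G, (∀ j ∈ S, x ≠ z j) →
      A x (ψ S) = (al x * ∏ j ∈ S, f (z j) x) • ψ S
        + ∑ j ∈ S, (al (z j) * g (z j) x * ∏ k ∈ S.erase j, f (z k) (z j)) • B x (ψ (S.erase j)) := by
  intro S
  induction S using Finset.induction_on with
  | empty => intro x hx _; simp [hψ0, hΩ x hx]
  | insert m S hm ih =>
    intro x hx hne
    have hxm : x ≠ z m := hne m (Finset.mem_insert_self _ _)
    have hxS : ∀ j ∈ S, x ≠ z j := fun j hj => hne j (Finset.mem_insert_of_mem hj)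
    have hmS : ∀ j ∈ S, z m ≠ z j := fun j hj h => hm (by rw [hinj h]; exact hj)
    rw [hψ S m hm, hA x hx m hxm, ih x hx hxS, ih (z m) (hzG m) hmS]
    rw [Finset.sum_insert hm, Finset.prod_insert hm, Finset.erase_insert hm]
    simp only [map_add, map_smul, map_sum, smul_add, smul_smul, Finset.smul_sum]
    have key : ∀ j ∈ S, (al (z j) * g (z j) x * ∏ k ∈ (insert m S).erase j, f (z k) (z j)) •
        B x (ψ ((insert m S).erase j)) =
        (f (z m) x * (al (z j) * g (z j) x * ∏ k ∈ S.erase j, f (z k) (z j))) •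
          B (z m) (B x (ψ (S.erase j))) +
        (g (z m) x * (al (z j) * g (z j) (z m) * ∏ k ∈ S.erase j, f (z k) (z j))) •
          B x (B (z m) (ψ (S.erase j))) := by
      intro j hj
      have hjm : j ≠ m := fun h => hm (h ▸ hj)
      have hme : m ∉ S.erase j := fun h => hm (Finset.mem_of_mem_erase h)
      rw [Finset.erase_insert_of_ne hjm.symm, Finset.prod_insert hme, hψ _ _ hme,
        ← hB x hx m, ← add_smul]
      congr 1
      have := hfg x hx j m hjm (hxS j hj) hxm
      linear_combination (-al (z j) * ∏ k ∈ S.erase j, f (z k) (z j)) * this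
    rw [Finset.sum_congr rfl key, Finset.sum_add_distrib]
    have e1 : f (z m) x * (al x * ∏ j ∈ S, f (z j) x) = al x * (f (z m) x * ∏ j ∈ S, f (z j) x) := by ring
    have e2 : g (z m) x * (al (z m) * ∏ j ∈ S, f (z j) (z m)) =
      al (z m) * g (z m) x * ∏ j ∈ S, f (z j) (z m) := by ring
    rw [e1, e2]
    abel

/-- chain of `n` spins -/
def Ch : ℕ → Type
  | 0 => Unit
  | n + 1 => Bool × Ch n

instance instFintypeCh : ∀ n, Fintype (Ch n)
  | 0 => inferInstanceAs (Fintype Unit)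
  | n + 1 => @instFintypeProd _ _ _ (instFintypeCh n)

instance instDecEqCh : ∀ n, DecidableEq (Ch n)
  | 0 => inferInstanceAs (DecidableEq Unit)
  | n + 1 => @instDecidableEqProd _ _ _ (instDecEqCh n)

/-- six-vertex local weights -/
def lw {R : Type*} [Zero R] (a b cp cm : R) : Bool → Bool → Matrix Bool Bool R
  | false, false => fun s t => match s, t with
    | false, false => a | true, true => b | _, _ => 0
  | true, true => fun s t => match s, t with
    | false, false => b | true, true => a | _, _ => 0
  | false, true => fun s t => match s, t with
    | true, false => cp | _, _ => 0
  | true, false => fun s t => match s, t with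
    | false, true => cm | _, _ => 0

/-- monodromy matrix -/
def mono {R : Type*} [CommRing R] (L : ℕ → Bool → Bool → Matrix Bool Bool R) :
    (n : ℕ) → Bool → Bool → Matrix (Ch n) (Ch n) R
  | 0 => fun i j => if i = j then 1 else 0
  | n + 1 => fun i j => ∑ k, Matrix.kroneckerMap (· * ·) (L n i k) (mono L n k j)

theorem mono_succ {R : Type*} [CommRing R] (L : ℕ → Bool → Bool → Matrix Bool Bool R) (n : ℕ)
    (i j : Bool) (s t : Bool) (σ τ : Ch n) :
    mono L (n + 1) i j (s, σ) (t, τ) = ∑ k, L n i k s t * mono L n k j σ τ := by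
  show (∑ k, Matrix.kroneckerMap (· * ·) (L n i k) (mono L n k j)) (s, σ) (t, τ) = _
  rw [Matrix.sum_apply]; rfl

/-- RTT relation -/
def RTT {R 𝓐 : Type*} [CommRing R] [Ring 𝓐] [Algebra R 𝓐] (r : Bool → Bool → Matrix Bool Bool R)
    (X Y : Bool → Bool → 𝓐) : Prop :=
  ∀ i j i' j', ∑ k, ∑ l, r i k j l • (X k i' * Y l j') = ∑ k, ∑ l, r k i' l j' • (Y j l * X i k)

theorem RTT_step {R : Type*} [CommRing R] {α β : Type*} [Fintype α] [Fintype β] [DecidableEq α]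
    [DecidableEq β] (r : Bool → Bool → Matrix Bool Bool R)
    (X Y : Bool → Bool → Matrix α α R) (X' Y' : Bool → Bool → Matrix β β R)
    (h : RTT r X Y) (h' : RTT r X' Y') :
    RTT r (fun i j => ∑ k, Matrix.kroneckerMap (· * ·) (X i k) (X' k j))
      (fun i j => ∑ k, Matrix.kroneckerMap (· * ·) (Y i k) (Y' k j)) := by
  intro i j i' j'
  have h1 := fun (p q : Bool) => congrArg
    (fun M => Matrix.kroneckerMap (· * ·) M (X' p i' * Y' q j')) (h i j p q)
  have h2 := fun (p q : Bool) => congrArg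
    (fun M => Matrix.kroneckerMap (· * ·) (Y j q * X i p) M) (h' p q i' j')
  simp only [Fintype.sum_bool, Matrix.add_kronecker, Matrix.kronecker_add, Matrix.smul_kronecker,
    Matrix.kronecker_smul, Matrix.mul_kronecker_mul, add_mul, mul_add, smul_add] at h1 h2 ⊢
  have a1 := h1 true true
  have a2 := h1 true false
  have a3 := h1 false true
  have a4 := h1 false false
  have b1 := h2 true true
  have b2 := h2 true false
  have b3 := h2 false true
  have b4 := h2 false false
  linear_combination (norm := module) a1 + a2 + a3 + a4 + b1 + b2 + b3 + b4

theorem RLL {R : Type*} [CommRing R] (q q' x z y : R) (hq : q * q' = 1) :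
    RTT (lw (x * q - z * q') (x - z) ((q - q') * x) ((q - q') * z))
      (lw (x * q - y * q') (x - y) ((q - q') * x) ((q - q') * y))
      (lw (z * q - y * q') (z - y) ((q - q') * z) ((q - q') * y)) := by
  intro i j i' j'
  ext s t
  simp only [Fintype.sum_bool, Matrix.add_apply, Matrix.smul_apply, Matrix.mul_apply, smul_eq_mul]
  cases i <;> cases j <;> cases i' <;> cases j' <;> cases s <;> cases t <;>
    simp only [lw, mul_zero, zero_mul, add_zero, zero_add] <;>
    first
    | done
    | ring1
    | linear_combination x * (q - q') * (z - y) * (x - z) * hq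
    | linear_combination -x * (q - q') * (z - y) * (x - z) * hq
    | linear_combination y * (q - q') * (z - y) * (x - z) * hq
    | linear_combination -y * (q - q') * (z - y) * (x - z) * hq

/-- polynomial-gauge L operator with spectral parameter `x`, inhomogeneities `y` -/
def Lq {R : Type*} [CommRing R] (q q' : R) (y : ℕ → R) (x : R) (n : ℕ) :
    Bool → Bool → Matrix Bool Bool R :=
  lw (x * q - y n * q') (x - y n) ((q - q') * x) ((q - q') * y n)

theorem RTT_mono {R : Type*} [CommRing R] (q q' : R) (hq : q * q' = 1) (y : ℕ → R) (x z : R) (n : ℕ) :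
    RTT (lw (x * q - z * q') (x - z) ((q - q') * x) ((q - q') * z))
      (mono (Lq q q' y x) n) (mono (Lq q q' y z) n) := by
  induction n with
  | zero =>
    intro i j i' j'
    cases i <;> cases j <;> cases i' <;> cases j' <;> simp [mono, lw]
  | succ n ih => exact RTT_step _ _ _ _ _ (RLL q q' x z (y n) hq) ih

section rel
variable {R : Type*} [CommRing R] (q q' : R) (hq : q * q' = 1) (y : ℕ → R) (x z : R) (n : ℕ)
include hq

theorem rel_BB : (x * q - z * q') • (mono (Lq q q' y x) n false true * mono (Lq q q' y z) n false true)
    = (x * q - z * q') • (mono (Lq q q' y z) n false true * mono (Lq q q' y x) n false true) := by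
  have := RTT_mono q q' hq y x z n false false true true
  simpa [lw] using this

theorem rel_AB : (z - x) • (mono (Lq q q' y x) n false false * mono (Lq q q' y z) n false true)
    = (z * q - x * q') • (mono (Lq q q' y z) n false true * mono (Lq q q' y x) n false false)
    + (-((q - q') * z)) • (mono (Lq q q' y x) n false true * mono (Lq q q' y z) n false false) := by
  have := RTT_mono q q' hq y z x n false false true false
  simp [lw] at this
  rw [this]; module

theorem rel_DB : (z - x) • (mono (Lq q q' y x) n true true * mono (Lq q q' y z) n false true)
    = (z * q' - x * q) • (mono (Lq q q' y z) n false true * mono (Lq q q' y x) n true true)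
    + ((q - q') * z) • (mono (Lq q q' y x) n false true * mono (Lq q q' y z) n true true) := by
  have := RTT_mono q q' hq y x z n true false true true
  simp [lw] at this
  linear_combination (norm := module) -this

end rel

/-- tensor product vector -/
def tens {R : Type*} [CommRing R] {n : ℕ} (u : Bool → R) (v : Ch n → R) : Ch (n + 1) → R :=
  fun c => u c.1 * v c.2

theorem mono_tens {R : Type*} [CommRing R] (L : ℕ → Bool → Bool → Matrix Bool Bool R) (n : ℕ)
    (i j : Bool) (u : Bool → R) (v : Ch n → R) :
    (mono L (n + 1) i j).mulVec (tens u v) =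
      ∑ k, tens ((L n i k).mulVec u) ((mono L n k j).mulVec v) := by
  ext c
  rw [Finset.sum_apply]
  have h1 : (mono L (n + 1) i j).mulVec (tens u v) c =
      ∑ t : Bool, ∑ τ : Ch n, (∑ k, L n i k c.1 t * mono L n k j c.2 τ) * (u t * v τ) := by
    show ∑ d : Bool × Ch n, mono L (n + 1) i j (c.1, c.2) d * (u d.1 * v d.2) = _
    rw [Fintype.sum_prod_type]
    simp only [mono_succ]
  rw [h1]
  simp only [tens, Matrix.mulVec, dotProduct, Fintype.sum_bool, Finset.mul_sum, add_mul,
    Finset.sum_add_distrib]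
  have e : ∀ (k t : Bool), ∑ τ : Ch n, L n i k c.1 t * mono L n k j c.2 τ * (u t * v τ) =
      ∑ τ : Ch n, L n i k c.1 t * u t * (mono L n k j c.2 τ * v τ) :=
    fun k t => Finset.sum_congr rfl fun x _ => by ring
  simp only [e]
  abel

/-- up vector -/
def e0 {R : Type*} [CommRing R] : Bool → R := fun s => if s = false then 1 else 0
/-- down vector -/
def e1 {R : Type*} [CommRing R] : Bool → R := fun s => if s = true then 1 else 0

/-- pseudo-vacuum -/
def vac {R : Type*} [CommRing R] : (n : ℕ) → Ch n → R
  | 0 => fun _ => 1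
  | n + 1 => tens e0 (vac n)

theorem tens_zero_left {R : Type*} [CommRing R] {n : ℕ} (v : Ch n → R) : tens 0 v = 0 := by
  ext; simp [tens]
theorem tens_zero_right {R : Type*} [CommRing R] {n : ℕ} (u : Bool → R) :
    tens u (0 : Ch n → R) = 0 := by
  ext; simp [tens]
theorem tens_smul {R : Type*} [CommRing R] {n : ℕ} (u : Bool → R) (v : Ch n → R) (a b : R) :
    tens (a • u) (b • v) = (a * b) • tens u v := by
  ext; simp [tens]; ring

section lwe
variable {R : Type*} [CommRing R] (a b cp cm : R)
theorem lw_00_0 : (lw a b cp cm false false).mulVec e0 = a • e0 := by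
  ext s; cases s <;> simp [lw, e0, Matrix.mulVec, dotProduct]
theorem lw_00_1 : (lw a b cp cm false false).mulVec e1 = b • e1 := by
  ext s; cases s <;> simp [lw, e1, Matrix.mulVec, dotProduct]
theorem lw_11_0 : (lw a b cp cm true true).mulVec e0 = b • e0 := by
  ext s; cases s <;> simp [lw, e0, Matrix.mulVec, dotProduct]
theorem lw_11_1 : (lw a b cp cm true true).mulVec e1 = a • e1 := by
  ext s; cases s <;> simp [lw, e1, Matrix.mulVec, dotProduct]
theorem lw_10_0 : (lw a b cp cm true false).mulVec e0 = 0 := by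
  ext s; cases s <;> simp [lw, e0, Matrix.mulVec, dotProduct]
theorem lw_10_1 : (lw a b cp cm true false).mulVec e1 = cm • e0 := by
  ext s; cases s <;> simp [lw, e0, e1, Matrix.mulVec, dotProduct]
theorem lw_01_0 : (lw a b cp cm false true).mulVec e0 = cp • e1 := by
  ext s; cases s <;> simp [lw, e0, e1, Matrix.mulVec, dotProduct]
theorem lw_01_1 : (lw a b cp cm false true).mulVec e1 = 0 := by
  ext s; cases s <;> simp [lw, e1, Matrix.mulVec, dotProduct]
end lwe

section vacs
variable {R : Type*} [CommRing R] (q q' : R) (y : ℕ → R) (x : R)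

theorem C_vac (n : ℕ) : (mono (Lq q q' y x) n true false).mulVec (vac n) = 0 := by
  induction n with
  | zero => simp [mono]
  | succ n ih =>
    rw [vac, mono_tens, Fintype.sum_bool, ih, tens_zero_right, Lq, lw_10_0, tens_zero_left, add_zero]

theorem A_vac (n : ℕ) : (mono (Lq q q' y x) n false false).mulVec (vac n)
    = (∏ k ∈ Finset.range n, (x * q - y k * q')) • vac n := by
  induction n with
  | zero => simp [mono]
  | succ n ih =>
    rw [vac, mono_tens, Fintype.sum_bool, C_vac, tens_zero_right, ih, Lq, lw_00_0, zero_add, tens_smul,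
      Finset.prod_range_succ, mul_comm]

theorem D_vac (n : ℕ) : (mono (Lq q q' y x) n true true).mulVec (vac n)
    = (∏ k ∈ Finset.range n, (x - y k)) • vac n := by
  induction n with
  | zero => simp [mono]
  | succ n ih =>
    rw [vac, mono_tens, Fintype.sum_bool, ih, Lq, lw_11_0, lw_10_0, tens_zero_left, add_zero, tens_smul,
      Finset.prod_range_succ, mul_comm]

/-- Bethe vector -/
def bvl (N : ℕ) : List R → (Ch N → R)
  | [] => vac N
  | z :: l => (mono (Lq q q' y z) N false true).mulVec (bvl N l)

/-- transfer matrix (polynomial gauge) -/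
def Tq (N : ℕ) : Matrix (Ch N) (Ch N) R :=
  mono (Lq q q' y x) N false false + mono (Lq q q' y x) N true true
end vacs

theorem BB_comm {K : Type*} [Field K] (q q' : K) (hq : q * q' = 1) (y : ℕ → K) (x z : K) (n : ℕ)
    (h : x * q - z * q' ≠ 0 ∨ z * q - x * q' ≠ 0) :
    mono (Lq q q' y x) n false true * mono (Lq q q' y z) n false true
    = mono (Lq q q' y z) n false true * mono (Lq q q' y x) n false true := by
  rcases h with h | h
  · exact smul_right_injective _ h (rel_BB q q' hq y x z n)
  · exact (smul_right_injective _ h (rel_BB q q' hq y z x n)).symm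

theorem bethe {K : Type*} [Field K] (q q' : K) (hq : q * q' = 1) (y : ℕ → K) (N n : ℕ)
    (z : Fin n → K) (hz : Function.Injective z) (x : K) (hx : ∀ j, x ≠ z j)
    (hc : ∀ i j, z i * q - z j * q' ≠ 0)
    (hcx : ∀ j, x * q - z j * q' ≠ 0 ∨ z j * q - x * q' ≠ 0)
    (hbae : ∀ j, (∏ k ∈ Finset.range N, (z j * q - y k * q')) *
        ∏ k ∈ Finset.univ.erase j, (z k * q - z j * q') =
      (∏ k ∈ Finset.range N, (z j - y k)) * ∏ k ∈ Finset.univ.erase j, (z k * q' - z j * q)) :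
    (Tq q q' y x N).mulVec (bvl q q' y N ((List.finRange n).map z)) =
      ((∏ k ∈ Finset.range N, (x * q - y k * q')) * ∏ j, ((z j * q - x * q') / (z j - x)) +
       (∏ k ∈ Finset.range N, (x - y k)) * ∏ j, ((z j * q' - x * q) / (z j - x))) •
        bvl q q' y N ((List.finRange n).map z) := by
  classical
  set G : Set K := {w | w = x ∨ ∃ j, w = z j} with hG
  have hzG : ∀ j, z j ∈ G := fun j => Or.inr ⟨j, rfl⟩
  have hxG : x ∈ G := Or.inl rfl
  let M : Bool → Bool → K → (Ch N → K) →ₗ[K] (Ch N → K) :=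
    fun i j w => Matrix.mulVecLin (mono (Lq q q' y w) N i j)
  let ψ : Finset (Fin n) → (Ch N → K) := fun S => bvl q q' y N (S.toList.map z)
  have hBB : ∀ u ∈ G, ∀ j, ∀ v, M false true u (M false true (z j) v)
      = M false true (z j) (M false true u v) := by
    rintro u (rfl | ⟨i, rfl⟩) j v
    · simp only [M, Matrix.mulVecLin_apply, Matrix.mulVec_mulVec]
      rw [BB_comm q q' hq y u (z j) N (hcx j)]
    · simp only [M, Matrix.mulVecLin_apply, Matrix.mulVec_mulVec]
      rw [BB_comm q q' hq y (z i) (z j) N (Or.inl (hc i j))]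
  have hperm : ∀ l₁ l₂ : List (Fin n), l₁.Perm l₂ →
      bvl q q' y N (l₁.map z) = bvl q q' y N (l₂.map z) := by
    intro l₁ l₂ h
    induction h with
    | nil => rfl
    | cons a _ ih => simp only [List.map_cons, bvl, ih]
    | swap a b l =>
      simp only [List.map_cons, bvl]
      exact hBB (z b) (hzG b) a _
    | trans _ _ h1 h2 => exact h1.trans h2
  have hψ : ∀ (S : Finset (Fin n)) (j : Fin n), j ∉ S → ψ (insert j S) = M false true (z j) (ψ S) := by
    intro S j hj
    exact hperm _ _ (Finset.toList_insert hj)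
  have hψu : bvl q q' y N ((List.finRange n).map z) = ψ Finset.univ := by
    apply hperm
    apply (List.perm_ext_iff_of_nodup (List.nodup_finRange n) (Finset.nodup_toList _)).2
    simp
  have hne : ∀ u ∈ G, ∀ j, u ≠ z j → z j - u ≠ 0 := fun u _ j h => sub_ne_zero.2 (Ne.symm h)
  have keyA := aba (M false false) (M false true) G z (fun w u => (w * q - u * q') / (w - u))
    (fun w u => -((q - q') * w) / (w - u)) (fun u => ∏ k ∈ Finset.range N, (u * q - y k * q'))
    (vac N) ψ (by simp [ψ, bvl]) hψ hzG hz
    (by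
      intro u hu j huj v
      have h0 := hne u hu j huj
      have := congrArg (fun A => (z j - u)⁻¹ • A.mulVec v) (rel_AB q q' hq y u (z j) N)
      simp only [Matrix.smul_mulVec, Matrix.add_mulVec, smul_smul, smul_add, inv_mul_cancel₀ h0,
        one_smul, ← Matrix.mulVec_mulVec] at this
      simp only [M, Matrix.mulVecLin_apply]
      rw [this]; simp only [div_eq_inv_mul])
    hBB
    (by
      intro u hu j m hjm h1 h2
      have h0 := hne u hu j h1
      have h0' := hne u hu m h2
      have h3 : z j - z m ≠ 0 := sub_ne_zero.2 fun h => hjm (hz h)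
      have h4 : z m - z j ≠ 0 := sub_ne_zero.2 fun h => hjm (hz h).symm
      field_simp
      linear_combination (0 : K) * hq)
    (fun u _ => A_vac q q' y u N) Finset.univ x hxG (fun j _ => hx j)
  have keyD := aba (M true true) (M false true) G z (fun w u => (w * q' - u * q) / (w - u))
    (fun w u => ((q - q') * w) / (w - u)) (fun u => ∏ k ∈ Finset.range N, (u - y k))
    (vac N) ψ (by simp [ψ, bvl]) hψ hzG hz
    (by
      intro u hu j huj v
      have h0 := hne u hu j huj
      have := congrArg (fun A => (z j - u)⁻¹ • A.mulVec v) (rel_DB q q' hq y u (z j) N)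
      simp only [Matrix.smul_mulVec, Matrix.add_mulVec, smul_smul, smul_add, inv_mul_cancel₀ h0,
        one_smul, ← Matrix.mulVec_mulVec] at this
      simp only [M, Matrix.mulVecLin_apply]
      rw [this]; simp only [div_eq_inv_mul])
    hBB
    (by
      intro u hu j m hjm h1 h2
      have h0 := hne u hu j h1
      have h0' := hne u hu m h2
      have h3 : z j - z m ≠ 0 := sub_ne_zero.2 fun h => hjm (hz h)
      have h4 : z m - z j ≠ 0 := sub_ne_zero.2 fun h => hjm (hz h).symm
      field_simp
      linear_combination (0 : K) * hq)
    (fun u _ => D_vac q q' y u N) Finset.univ x hxG (fun j _ => hx j)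
  rw [hψu, Tq, Matrix.add_mulVec, add_smul]
  simp only [M, Matrix.mulVecLin_apply] at keyA keyD
  rw [keyA, keyD, add_add_add_comm, ← Finset.sum_add_distrib]
  convert add_zero _
  apply Finset.sum_eq_zero
  intro j _
  rw [← add_smul]
  convert zero_smul K _
  rw [Finset.prod_div_distrib, Finset.prod_div_distrib]
  have := hbae j
  simp only [div_eq_mul_inv]
  linear_combination (-((q - q') * z j) * (z j - x)⁻¹ *
    (∏ k ∈ Finset.univ.erase j, (z k - z j))⁻¹) * this

section dimer
variable {K : Type*} [Field K] (q q' : K) (z : ℕ → K)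

/-- dimerised inhomogeneities -/
def ydim (k : ℕ) : K := if k % 2 = 0 then z (k / 2) * (q * q) else z (k / 2)

/-- dimer vector: pairs in `S` are singlets -/
def st (S : Finset ℕ) : (n : ℕ) → Ch (2 * n) → K
  | 0 => fun _ => 1
  | n + 1 => if n ∈ S then
      (show Ch (2 * n + 1 + 1) → K from tens e0 (tens e1 (st S n)) + (-q) • tens e1 (tens e0 (st S n)))
    else (show Ch (2 * n + 1 + 1) → K from tens e0 (tens e0 (st S n)))

theorem st_ne (S : Finset ℕ) (n : ℕ) : ∃ c, st q S n c ≠ 0 := by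
  induction n with
  | zero => exact ⟨(), one_ne_zero⟩
  | succ n ih =>
    obtain ⟨c, hc⟩ := ih
    by_cases h : n ∈ S
    · refine ⟨((false, (true, c)) : Bool × Bool × Ch (2 * n)), ?_⟩
      simp only [st, h, if_true]
      show e0 false * (e1 true * st q S n c) + (-q) * (e1 false * (e0 true * st q S n c)) ≠ 0
      simpa [e0, e1] using hc
    · refine ⟨((false, (false, c)) : Bool × Bool × Ch (2 * n)), ?_⟩
      simp only [st, h, if_false]
      show e0 false * (e0 false * st q S n c) ≠ 0
      simpa [e0, e1] using hc

theorem st_vac (n : ℕ) : st q ∅ n = vac (2 * n) := by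
  induction n with
  | zero => rfl
  | succ n ih => simp only [st, Finset.notMem_empty, if_false, ih]; rfl

theorem Lq_even (x : K) (n : ℕ) : Lq q q' (ydim q z) x (2 * n) =
    lw (x * q - z n * (q * q) * q') (x - z n * (q * q)) ((q - q') * x) ((q - q') * (z n * (q * q))) := by
  simp [Lq, ydim]

theorem Lq_odd (x : K) (n : ℕ) : Lq q q' (ydim q z) x (2 * n + 1) =
    lw (x * q - z n * q') (x - z n) ((q - q') * x) ((q - q') * z n) := by
  have h1 : (2 * n + 1) % 2 = 1 := by omega
  have h2 : (2 * n + 1) / 2 = n := by omega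
  simp [Lq, ydim, h1, h2]

theorem tens_smul_r {n : ℕ} (u : Bool → K) (v : Ch n → K) (b : K) :
    tens u (b • v) = b • tens u v := by
  ext; simp [tens]; ring
theorem tens_smul_l {n : ℕ} (u : Bool → K) (v : Ch n → K) (b : K) :
    tens (b • u) v = b • tens u v := by
  ext; simp [tens]; ring

theorem pair_any (u w : Bool → K) (x : K) (n : ℕ) (i j : Bool) (v : Ch (2 * n) → K) :
    (mono (Lq q q' (ydim q z) x) (2 * n + 1 + 1) i j).mulVec (tens u (tens w v)) =
      ∑ k, ∑ l, tens ((Lq q q' (ydim q z) x (2 * n + 1) i k).mulVec u)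
        (tens ((Lq q q' (ydim q z) x (2 * n) k l).mulVec w)
          ((mono (Lq q q' (ydim q z) x) (2 * n) l j).mulVec v)) := by
  rw [mono_tens]
  refine Finset.sum_congr rfl fun k _ => ?_
  rw [mono_tens, Fintype.sum_bool, Fintype.sum_bool]
  ext c; simp [tens, mul_add]

variable (hq : q * q' = 1)
include hq

/-- action of the monodromy on a top pair -/
theorem pair_act (x : K) (n : ℕ) (i j : Bool) (v : Ch (2 * n) → K) :
    (mono (Lq q q' (ydim q z) x) (2 * n + 1 + 1) i j).mulVec
      (tens e0 (tens e1 v) + (-q) • tens e1 (tens e0 v)) =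
    ((x * q - z n * q') * (x - z n * (q * q))) •
      (tens e0 (tens e1 ((mono (Lq q q' (ydim q z) x) (2 * n) i j).mulVec v)) +
       (-q) • tens e1 (tens e0 ((mono (Lq q q' (ydim q z) x) (2 * n) i j).mulVec v))) := by
  rw [Matrix.mulVec_add, Matrix.mulVec_smul, pair_any, pair_any]
  have hq2 : q * q * q' = q := by linear_combination q * hq
  cases i <;> simp only [Fintype.sum_bool, Lq_even, Lq_odd, lw_00_0, lw_00_1, lw_01_0, lw_01_1, lw_10_0,
      lw_10_1, lw_11_0, lw_11_1, tens_zero_left, tens_zero_right, tens_smul_l, tens_smul_r] <;>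
    match_scalars <;> grind

omit hq in
theorem vac_act0 (x : K) (n : ℕ) (j : Bool) (v : Ch (2 * n) → K) :
    (mono (Lq q q' (ydim q z) x) (2 * n + 1 + 1) true j).mulVec (tens e0 (tens e0 v)) =
    ((x - z n) * (x - z n * (q * q))) •
      tens e0 (tens e0 ((mono (Lq q q' (ydim q z) x) (2 * n) true j).mulVec v)) := by
  rw [pair_any]
  simp only [Fintype.sum_bool, Lq_even, Lq_odd, lw_00_0, lw_00_1, lw_01_0, lw_01_1, lw_10_0,
      lw_10_1, lw_11_0, lw_11_1, tens_zero_left, tens_zero_right, tens_smul_l, tens_smul_r]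
  module

theorem vac_act1 (x : K) (n : ℕ) (j : Bool) (v : Ch (2 * n) → K) :
    (mono (Lq q q' (ydim q z) x) (2 * n + 1 + 1) false j).mulVec (tens e0 (tens e0 v)) =
    ((x * q - z n * q') * (x * q - z n * q)) •
      tens e0 (tens e0 ((mono (Lq q q' (ydim q z) x) (2 * n) false j).mulVec v)) +
    ((q - q') * x) • ((x * q - z n * q') •
      tens e0 (tens e1 ((mono (Lq q q' (ydim q z) x) (2 * n) true j).mulVec v)) +
     (x - z n * (q * q)) •
      tens e1 (tens e0 ((mono (Lq q q' (ydim q z) x) (2 * n) true j).mulVec v))) := by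
  rw [pair_any]
  have hq2 : q * q * q' = q := by linear_combination q * hq
  simp only [Fintype.sum_bool, Lq_even, Lq_odd, lw_00_0, lw_00_1, lw_01_0, lw_01_1, lw_10_0,
      lw_10_1, lw_11_0, lw_11_1, tens_zero_left, tens_zero_right, tens_smul_l, tens_smul_r]
  match_scalars <;> grind

theorem st_C (x : K) (S : Finset ℕ) (n : ℕ) :
    (mono (Lq q q' (ydim q z) x) (2 * n) true false).mulVec (st q S n) = 0 := by
  induction n with
  | zero => simp [mono]
  | succ n ih =>
    by_cases h : n ∈ S
    · simp only [st, h, if_true]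
      refine (pair_act q q' z hq x n true false _).trans ?_
      simp [ih, tens_zero_right]
    · simp only [st, h, if_false]
      refine (vac_act0 q q' z x n false _).trans ?_
      simp [ih, tens_zero_right]

theorem st_D (x : K) (S : Finset ℕ) (n : ℕ) :
    (mono (Lq q q' (ydim q z) x) (2 * n) true true).mulVec (st q S n) =
      (∏ j ∈ Finset.range n, if j ∈ S then (x * q - z j * q') * (x - z j * (q * q)) else
        (x - z j) * (x - z j * (q * q))) • st q S n := by
  induction n with
  | zero => simp [mono]
  | succ n ih =>
    rw [Finset.prod_range_succ]
    by_cases h : n ∈ S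
    · simp only [st, h, if_true]
      refine (pair_act q q' z hq x n true true _).trans ?_
      simp only [ih, tens_smul_r]
      module
    · simp only [st, h, if_false]
      refine (vac_act0 q q' z x n true _).trans ?_
      simp only [ih, tens_smul_r]
      module

theorem st_B (hqq : q - q' ≠ 0) (S : Finset ℕ) (n m : ℕ) (hm : m < n) (hmS : m ∉ S)
    (hz0 : z m ≠ 0) (hz : ∀ j < n, j ≠ m → z m ≠ z j)
    (hc : ∀ j < n, z m * q - z j * q' ≠ 0) (hc' : ∀ j < n, z j * q - z m * q' ≠ 0) :
    ∃ κ : K, κ ≠ 0 ∧ (mono (Lq q q' (ydim q z) (z m)) (2 * n) false true).mulVec (st q S n) =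
      κ • st q (insert m S) n := by
  have hqne : q ≠ 0 := left_ne_zero_of_mul_eq_one hq
  have h2 : ∀ j < n, z m - z j * (q * q) ≠ 0 := fun j hj h => hc' j hj (by
    have : (z j * q - z m * q') * q = 0 := by linear_combination (-z m) * hq - h
    exact (mul_eq_zero.1 this).resolve_right hqne)
  induction n with
  | zero => omega
  | succ n ih =>
    by_cases hnm : n = m
    · subst hnm
      have hins : st q (insert n S) n = st q S n := by
        have : ∀ k ≤ n, st q (insert n S) k = st q S k := by
          intro k hk
          induction k with
          | zero => rfl
          | succ k ihk => simp only [st, ihk (by omega), Finset.mem_insert,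
              show ¬ k = n by omega, false_or]
        exact this n le_rfl
      refine ⟨((q - q') * z n) * ((q - q') * z n) * ∏ j ∈ Finset.range n, if j ∈ S then
        (z n * q - z j * q') * (z n - z j * (q * q)) else
        (z n - z j) * (z n - z j * (q * q)), ?_, ?_⟩
      · refine mul_ne_zero (mul_ne_zero (mul_ne_zero hqq hz0) (mul_ne_zero hqq hz0)) ?_
        rw [Finset.prod_ne_zero_iff]
        intro j hj
        have hj' : j < n := Finset.mem_range.1 hj
        split_ifs
        · exact mul_ne_zero (hc j (by omega)) (h2 j (by omega))
        · exact mul_ne_zero (sub_ne_zero.2 (hz j (by omega) (by omega))) (h2 j (by omega))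
      · simp only [st, hmS, if_false, Finset.mem_insert_self, if_true, hins]
        refine (vac_act1 q q' z hq (z n) n true _).trans ?_
        simp only [st_D q q' z hq, tens_smul_r]
        match_scalars <;> grind
    · obtain ⟨κ, hκ, e⟩ := ih (by omega) (fun j hj => hz j (by omega)) (fun j hj => hc j (by omega))
        (fun j hj => hc' j (by omega)) (fun j hj => h2 j (by omega))
      by_cases h : n ∈ S
      · refine ⟨(z m * q - z n * q') * (z m - z n * (q * q)) * κ,
          mul_ne_zero (mul_ne_zero (hc n (by omega)) (h2 n (by omega))) hκ, ?_⟩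
        simp only [st, h, Finset.mem_insert, or_true, if_true]
        refine (pair_act q q' z hq (z m) n false true _).trans ?_
        simp only [e, tens_smul_r]
        module
      · refine ⟨(z m * q - z n * q') * (z m * q - z n * q) * κ, mul_ne_zero (mul_ne_zero
          (hc n (by omega)) ?_) hκ, ?_⟩
        · rw [← sub_mul]
          exact mul_ne_zero (sub_ne_zero.2 (hz n (by omega) hnm)) hqne
        simp only [st, h, Finset.mem_insert, hnm, or_self, if_false]
        refine (vac_act1 q q' z hq (z m) n true _).trans ?_
        have hD : (mono (Lq q q' (ydim q z) (z m)) (2 * n) true true).mulVec (st q S n) = 0 := by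
          rw [st_D q q' z hq, Finset.prod_eq_zero (Finset.mem_range.2 (show m < n by omega)), zero_smul]
          simp [hmS]
        simp only [e, hD, tens_smul_r, tens_zero_right, smul_zero, add_zero]
        module

theorem dimer_ne (hqq : q - q' ≠ 0) (n : ℕ) (hz0 : ∀ j < n, z j ≠ 0)
    (hz : ∀ i < n, ∀ j < n, i ≠ j → z i ≠ z j)
    (hc : ∀ i < n, ∀ j < n, z i * q - z j * q' ≠ 0) :
    ∃ c, bvl q q' (ydim q z) (2 * n) ((List.finRange n).map fun j : Fin n => z j) c ≠ 0 := by
  have key : ∀ l : List (Fin n), l.Nodup → ∃ κ : K, κ ≠ 0 ∧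
      bvl q q' (ydim q z) (2 * n) (l.map fun j : Fin n => z j) =
        κ • st q (l.map fun j : Fin n => (j : ℕ)).toFinset n := by
    intro l
    induction l with
    | nil => intro _; exact ⟨1, one_ne_zero, by simp [bvl, st_vac]⟩
    | cons a l ih =>
      intro hl
      obtain ⟨κ, hκ, e⟩ := ih (List.nodup_cons.1 hl).2
      obtain ⟨κ', hκ', e'⟩ := st_B q q' z hq hqq (l.map fun j : Fin n => (j : ℕ)).toFinset n a a.2
        (by
          have := (List.nodup_cons.1 hl).1
          simp only [List.mem_toFinset, List.mem_map, not_exists, not_and]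
          intro b hb hab
          exact this (Fin.ext hab ▸ hb))
        (hz0 a a.2) (fun j hj hja => hz a a.2 j hj (Ne.symm hja)) (fun j hj => hc a a.2 j hj)
        (fun j hj => hc j hj a a.2)
      refine ⟨κ * κ', mul_ne_zero hκ hκ', ?_⟩
      simp only [List.map_cons, bvl, e, Matrix.mulVec_smul, e', List.toFinset_cons, smul_smul]
  obtain ⟨κ, hκ, e⟩ := key _ (List.nodup_finRange n)
  obtain ⟨c, hc⟩ := st_ne q ((List.finRange n).map fun j : Fin n => (j : ℕ)).toFinset n
  exact ⟨c, by rw [e, Pi.smul_apply, smul_eq_mul]; exact mul_ne_zero hκ hc⟩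

end dimer

theorem sym_poly (N : ℕ) (D : MvPolynomial (Fin N) (Polynomial ℂ)) (φ0 φd : Polynomial ℂ) :
    ∃ p : Polynomial ℂ, ∀ (s : ℂ) (y : Fin N → ℂ),
      ∏ k, (Polynomial.X - Polynomial.C (y k)) = φ0 + Polynomial.C s * φd →
      ∏ e : Equiv.Perm (Fin N), MvPolynomial.eval₂Hom (Polynomial.evalRingHom s) (y ∘ e) D = p.eval s := by
  classical
  let P : MvPolynomial (Fin N) (Polynomial ℂ) := ∏ e : Equiv.Perm (Fin N), MvPolynomial.rename e D
  have hP : P.IsSymmetric := by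
    intro e
    simp only [P, map_prod, MvPolynomial.rename_rename, ← Equiv.Perm.coe_mul]
    exact Fintype.prod_equiv (Equiv.mulLeft e) _ _ (fun _ => rfl)
  obtain ⟨G, hG⟩ := MvPolynomial.esymmAlgHom_fin_surjective (Polynomial ℂ) (le_refl N) ⟨P, hP⟩
  have hG' := congrArg Subtype.val hG
  rw [MvPolynomial.esymmAlgHom_apply] at hG'
  change _ = P at hG'
  let E : Fin N → Polynomial ℂ := fun i => Polynomial.C ((-1) ^ (i.1 + 1)) *
    (Polynomial.C (φ0.coeff (N - (i.1 + 1))) + Polynomial.X * Polynomial.C (φd.coeff (N - (i.1 + 1))))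
  refine ⟨MvPolynomial.eval₂Hom (RingHom.id _) E G, fun s y hy => ?_⟩
  have h1 : ∏ e : Equiv.Perm (Fin N), MvPolynomial.eval₂Hom (Polynomial.evalRingHom s) (y ∘ e) D =
      MvPolynomial.eval₂Hom (Polynomial.evalRingHom s) y P := by
    simp only [P, map_prod, MvPolynomial.eval₂Hom_rename]
  have h2 : ∀ k, MvPolynomial.eval₂Hom (Polynomial.evalRingHom s) y
      (MvPolynomial.esymm (Fin N) (Polynomial ℂ) k) = (Finset.univ.val.map y).esymm k := by
    intro k
    simp only [MvPolynomial.esymm, map_sum, map_prod, Finset.esymm_map_val]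
    simp
  rw [h1, ← hG', MvPolynomial.aeval_def, ← MvPolynomial.coe_eval₂Hom, MvPolynomial.map_eval₂Hom]
  rw [← Polynomial.coe_evalRingHom, MvPolynomial.map_eval₂Hom]
  congr 2
  · ext <;> simp
  · funext i
    rw [h2]
    have hv := (Finset.univ.val.map y).prod_X_sub_C_coeff (k := N - (i.1 + 1)) (by simp)
    have hi := i.2
    have hcard : Multiset.card (Finset.univ.val.map y) - (N - (i.1 + 1)) = i.1 + 1 := by
      simp; omega
    rw [hcard] at hv
    have : ((Finset.univ.val.map y).map fun t => Polynomial.X - Polynomial.C t).prod =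
        φ0 + Polynomial.C s * φd := by
      rw [← hy, Multiset.map_map]; rfl
    rw [this] at hv
    simp only [Polynomial.coeff_add, Polynomial.coeff_C_mul] at hv
    simp only [E, Polynomial.coe_evalRingHom, Polynomial.eval_mul, Polynomial.eval_C, Polynomial.eval_add,
      Polynomial.eval_X]
    rw [hv, ← mul_assoc, ← mul_pow]
    simp

section maps
variable {R R' : Type*} [CommRing R] [CommRing R'] (f : R →+* R')

theorem lw_map (a b cp cm : R) (i j : Bool) :
    (lw a b cp cm i j).map f = lw (f a) (f b) (f cp) (f cm) i j := by
  ext s t; rw [Matrix.map_apply]; cases i <;> cases j <;> cases s <;> cases t <;> simp [lw]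

theorem mono_map (L : ℕ → Bool → Bool → Matrix Bool Bool R) (n : ℕ) (i j : Bool) (c d : Ch n) :
    f (mono L n i j c d) = mono (fun k i j => (L k i j).map f) n i j c d := by
  induction n generalizing i j with
  | zero =>
    cases i <;> cases j <;> simp [mono, Matrix.one_apply, apply_ite f]
  | succ n ih =>
    obtain ⟨s, c⟩ := c
    obtain ⟨t, d⟩ := d
    rw [mono_succ, mono_succ, map_sum]
    simp [ih]

theorem monoq_map (q q' : R) (y : ℕ → R) (x : R) (n : ℕ) (i j : Bool) (c d : Ch n) :
    f (mono (Lq q q' y x) n i j c d) = mono (Lq (f q) (f q') (f ∘ y) (f x)) n i j c d := by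
  rw [mono_map]
  congr 1
  funext k i j
  simp [Lq, lw_map]

theorem vac_map (n : ℕ) (c : Ch n) : f (vac n c) = vac n c := by
  induction n with
  | zero => simp [vac]
  | succ n ih => simp [vac, tens, e0, ih, apply_ite f]

theorem bvl_map (q q' : R) (y : ℕ → R) (n : ℕ) (l : List R) (c : Ch n) :
    f (bvl q q' y n l c) = bvl (f q) (f q') (f ∘ y) n (l.map f) c := by
  induction l generalizing c with
  | nil => exact vac_map f n c
  | cons z l ih =>
    simp only [bvl, List.map_cons, Matrix.mulVec, dotProduct, map_sum, map_mul, monoq_map, ih]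

theorem Tq_map (q q' : R) (y : ℕ → R) (x : R) (n : ℕ) :
    (Tq q q' y x n).map f = Tq (f q) (f q') (f ∘ y) (f x) n := by
  ext c d; simp [Tq, monoq_map]

theorem mono_congr (L L' : ℕ → Bool → Bool → Matrix Bool Bool R) (n : ℕ) (h : ∀ k < n, L k = L' k) :
    mono L n = mono L' n := by
  induction n with
  | zero => rfl
  | succ n ih =>
    funext i j
    simp only [mono, ih fun k hk => h k (by omega), h n (by omega)]
end maps

theorem bethe_hom (q q' : ℂ) (hq : q * q' = 1) (hqq : q - q' ≠ 0) (n : ℕ)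
    (z : ℕ → ℂ) (hz0 : ∀ j < n, z j ≠ 0)
    (hz : ∀ i < n, ∀ j < n, i ≠ j → z i ≠ z j)
    (hc : ∀ i < n, ∀ j < n, z i * q - z j * q' ≠ 0) (x : ℂ) (hx : ∀ j < n, x ≠ z j)
    (hcx : ∀ j < n, x * q - z j * q' ≠ 0 ∨ z j * q - x * q' ≠ 0)
    (hbae : ∀ j : Fin n, (z j * q - q') ^ (2 * n) *
        ∏ k ∈ Finset.univ.erase j, (z k * q - z j * q') =
      (z j - 1) ^ (2 * n) * ∏ k ∈ Finset.univ.erase j, (z k * q' - z j * q)) :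
    (Tq q q' (fun _ => 1) x (2 * n) -
      Matrix.scalar _ ((x * q - q') ^ (2 * n) * ∏ j : Fin n, ((z j * q - x * q') / (z j - x)) +
       (x - 1) ^ (2 * n) * ∏ j : Fin n, ((z j * q' - x * q) / (z j - x)))).det = 0 := by
  classical
  set N := 2 * n with hN
  have hqne : q ≠ 0 := left_ne_zero_of_mul_eq_one hq
  set FA := ∏ j : Fin n, ((z j * q - x * q') / (z j - x))
  set FD := ∏ j : Fin n, ((z j * q' - x * q) / (z j - x))
  let φ0 : Polynomial ℂ := (Polynomial.X - Polynomial.C 1) ^ N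
  let φ1 : Polynomial ℂ := ∏ k : Fin N, (Polynomial.X - Polynomial.C (ydim q z k))
  let φd := φ1 - φ0
  -- value of the eigenvalue
  let tt : Polynomial ℂ → ℂ := fun φ => q' ^ N * φ.eval (x * (q * q)) * FA + φ.eval x * FD
  have htt : ∀ s, tt (φ0 + Polynomial.C s * φd) = tt φ0 + s * tt φd := by
    intro s; simp only [tt, Polynomial.eval_add, Polynomial.eval_mul, Polynomial.eval_C]; ring
  let tp : Polynomial ℂ := Polynomial.C (tt φ0) + Polynomial.X * Polynomial.C (tt φd)
  let Q := MvPolynomial (Fin N) (Polynomial ℂ)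
  let cc : ℂ →+* Q := MvPolynomial.C.comp Polynomial.C
  let yy : ℕ → Q := fun k => if h : k < N then MvPolynomial.X ⟨k, h⟩ else cc (ydim q z k)
  obtain ⟨c0, hc0⟩ := dimer_ne q q' z hq hqq n hz0 hz hc
  set ψ0 := bvl q q' (ydim q z) N ((List.finRange n).map fun j : Fin n => z j) c0 with hψ0
  let D1 : Q := (Tq (cc q) (cc q') yy (cc x) N - Matrix.scalar _ (MvPolynomial.C tp)).det
  let D2 : Q := 1 + cc (-ψ0⁻¹) * bvl (cc q) (cc q') yy N
    (((List.finRange n).map fun j : Fin n => z j).map cc) c0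
  obtain ⟨p1, hp1⟩ := sym_poly N D1 φ0 φd
  obtain ⟨p2, hp2⟩ := sym_poly N D2 φ0 φd
  -- evaluation
  let yn : (Fin N → ℂ) → ℕ → ℂ := fun y k => if h : k < N then y ⟨k, h⟩ else ydim q z k
  have hev : ∀ (s : ℂ) (y : Fin N → ℂ), ∀ w : ℂ, MvPolynomial.eval₂Hom (Polynomial.evalRingHom s) y (cc w) = w := by
    intro s y w; simp [cc]
  have hevy : ∀ (s : ℂ) (y : Fin N → ℂ), (MvPolynomial.eval₂Hom (Polynomial.evalRingHom s) y) ∘ yy = yn y := by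
    intro s y; funext k
    by_cases h : k < N
    · simp [yy, yn, h]
    · simp only [yy, yn, h, Function.comp, dite_false]; exact hev s y _
  have hD1 : ∀ (s : ℂ) (y : Fin N → ℂ), MvPolynomial.eval₂Hom (Polynomial.evalRingHom s) y D1 =
      (Tq q q' (yn y) x N - Matrix.scalar _ (tt φ0 + s * tt φd)).det := by
    intro s y
    simp only [D1]
    rw [RingHom.map_det, RingHom.mapMatrix_apply, Matrix.map_sub _ (map_sub _), Tq_map, hevy, hev, hev, hev]
    congr 2
    ext i j
    by_cases h : i = j
    · subst h; simp [tp]; ring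
    · simp [h]
  have hD2 : ∀ (s : ℂ) (y : Fin N → ℂ), MvPolynomial.eval₂Hom (Polynomial.evalRingHom s) y D2 =
      1 + -ψ0⁻¹ * bvl q q' (yn y) N ((List.finRange n).map fun j : Fin n => z j) c0 := by
    intro s y
    simp only [D2]
    rw [map_add, map_one, map_mul, bvl_map, hevy, hev, hev, hev, List.map_map]
    congr 3
    convert List.map_id _
    funext w; exact hev s y w
  -- product formulas
  have hprod : ∀ (s : ℂ) (y : Fin N → ℂ), ∏ k, (Polynomial.X - Polynomial.C (y k)) = φ0 + Polynomial.C s * φd →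
      ∀ e : Equiv.Perm (Fin N), ∀ w : ℂ, ∏ k ∈ Finset.range N, (w - yn (y ∘ e) k) =
        (φ0 + Polynomial.C s * φd).eval w := by
    intro s y hy e w
    rw [Finset.prod_range, ← hy, Polynomial.eval_prod]
    simp only [Polynomial.eval_sub, Polynomial.eval_X, Polynomial.eval_C]
    rw [← Equiv.prod_comp e (fun k => w - y k)]
    exact Finset.prod_congr rfl fun k _ => by simp [yn]
  have hprod' : ∀ (y : ℕ → ℂ) (w : ℂ), ∏ k ∈ Finset.range N, (w * q - y k * q') =
      q' ^ N * ∏ k ∈ Finset.range N, (w * (q * q) - y k) := by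
    intro y w
    have hcst : q' ^ N = ∏ k ∈ Finset.range N, q' := by rw [Finset.prod_const, Finset.card_range]
    rw [hcst, ← Finset.prod_mul_distrib]
    exact Finset.prod_congr rfl fun k _ => by linear_combination (-w * q) * hq
  have h0e : ∀ w, φ0.eval w = (w - 1) ^ N := by intro w; simp [φ0]
  have h0e' : ∀ w, q' ^ N * φ0.eval (w * (q * q)) = (w * q - q') ^ N := by
    intro w; rw [h0e, ← mul_pow]; congr 1; linear_combination (w * q) * hq
  have h1e : ∀ j : Fin n, φ1.eval (z j) = 0 ∧ φ1.eval (z j * (q * q)) = 0 := by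
    intro j
    have hj := j.2
    simp only [φ1, Polynomial.eval_prod, Polynomial.eval_sub, Polynomial.eval_X, Polynomial.eval_C]
    constructor
    · apply Finset.prod_eq_zero (Finset.mem_univ (⟨2 * j + 1, by omega⟩ : Fin N))
      have h1 : (2 * (j : ℕ) + 1) % 2 = 1 := by omega
      have h2 : (2 * (j : ℕ) + 1) / 2 = j := by omega
      simp [ydim, h1, h2]
    · apply Finset.prod_eq_zero (Finset.mem_univ (⟨2 * j, by omega⟩ : Fin N))
      simp [ydim]
  have main : ∀ s, p1.eval s * (p2.eval s - 1) = 0 := by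
    intro s
    -- roots
    have hmon : (φ0 + Polynomial.C s * φd).Monic ∧ (φ0 + Polynomial.C s * φd).natDegree = N := by
      have m0 : φ0.Monic := (Polynomial.monic_X_sub_C 1).pow N
      have m1 : φ1.Monic := Polynomial.monic_prod_of_monic _ _ fun k _ => Polynomial.monic_X_sub_C _
      have d0 : φ0.natDegree = N := by
        rw [Polynomial.natDegree_pow, Polynomial.natDegree_X_sub_C, mul_one]
      have d1 : φ1.natDegree = N := by simp [φ1]
      have dd : φd.degree < φ0.degree := by
        show (φ1 - φ0).degree < _
        rw [← neg_sub, Polynomial.degree_neg]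
        refine Polynomial.degree_sub_lt ?_ m0.ne_zero (by rw [m0.leadingCoeff, m1.leadingCoeff])
        rw [Polynomial.degree_eq_natDegree m0.ne_zero, Polynomial.degree_eq_natDegree m1.ne_zero, d0, d1]
      have dd' : (Polynomial.C s * φd).degree < φ0.degree :=
        by
        refine lt_of_le_of_lt (Polynomial.degree_mul_le _ _) (lt_of_le_of_lt ?_ dd)
        calc _ ≤ 0 + φd.degree := by gcongr; exact Polynomial.degree_C_le
          _ = _ := zero_add _
      exact ⟨m0.add_of_left dd', by
        rw [Polynomial.natDegree_add_eq_left_of_degree_lt dd', d0]⟩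
    have hspl := IsAlgClosed.splits (φ0 + Polynomial.C s * φd)
    have hroots := hspl.eq_prod_roots_of_monic hmon.1
    have hcard := hspl.natDegree_eq_card_roots
    rw [hmon.2] at hcard
    obtain ⟨y, hy⟩ : ∃ y : Fin N → ℂ, ∏ k, (Polynomial.X - Polynomial.C (y k)) = φ0 + Polynomial.C s * φd := by
      refine ⟨fun k => (φ0 + Polynomial.C s * φd).roots.toList.get (k.cast (by simp [hcard])), ?_⟩
      conv_rhs => rw [hroots, ← Multiset.coe_toList (φ0 + Polynomial.C s * φd).roots]
      rw [Multiset.map_coe, Multiset.prod_coe, ← List.prod_ofFn]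
      congr 1
      apply List.ext_get
      · simp [hcard]
      · intro i h1 h2; simp
    rw [← hp1 s y hy, ← hp2 s y hy]
    by_cases hdet : ∃ e : Equiv.Perm (Fin N), MvPolynomial.eval₂Hom (Polynomial.evalRingHom s) (y ∘ e) D1 = 0
    · obtain ⟨e, he⟩ := hdet
      rw [Finset.prod_eq_zero (Finset.mem_univ e) he, zero_mul]
    · push Not at hdet
      rw [mul_eq_zero]; right
      rw [sub_eq_zero]
      refine Finset.prod_eq_one fun e _ => ?_
      rw [hD2]
      have hde := hdet e
      rw [hD1] at hde
      have hb := bethe q q' hq (yn (y ∘ e)) N n (fun j : Fin n => z j)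
        (fun i j h => by
          by_contra hij
          exact hz i i.2 j j.2 (fun h' => hij (Fin.ext h')) h) x (fun j => hx j j.2)
        (fun i j => hc i i.2 j j.2) (fun j => hcx j j.2)
        (by
          intro j
          rw [hprod', hprod s y hy, hprod s y hy]
          simp only [Polynomial.eval_add, Polynomial.eval_mul, Polynomial.eval_C, φd, Polynomial.eval_sub,
            (h1e j).1, (h1e j).2]
          have := hbae j
          rw [← h0e, ← h0e'] at this
          linear_combination (1 - s) * this)
      rw [hprod', hprod s y hy, hprod s y hy] at hb
      have hb' : (Tq q q' (yn (y ∘ e)) x N - Matrix.scalar _ (tt φ0 + s * tt φd)).mulVec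
          (bvl q q' (yn (y ∘ e)) N ((List.finRange n).map fun j : Fin n => z j)) = 0 := by
        rw [Matrix.sub_mulVec, hb, ← htt]
        simp only [tt, Matrix.scalar_apply, ← Matrix.smul_one_eq_diagonal, Matrix.smul_mulVec,
          Matrix.one_mulVec]
        exact sub_self _
      have hz' := Matrix.eq_zero_of_mulVec_eq_zero hde hb'
      rw [hz']; simp
  have hmul : p1 * (p2 - 1) = 0 := Polynomial.funext fun s => by
    simpa using main s
  have hp2' : p2.eval 1 = 0 := by
    have h1 : ∏ k : Fin N, (Polynomial.X - Polynomial.C (ydim q z k)) = φ0 + Polynomial.C 1 * φd := by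
      simp [φd, φ1]
    rw [← hp2 1 (fun k : Fin N => ydim q z k) h1]
    apply Finset.prod_eq_zero (Finset.mem_univ 1)
    rw [hD2]
    have : yn ((fun k : Fin N => ydim q z k) ∘ (1 : Equiv.Perm (Fin N))) = ydim q z := by
      funext k; simp [yn]
    rw [this, ← hψ0]
    field_simp; simp
  have hp10 : p1 = 0 := by
    rcases mul_eq_zero.1 hmul with h | h
    · exact h
    · rw [sub_eq_zero] at h
      rw [h] at hp2'; simp at hp2'
  have hfin := hp1 0 (fun _ => 1) (by simp [φ0])
  rw [hp10, Polynomial.eval_zero, Finset.prod_eq_zero_iff] at hfin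
  obtain ⟨e, _, he⟩ := hfin
  rw [hD1] at he
  have e1 : Tq q q' (yn ((fun _ => 1) ∘ e)) x N = Tq q q' (fun _ => 1) x N := by
    simp only [Tq]
    rw [mono_congr (Lq q q' (yn ((fun _ => 1) ∘ e)) x) (Lq q q' (fun _ => 1) x) N]
    intro k hk
    simp [Lq, yn, hk]
  rw [e1] at he
  convert he using 4
  simp only [zero_mul, add_zero, tt, h0e']; rw [h0e]

section cyc
variable {R κ : Type*} [CommRing R] [Fintype κ] [DecidableEq κ]

def pathP (A : ℕ → Matrix κ κ R) : ℕ → Matrix κ κ R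
  | 0 => 1
  | n + 1 => A n * pathP A n

theorem pathP_const (V : Matrix κ κ R) (n : ℕ) : pathP (fun _ => V) n = V ^ n := by
  induction n with
  | zero => simp [pathP]
  | succ n ih => rw [pathP, ih, pow_succ']

theorem pathP_apply (A : ℕ → Matrix κ κ R) (n : ℕ) (x y : κ) :
    pathP A n x y = ∑ h : Fin n → κ, if (Fin.cons y h : Fin (n + 1) → κ) (Fin.last n) = x then
      ∏ i : Fin n, A i (h i) ((Fin.cons y h : Fin (n + 1) → κ) i.castSucc) else 0 := by
  induction n generalizing x with
  | zero =>
    simp [pathP, Matrix.one_apply, eq_comm]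
  | succ n ih =>
    rw [pathP, Matrix.mul_apply]
    rw [← (Fin.snocEquiv (fun _ => κ)).sum_comp, Fintype.sum_prod_type]
    have h0 : ∀ (x' : κ) (h : Fin n → κ), (Fin.snocEquiv (fun _ : Fin (n+1) => κ)) (x', h) = Fin.snoc h x' := fun _ _ => rfl
    simp only [h0, Fin.cons_snoc_eq_snoc_cons, Fin.snoc_last, Fin.prod_univ_castSucc, Fin.snoc_castSucc]
    simp only [ih, Finset.mul_sum]
    conv_rhs => rw [Finset.sum_eq_single x (by intro b _ hb; simp [hb]) (by simp)]
    rw [Finset.sum_comm]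
    refine Finset.sum_congr rfl fun h _ => ?_
    rw [Finset.sum_eq_single ((Fin.cons y h : Fin (n + 1) → κ) (Fin.last n))
      (by intro b _ hb; simp [hb.symm]) (by simp)]
    simp only [if_true, Fin.val_castSucc, Fin.val_last]
    rw [mul_comm]

theorem cyc (A : ℕ → Matrix κ κ R) (n : ℕ) (hn : 0 < n) :
    ∑ h : Fin n → κ, ∏ i : Fin n, A i (h i) (h (predF i)) = (pathP A n).trace := by
  obtain ⟨n, rfl⟩ : ∃ m, n = m + 1 := ⟨n - 1, by omega⟩
  simp only [Matrix.trace, Matrix.diag_apply, pathP_apply]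
  rw [Finset.sum_comm]
  refine Finset.sum_congr rfl fun h _ => ?_
  have h1 : ∀ y, (Fin.cons y h : Fin (n + 2) → κ) (Fin.last (n + 1)) = h (Fin.last n) := by
    intro y; rw [← Fin.succ_last, Fin.cons_succ]
  simp only [h1]
  rw [Finset.sum_ite_eq]
  simp only [Finset.mem_univ, if_true]
  refine Finset.prod_congr rfl fun i _ => ?_
  congr 1
  refine Fin.cases ?_ (fun j => ?_) i
  · simp only [Fin.castSucc_zero, Fin.cons_zero]
    congr 1; ext; simp [predF, Nat.mod_eq_of_lt]
  · rw [← Fin.succ_castSucc, Fin.cons_succ]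
    congr 1; ext
    simp only [predF, Fin.val_castSucc, Fin.val_succ]
    have := j.2
    rw [show (j : ℕ) + 1 + (n + 1 - 1) = j + (n + 1) by omega, Nat.add_mod_right, Nat.mod_eq_of_lt (by omega)]
end cyc

def toN : (n : ℕ) → Ch n → ℕ → Bool
  | 0, _, _ => false
  | n + 1, c, k => if k = n then c.1 else toN n c.2 k

theorem toN_inj (n : ℕ) (c d : Ch n) (h : ∀ k < n, toN n c k = toN n d k) : c = d := by
  induction n with
  | zero => rfl
  | succ n ih =>
    apply Prod.ext
    · have := h n (by omega); simpa [toN] using this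
    · apply ih
      intro k hk
      have := h k (by omega); simpa [toN, hk.ne] using this

theorem card_Ch (n : ℕ) : Fintype.card (Ch n) = 2 ^ n := by
  induction n with
  | zero => rfl
  | succ n ih =>
    have : Fintype.card (Ch (n + 1)) = Fintype.card (Bool × Ch n) := rfl
    rw [this, Fintype.card_prod, ih, Fintype.card_bool, pow_succ']

def toFE (n : ℕ) : Ch n ≃ (Fin n → Bool) :=
  Equiv.ofBijective (fun c k => toN n c k) ((Fintype.bijective_iff_injective_and_card _).2
    ⟨fun c d h => toN_inj n c d fun k hk => congrFun h ⟨k, hk⟩, by simp [card_Ch]⟩)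

theorem mono_path {R : Type*} [CommRing R] (L : ℕ → Bool → Bool → Matrix Bool Bool R) (n : ℕ)
    (σ τ : Ch n) (i j : Bool) :
    mono L n i j σ τ = pathP (fun k => (fun i j => L k i j (toN n σ k) (toN n τ k) : Matrix Bool Bool R)) n i j := by
  induction n generalizing i j with
  | zero =>
    cases i <;> cases j <;> simp [mono, pathP] <;> rfl
  | succ n ih =>
    have h : ∀ (A B : ℕ → Matrix Bool Bool R) m, (∀ k < m, A k = B k) → pathP A m = pathP B m := by
      intro A B m hm
      induction m with
      | zero => rfl
      | succ m ihm => rw [pathP, pathP, hm m (by omega), ihm fun k hk => hm k (by omega)]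
    refine (mono_succ L n i j σ.1 τ.1 σ.2 τ.2).trans (Eq.trans ?_ (Matrix.mul_apply (i := i) (k := j)).symm)
    refine Finset.sum_congr rfl fun k _ => ?_
    rw [ih]
    congr 1
    · simp [toN]
    · refine congrFun (congrFun (h _ _ n fun m hm => ?_) k) j
      ext i j; simp [toN, hm.ne]

/-- row-to-row transfer matrix -/
def TT {R : Type*} [CommRing R] (a b c : R) (n : ℕ) : Matrix (Ch n) (Ch n) R :=
  mono (fun _ => lw a b c c) n false false + mono (fun _ => lw a b c c) n true true

theorem TT_apply {R : Type*} [CommRing R] (a b c : R) (n : ℕ) (hn : 0 < n) (σ τ : Ch n) :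
    TT a b c n σ τ = ∑ h : Fin n → Bool, ∏ i : Fin n, lw a b c c (h i) (h (predF i)) (toFE n σ i) (toFE n τ i) := by
  have := cyc (fun k => (fun i j => lw a b c c i j (toN n σ k) (toN n τ k) : Matrix Bool Bool R)) n hn
  refine Eq.trans ?_ this.symm
  rw [TT, Matrix.add_apply, mono_path, mono_path]
  simp [Matrix.trace, add_comm]

theorem Z_trace (N M : ℕ) (hN : 0 < N) (hM : 0 < M) (a b c : ℝ) :
    Z N M a b c = (TT a b c N ^ M).trace := by
  rw [← pathP_const, ← cyc _ _ hM]
  simp only [TT_apply a b c N hN]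
  simp only [Finset.prod_univ_sum, Fintype.piFinset_univ]
  rw [Z, Fintype.sum_prod_type, Finset.sum_comm]
  -- reindex
  let e1 : (Fin M → Ch N) ≃ (Fin N × Fin M → Bool) :=
    ((Equiv.refl (Fin M)).arrowCongr (toFE N)).trans
      ((Equiv.curry (Fin M) (Fin N) Bool).symm.trans ((Equiv.prodComm (Fin M) (Fin N)).arrowCongr (Equiv.refl Bool)))
  let e2 : (Fin M → Fin N → Bool) ≃ (Fin N × Fin M → Bool) :=
      ((Equiv.curry (Fin M) (Fin N) Bool).symm.trans ((Equiv.prodComm (Fin M) (Fin N)).arrowCongr (Equiv.refl Bool)))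
  rw [← e1.sum_comp]
  refine Finset.sum_congr rfl fun w _ => ?_
  rw [← e2.sum_comp]
  refine Finset.sum_congr rfl fun h _ => ?_
  have he1 : ∀ i j, e1 w (i, j) = toFE N (w j) i := fun _ _ => rfl
  have he2 : ∀ i j, e2 h (i, j) = h j i := fun _ _ => rfl
  have hW : ∀ i j, (if inArrows (e2 h, e1 w) (i, j) = 2 then vWeight a b c (e2 h, e1 w) (i, j) else 0) =
      lw a b c c (h j i) (h j (predF i)) (toFE N (w j) i) (toFE N (w (predF j)) i) := by
    intro i j
    simp only [inArrows, vWeight, he1, he2]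
    cases h j i <;> cases h j (predF i) <;> cases toFE N (w j) i <;> cases toFE N (w (predF j)) i <;> simp [lw]
  rw [Finset.prod_comm]
  simp only [← hW]
  rw [← Finset.prod_product', Finset.univ_product_univ]
  by_cases hs : IsSixVertex (e2 h, e1 w)
  · rw [if_pos hs, W]
    exact Finset.prod_congr rfl fun v _ => by rw [if_pos (hs v)]
  · rw [if_neg hs]
    simp only [IsSixVertex, not_forall] at hs
    obtain ⟨v, hv⟩ := hs
    exact (Finset.prod_eq_zero (Finset.mem_univ v) (by rw [if_neg hv])).symm

section tr
variable {κ : Type*} [Fintype κ] [DecidableEq κ] [Nonempty κ]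

theorem pow_nonneg_entry (V : Matrix κ κ ℝ) (hV : ∀ s t, 0 ≤ V s t) (n : ℕ) (s t : κ) : 0 ≤ (V ^ n) s t := by
  induction n generalizing t with
  | zero => rw [pow_zero, Matrix.one_apply]; split_ifs <;> norm_num
  | succ n ih => rw [pow_succ, Matrix.mul_apply]; exact Finset.sum_nonneg fun k _ => mul_nonneg (ih k) (hV _ _)

theorem diag_super (V : Matrix κ κ ℝ) (hV : ∀ s t, 0 ≤ V s t) (m n : ℕ) (s : κ) :
    (V ^ m) s s * (V ^ n) s s ≤ (V ^ (m + n)) s s := by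
  rw [pow_add, Matrix.mul_apply]
  exact Finset.single_le_sum (f := fun k => (V ^ m) s k * (V ^ n) k s)
    (fun k _ => mul_nonneg (pow_nonneg_entry V hV m _ _) (pow_nonneg_entry V hV n _ _)) (Finset.mem_univ s)

theorem diag_pos (V : Matrix κ κ ℝ) (hV : ∀ s t, 0 ≤ V s t) (hd : ∀ s, 0 < V s s) (n : ℕ) (s : κ) :
    0 < (V ^ n) s s := by
  induction n with
  | zero => simp
  | succ n ih =>
    refine lt_of_lt_of_le (mul_pos ih (hd s)) ?_
    simpa using diag_super V hV n 1 s

theorem diag_le (V : Matrix κ κ ℝ) (hV : ∀ s t, 0 ≤ V s t) (n : ℕ) (s t : κ) :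
    (V ^ n) s t ≤ (1 + ∑ u, ∑ v, V u v) ^ n := by
  set S := 1 + ∑ u, ∑ v, V u v
  have hS : ∀ u, ∑ v, V u v ≤ S := by
    intro u
    have := Finset.single_le_sum (f := fun u => ∑ v, V u v) (fun u _ => Finset.sum_nonneg fun v _ => hV u v) (Finset.mem_univ u)
    simp only [S]; linarith
  have h : ∀ s, ∑ t, (V ^ n) s t ≤ S ^ n := by
    induction n with
    | zero => intro s; simp [Matrix.one_apply]
    | succ n ih =>
      intro s
      simp only [pow_succ, Matrix.mul_apply]
      rw [Finset.sum_comm]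
      simp only [← Finset.mul_sum]
      calc _ ≤ ∑ k, (V ^ n) s k * S := Finset.sum_le_sum fun k _ =>
            mul_le_mul_of_nonneg_left (hS k) (pow_nonneg_entry V hV n _ _)
        _ = (∑ k, (V ^ n) s k) * S := by rw [Finset.sum_mul]
        _ ≤ _ := mul_le_mul_of_nonneg_right (ih s) (by
          have := Finset.sum_nonneg fun u (_ : u ∈ Finset.univ) => Finset.sum_nonneg fun v (_ : v ∈ Finset.univ) => hV u v
          simp only [S]; linarith)
  exact (Finset.single_le_sum (fun t _ => pow_nonneg_entry V hV n s t) (Finset.mem_univ t)).trans (h s)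

theorem trace_lim (V : Matrix κ κ ℝ) (hV : ∀ s t, 0 ≤ V s t) (hd : ∀ s, 0 < V s s) :
    ∃ l : ℝ, Tendsto (fun M : ℕ => Real.log ((V ^ M).trace) / M) atTop (nhds l) := by
  have h1 : ∀ s, ∃ l, Tendsto (fun M : ℕ => Real.log ((V ^ M) s s) / M) atTop (nhds l) := by
    intro s
    have hsub : Subadditive fun n => - Real.log ((V ^ n) s s) := by
      intro m n
      have := Real.log_le_log (mul_pos (diag_pos V hV hd m s) (diag_pos V hV hd n s)) (diag_super V hV m n s)
      rw [Real.log_mul (diag_pos V hV hd m s).ne' (diag_pos V hV hd n s).ne'] at this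
      linarith
    have hb : BddBelow (Set.range fun n : ℕ => (- Real.log ((V ^ n) s s)) / n) := by
      set S := 1 + ∑ u, ∑ v, V u v with hS
      have hS1 : 1 ≤ S := by
        have := Finset.sum_nonneg fun u (_ : u ∈ Finset.univ) => Finset.sum_nonneg fun v (_ : v ∈ Finset.univ) => hV u v
        simp only [S]; linarith
      refine ⟨- Real.log S, ?_⟩
      rintro _ ⟨n, rfl⟩
      rcases Nat.eq_zero_or_pos n with rfl | hn
      · simp; exact Real.log_nonneg hS1
      have := Real.log_le_log (diag_pos V hV hd n s) (diag_le V hV n s s)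
      rw [Real.log_pow] at this
      show _ ≤ (- Real.log ((V ^ n) s s)) / n
      rw [le_div_iff₀ (by exact_mod_cast hn)]
      linarith
    refine ⟨- hsub.lim, ?_⟩
    have := (hsub.tendsto_lim hb).neg
    refine this.congr fun n => by ring
  choose l hl using h1
  have hsup := Filter.Tendsto.finset_sup'_nhds_apply (Finset.univ_nonempty (α := κ)) (fun s _ => hl s)
  refine ⟨_, tendsto_of_tendsto_of_tendsto_of_le_of_le' hsup (h := fun M : ℕ =>
    Finset.univ.sup' Finset.univ_nonempty (fun s => Real.log ((V ^ M) s s) / M) + Real.log (Fintype.card κ) / M)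
    ?_ ?_ ?_⟩
  · simpa using hsup.add (tendsto_const_div_atTop_nhds_zero_nat (Real.log (Fintype.card κ)))
  · filter_upwards with M
    refine Finset.sup'_le _ _ fun s _ => ?_
    gcongr
    · exact diag_pos V hV hd M s
    · exact Finset.single_le_sum (f := fun s => (V ^ M) s s) (fun s _ => (diag_pos V hV hd M s).le) (Finset.mem_univ s)
  · filter_upwards [eventually_gt_atTop 0] with M hM
    obtain ⟨s, _, hs⟩ := Finset.exists_max_image Finset.univ (fun s => (V ^ M) s s) Finset.univ_nonempty
    refine le_trans ?_ (add_le_add_left (Finset.le_sup' (fun s => Real.log ((V ^ M) s s) / M) (Finset.mem_univ s)) _)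
    rw [← add_div]
    gcongr
    rw [add_comm, ← Real.log_mul (by simp) (diag_pos V hV hd M s).ne']
    apply Real.log_le_log
    · exact Finset.sum_pos (fun s _ => diag_pos V hV hd M s) Finset.univ_nonempty
    · have := Finset.sum_le_card_nsmul Finset.univ (fun s => (V ^ M) s s) ((V ^ M) s s) (fun t _ => hs t (Finset.mem_univ t))
      simpa [Matrix.trace] using this

theorem trace_map_pow (V : Matrix κ κ ℝ) (M : ℕ) :
    (((V ^ M).trace : ℝ) : ℂ) = (((V.map Complex.ofReal) ^ M).charpoly.roots).sum := by
  rw [← Matrix.trace_eq_sum_roots_charpoly]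
  have : (V.map Complex.ofReal) ^ M = (V ^ M).map Complex.ofReal := by
    have := (map_pow (Complex.ofRealHom.mapMatrix (m := κ)) V M)
    exact this.symm
  rw [this]
  simp [Matrix.trace]

theorem root_pow (A : Matrix κ κ ℂ) (M : ℕ) (z : ℂ) :
    z ∈ (A ^ M).charpoly.roots ↔ ∃ w ∈ spectrum ℂ A, w ^ M = z := by
  rw [Polynomial.mem_roots (Matrix.charpoly_monic _).ne_zero, ← Matrix.mem_spectrum_iff_isRoot_charpoly]
  have := spectrum.map_pow_of_nonempty (𝕜 := ℂ) (a := A) (spectrum.nonempty_of_isAlgClosed_of_finiteDimensional ℂ A) M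
  rw [this]
  rfl

theorem lim_le (V : Matrix κ κ ℝ) (hV : ∀ s t, 0 ≤ V s t) (hd : ∀ s, 0 < V s s) (l r : ℝ) (hr : 0 < r)
    (hl : Tendsto (fun M : ℕ => Real.log ((V ^ M).trace) / M) atTop (nhds l))
    (h : ∀ w ∈ spectrum ℂ (V.map Complex.ofReal), ‖w‖ ≤ r) : l ≤ Real.log r := by
  have h2 : Tendsto (fun M : ℕ => Real.log (Fintype.card κ) / M + Real.log r) atTop (nhds (0 + Real.log r)) :=
    (tendsto_const_div_atTop_nhds_zero_nat (Real.log (Fintype.card κ))).add_const _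
  rw [zero_add] at h2
  refine le_of_tendsto_of_tendsto hl h2 ?_
  filter_upwards [eventually_gt_atTop 0] with M hM
  have hM' : (0 : ℝ) < M := by exact_mod_cast hM
  have ht : (V ^ M).trace ≤ Fintype.card κ * r ^ M := by
    have h3 : ‖(((V ^ M).trace : ℝ) : ℂ)‖ ≤ Fintype.card κ * r ^ M := by
      rw [trace_map_pow]
      set A := (V.map Complex.ofReal)
      have h4 : ∀ z ∈ (A ^ M).charpoly.roots, ‖z‖ ≤ r ^ M := by
        intro z hz
        obtain ⟨w, hw, rfl⟩ := (root_pow A M z).1 hz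
        rw [norm_pow]; gcongr; exact h w hw
      refine (norm_multiset_sum_le _).trans ?_
      refine (Multiset.sum_le_card_nsmul _ (r ^ M) ?_).trans ?_
      · intro x hx
        obtain ⟨z, hz, rfl⟩ := Multiset.mem_map.1 hx
        exact h4 z hz
      · rw [nsmul_eq_mul, Multiset.card_map]
        gcongr
        exact (Polynomial.card_roots' _).trans (Matrix.charpoly_natDegree_eq_dim _).le
    rw [Complex.norm_real] at h3
    exact (le_abs_self _).trans h3
  have hpos : 0 < (V ^ M).trace := Finset.sum_pos (fun s _ => diag_pos V hV hd M s) Finset.univ_nonempty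
  have := Real.log_le_log hpos ht
  rw [Real.log_mul (by simp) (pow_pos hr M).ne', Real.log_pow] at this
  rw [div_add' _ _ _ hM'.ne', div_le_div_iff_of_pos_right hM']
  linarith

theorem le_lim (V : Matrix κ κ ℝ) (l : ℝ) (w0 : ℂ) (hw0 : w0 ≠ 0)
    (hl : Tendsto (fun M : ℕ => Real.log ((V ^ M).trace) / M) atTop (nhds l))
    (h : w0 ∈ spectrum ℂ (V.map Complex.ofReal)) : Real.log ‖w0‖ ≤ l := by
  set A := (V.map Complex.ofReal) with hA
  have hfin : (spectrum ℂ A).Finite := Matrix.finite_spectrum A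
  haveI := hfin.to_subtype
  haveI := Fintype.ofFinite (spectrum ℂ A)
  let x : spectrum ℂ A → Circle := fun w => Circle.exp (Complex.arg w)
  have hx : ∀ w : spectrum ℂ A, (w : ℂ) = ‖(w : ℂ)‖ * (x w : ℂ) := by
    intro w; simp only [x, Circle.coe_exp]; exact (Complex.norm_mul_exp_arg_mul_I _).symm
  have hcl := mapClusterPt_one_atTop_pow x
  let U : Set (spectrum ℂ A → Circle) := {y | ∀ w, (1:ℝ) / 2 < ((y w : ℂ)).re}
  have hU : U ∈ nhds (1 : spectrum ℂ A → Circle) := by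
    refine IsOpen.mem_nhds ?_ ?_
    · have : U = ⋂ w, {y | (1:ℝ) / 2 < ((y w : ℂ)).re} := by ext; simp [U]
      rw [this]
      refine isOpen_iInter_of_finite fun w => isOpen_lt continuous_const ?_
      exact Complex.continuous_re.comp (continuous_subtype_val.comp (continuous_apply w))
    · intro w; norm_num
  have hfr := (mapClusterPt_iff_frequently.1 hcl) U hU
  have hlow : ∃ᶠ M : ℕ in atTop, Real.log ‖w0‖ - Real.log 2 / M ≤ Real.log ((V ^ M).trace) / M := by
    refine (hfr.and_eventually (eventually_gt_atTop 0)).mono fun M hM => ?_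
    obtain ⟨hM, hM0⟩ := hM
    have hM' : (0 : ℝ) < M := by exact_mod_cast hM0
    have hre : ∀ w ∈ spectrum ℂ A, ‖w‖ ^ M / 2 ≤ (w ^ M).re := by
      intro w hw
      have h1 := hM ⟨w, hw⟩
      have h2 := hx ⟨w, hw⟩
      simp only at h2
      conv_rhs => rw [h2, mul_pow, ← Complex.ofReal_pow, Complex.re_ofReal_mul]
      have h3 : (1 : ℝ) / 2 < ((x ⟨w, hw⟩ : ℂ) ^ M).re := by simpa using h1
      have := pow_nonneg (norm_nonneg w) M
      nlinarith
    have htr : ‖w0‖ ^ M / 2 ≤ (V ^ M).trace := by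
      have h4 : (V ^ M).trace = ((A ^ M).charpoly.roots.map Complex.re).sum := by
        have h5 := congrArg Complex.re (trace_map_pow V M)
        rw [Complex.ofReal_re] at h5
        rw [h5]
        exact map_multiset_sum Complex.reAddGroupHom _
      rw [h4]
      refine (hre w0 h).trans ?_
      refine Multiset.single_le_sum ?_ _ (Multiset.mem_map_of_mem _ ((root_pow A M _).2 ⟨w0, h, rfl⟩))
      intro r hr
      obtain ⟨z, hz, rfl⟩ := Multiset.mem_map.1 hr
      obtain ⟨w, hw, rfl⟩ := (root_pow A M z).1 hz
      exact le_trans (by positivity) (hre w hw)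
    have hpos : 0 < ‖w0‖ ^ M / 2 := by have := norm_pos_iff.2 hw0; positivity
    have := Real.log_le_log hpos htr
    rw [Real.log_div (by positivity) (by norm_num), Real.log_pow] at this
    rw [sub_le_iff_le_add, ← add_div, le_div_iff₀ hM']
    linarith
  by_contra hlt
  push Not at hlt
  have h1 : Tendsto (fun M : ℕ => Real.log ‖w0‖ - Real.log 2 / M) atTop (nhds (Real.log ‖w0‖ - 0)) :=
    tendsto_const_nhds.sub (tendsto_const_div_atTop_nhds_zero_nat _)
  rw [sub_zero] at h1
  have := hl.eventually_lt h1 hlt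
  exact hlow (this.mono fun M hM => not_le.2 hM)
end tr

def gN (a b c : ℝ) (N : ℕ) : ℝ := limUnder atTop (fun M : ℕ => Real.log (Z N M a b c) / (M * N))

theorem lw_nonneg (a b c : ℝ) (ha : 0 < a) (hb : 0 < b) (hc : 0 < c) (i j s t : Bool) : 0 ≤ lw a b c c i j s t := by
  cases i <;> cases j <;> cases s <;> cases t <;> simp [lw, ha.le, hb.le, hc.le]

theorem TT_nonneg (a b c : ℝ) (ha : 0 < a) (hb : 0 < b) (hc : 0 < c) (N : ℕ) (hN : 0 < N) (σ τ : Ch N) :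
    0 ≤ TT a b c N σ τ := by
  rw [TT_apply _ _ _ _ hN]
  exact Finset.sum_nonneg fun h _ => Finset.prod_nonneg fun i _ => lw_nonneg a b c ha hb hc _ _ _ _

theorem TT_diag (a b c : ℝ) (ha : 0 < a) (hb : 0 < b) (hc : 0 < c) (N : ℕ) (hN : 0 < N) (σ : Ch N) :
    0 < TT a b c N σ σ := by
  rw [TT_apply _ _ _ _ hN]
  refine lt_of_lt_of_le ?_ (Finset.single_le_sum (f := fun h : Fin N → Bool =>
    ∏ i : Fin N, lw a b c c (h i) (h (predF i)) (toFE N σ i) (toFE N σ i))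
    (fun h _ => Finset.prod_nonneg fun i _ => lw_nonneg a b c ha hb hc _ _ _ _) (Finset.mem_univ (fun _ => false)))
  refine Finset.prod_pos fun i _ => ?_
  cases toFE N σ i <;> simp [lw, ha, hb]

instance instNonemptyCh (n : ℕ) : Nonempty (Ch n) := ⟨(toFE n).symm fun _ => false⟩

theorem TT_map (a b c : ℝ) (N : ℕ) : (TT a b c N).map Complex.ofReal = TT (a : ℂ) b c N := by
  ext σ τ
  simp only [TT, Matrix.map_apply, Matrix.add_apply, Complex.ofReal_add]
  have h : ∀ i j, ((mono (fun _ => lw a b c c) N i j σ τ : ℝ) : ℂ) = mono (fun _ => lw (a:ℂ) b c c) N i j σ τ := by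
    intro i j
    have := mono_map Complex.ofRealHom (fun _ => lw a b c c) N i j σ τ
    simp only [lw_map] at this
    exact this
  rw [h, h]

theorem g_all (a b c : ℝ) (ha : 0 < a) (hb : 0 < b) (hc : 0 < c) (N : ℕ) (hN : 0 < N) :
    Tendsto (fun M : ℕ => Real.log (Z N M a b c) / (M * N)) atTop (nhds (gN a b c N)) ∧
    (∀ r > 0, (∀ w ∈ spectrum ℂ (TT (a : ℂ) b c N), ‖w‖ ≤ r) → gN a b c N ≤ Real.log r / N) ∧
    (∀ w ∈ spectrum ℂ (TT (a : ℂ) b c N), w ≠ 0 → Real.log ‖w‖ / N ≤ gN a b c N) := by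
  obtain ⟨l, hl⟩ := trace_lim (TT a b c N) (TT_nonneg a b c ha hb hc N hN) (TT_diag a b c ha hb hc N hN)
  have hN' : (0 : ℝ) < N := by exact_mod_cast hN
  have h1 : Tendsto (fun M : ℕ => Real.log (Z N M a b c) / (M * N)) atTop (nhds (l / N)) := by
    refine (hl.div_const (N : ℝ)).congr' ?_
    filter_upwards [eventually_gt_atTop 0] with M hM
    rw [Z_trace N M hN hM, div_div]
  have h2 : gN a b c N = l / N := h1.limUnder_eq
  rw [h2]
  refine ⟨h1, fun r hr h => ?_, fun w hw hw0 => ?_⟩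
  · rw [← TT_map] at h
    have := lim_le _ (TT_nonneg a b c ha hb hc N hN) (TT_diag a b c ha hb hc N hN) l r hr hl h
    gcongr
  · rw [← TT_map] at hw
    have := le_lim _ l w hw0 hl hw
    gcongr

theorem Z_pos (a b c : ℝ) (ha : 0 < a) (hb : 0 < b) (hc : 0 < c) (N M : ℕ) (hN : 0 < N) (hM : 0 < M) :
    0 < Z N M a b c := by
  rw [Z_trace N M hN hM]
  exact Finset.sum_pos (fun s _ => diag_pos _ (TT_nonneg a b c ha hb hc N hN) (TT_diag a b c ha hb hc N hN) M s) Finset.univ_nonempty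

theorem Z_mono (a b c a' b' c' k : ℝ) (ha : 0 < a) (hb : 0 < b) (hc : 0 < c)
    (ha' : a ≤ k * a') (hb' : b ≤ k * b') (hc' : c ≤ k * c') (N M : ℕ) :
    Z N M a b c ≤ k ^ (N * M) * Z N M a' b' c' := by
  rw [Z, Z, Finset.mul_sum]
  refine Finset.sum_le_sum fun ω _ => ?_
  split_ifs with h
  · rw [W, W]
    have : k ^ (N * M) = ∏ v : Fin N × Fin M, k := by simp
    rw [this, ← Finset.prod_mul_distrib]
    refine Finset.prod_le_prod (fun v _ => ?_) fun v _ => ?_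
    · unfold vWeight; split_ifs <;> linarith
    · unfold vWeight; split_ifs <;> linarith
  · simp

theorem gN_mono (a b c a' b' c' k : ℝ) (ha : 0 < a) (hb : 0 < b) (hc : 0 < c)
    (ha0 : 0 < a') (hb0 : 0 < b') (hc0 : 0 < c') (hk : 0 < k)
    (ha' : a ≤ k * a') (hb' : b ≤ k * b') (hc' : c ≤ k * c') (N : ℕ) (hN : 0 < N) :
    gN a b c N ≤ Real.log k + gN a' b' c' N := by
  have hN' : (0 : ℝ) < N := by exact_mod_cast hN
  refine le_of_tendsto_of_tendsto (g_all a b c ha hb hc N hN).1 ((g_all a' b' c' ha0 hb0 hc0 N hN).1.const_add _) ?_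
  filter_upwards [eventually_gt_atTop 0] with M hM
  have hM' : (0 : ℝ) < M := by exact_mod_cast hM
  have := Real.log_le_log (Z_pos a b c ha hb hc N M hN hM) (Z_mono a b c a' b' c' k ha hb hc ha' hb' hc' N M)
  rw [Real.log_mul (by positivity) (Z_pos a' b' c' ha0 hb0 hc0 N M hN hM).ne', Real.log_pow] at this
  push_cast at this
  rw [add_div' _ _ _ (by positivity), div_le_div_iff_of_pos_right (by positivity)]
  linarith

theorem lw_unit (ζ : ℝ) (v : ℂ) (hv : v.re = 0) (u : Bool → Bool → ℂ) :
    ∑ i, ∑ s, ‖∑ k, ∑ t, lw (Complex.sin (ζ - v)) (Complex.sin v) (Complex.sin ζ) (Complex.sin ζ) i k s t * u k t‖ ^ 2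
      = ‖Complex.sin (ζ - v)‖ ^ 2 * ∑ k, ∑ t, ‖u k t‖ ^ 2 := by
  obtain ⟨y, rfl⟩ : ∃ y : ℝ, v = y * Complex.I := ⟨v.im, by apply Complex.ext <;> simp [hv]⟩
  have hb : Complex.sin (y * Complex.I) = (Real.sinh y : ℂ) * Complex.I := by rw [Complex.sin_mul_I]; simp
  have ha : Complex.sin (ζ - y * Complex.I) = (Real.sin ζ * Real.cosh y : ℝ) - (Real.cos ζ * Real.sinh y : ℝ) * Complex.I := by
    rw [Complex.sin_sub, Complex.sin_mul_I, Complex.cos_mul_I]; push_cast; ring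
  have hc : Complex.sin ζ = (Real.sin ζ : ℂ) := by simp
  rw [hb, ha, hc]
  simp only [Fintype.sum_bool, lw, Complex.sq_norm, Complex.normSq_apply]
  have h1 := Real.sin_sq_add_cos_sq ζ
  have h2 := Real.cosh_sq y
  generalize Real.sin ζ = S at *
  generalize Real.cos ζ = C at *
  generalize Real.cosh y = c at *
  generalize Real.sinh y = s at *
  generalize u true true = z1
  generalize u true false = z2
  generalize u false true = z3
  generalize u false false = z4
  simp
  have hC : C ^ 2 = 1 - S ^ 2 := by linarith
  ring_nf
  simp only [h2, hC]
  ring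

theorem mono_unit (ζ : ℝ) (v : ℂ) (hv : v.re = 0) (n : ℕ) (w : Bool → Ch n → ℂ) :
    ∑ i, ∑ σ, ‖∑ j, ∑ τ, mono (fun _ => lw (Complex.sin (ζ - v)) (Complex.sin v) (Complex.sin ζ) (Complex.sin ζ)) n i j σ τ * w j τ‖ ^ 2
      = (‖Complex.sin (ζ - v)‖ ^ 2) ^ n * ∑ j, ∑ τ, ‖w j τ‖ ^ 2 := by
  induction n with
  | zero =>
    simp only [pow_zero, one_mul]
    refine Finset.sum_congr rfl fun i _ => Finset.sum_congr rfl fun σ _ => ?_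
    congr 2
    rw [Finset.sum_eq_single i, Finset.sum_eq_single σ]
    · simp [mono]
    · intro τ _ h; exact absurd rfl h
    · simp
    · intro j _ h; simp [mono, h.symm]
    · simp
  | succ n ih =>
    set L := lw (Complex.sin (ζ - v)) (Complex.sin v) (Complex.sin ζ) (Complex.sin ζ)
    have hs : ∀ f : Ch (n + 1) → ℝ, ∑ σ, f σ = ∑ σ : Ch n, ∑ s, f (s, σ) := fun f =>
      (Fintype.sum_prod_type (α₁ := Bool) (α₂ := Ch n) f).trans Finset.sum_comm
    have hs' : ∀ f : Ch (n + 1) → ℂ, ∑ σ, f σ = ∑ s, ∑ σ : Ch n, f (s, σ) := fun f =>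
      (Fintype.sum_prod_type (α₁ := Bool) (α₂ := Ch n) f)
    let U : Bool → Ch n → Bool → ℂ := fun k σ t => ∑ j, ∑ τ, mono (fun _ => L) n k j σ τ * w j (t, τ)
    have h1 : ∀ i s σ, ∑ j, ∑ τ, mono (fun _ => L) (n + 1) i j (s, σ) τ * w j τ =
        ∑ k, ∑ t, L i k s t * U k σ t := by
      intro i s σ
      simp only [hs', U, mono_succ, Finset.mul_sum, Finset.sum_mul]
      rw [Finset.sum_comm' (t' := Finset.univ) (s' := fun _ => Finset.univ) (by simp)]
      conv_rhs => rw [Finset.sum_comm]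
      refine Finset.sum_congr rfl fun t _ => ?_
      rw [Finset.sum_comm]
      conv_rhs => rw [Finset.sum_comm' (t' := Finset.univ) (s' := fun _ => Finset.univ) (by simp)]
      rw [Finset.sum_comm]
      refine Finset.sum_congr rfl fun j _ => ?_
      conv_rhs => rw [Finset.sum_comm]
      refine Finset.sum_congr rfl fun τ _ => ?_
      refine Finset.sum_congr rfl fun k _ => ?_
      ring
    simp only [hs, h1]
    rw [Finset.sum_comm]
    simp only [lw_unit ζ v hv, L]
    rw [← Finset.mul_sum, pow_succ' (‖Complex.sin (ζ - v)‖ ^ 2) n, mul_assoc]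
    congr 1
    have h2 := fun t => ih (fun j τ => w j (t, τ))
    calc ∑ σ, ∑ k, ∑ t, ‖U k σ t‖ ^ 2 = ∑ t, ∑ k, ∑ σ, ‖U k σ t‖ ^ 2 := by
          rw [Finset.sum_comm, Finset.sum_comm' (t' := Finset.univ) (s' := fun _ => Finset.univ) (by simp)]
          simp only [Fintype.sum_bool, Finset.sum_add_distrib]; ring
      _ = ∑ t, (‖Complex.sin (ζ - v)‖ ^ 2) ^ n * ∑ j, ∑ τ, ‖w j (t, τ)‖ ^ 2 := Finset.sum_congr rfl fun t _ => h2 t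
      _ = _ := by
          rw [← Finset.mul_sum]
          congr 1
          simp only [hs, Fintype.sum_bool, Finset.sum_add_distrib]; ring

def bil (a b c : ℂ) (n : ℕ) (x w : Ch n → ℂ) : ℂ := ∑ σ, x σ * ∑ τ, TT a b c n σ τ * w τ

def l2 {α : Type*} [Fintype α] (x : α → ℂ) : ℝ := √(∑ σ, ‖x σ‖ ^ 2)

theorem bil_bound (ζ : ℝ) (v : ℂ) (hv : v.re = 0) (n : ℕ) (x w : Ch n → ℂ) :
    ‖bil (Complex.sin (ζ - v)) (Complex.sin v) (Complex.sin ζ) n x w‖ ≤ 2 * (l2 x * l2 w) * ‖Complex.sin (ζ - v)‖ ^ n := by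
  set L := lw (Complex.sin (ζ - v)) (Complex.sin v) (Complex.sin ζ) (Complex.sin ζ) with hL
  have h1 : ∀ i, ∑ σ, ‖∑ τ, mono (fun _ => L) n i i σ τ * w τ‖ ^ 2 ≤ (‖Complex.sin (ζ - v)‖ ^ 2) ^ n * ∑ τ, ‖w τ‖ ^ 2 := by
    intro i
    have := mono_unit ζ v hv n (fun j τ => if j = i then w τ else 0)
    have h3 : ∑ j, ∑ τ, ‖(if j = i then w τ else 0)‖ ^ 2 = ∑ τ, ‖w τ‖ ^ 2 := by
      rw [Finset.sum_eq_single i (by intro j _ h; simp [h]) (by simp)]; simp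
    rw [h3] at this
    rw [← this]
    refine le_trans (le_of_eq ?_) (Finset.single_le_sum (fun i _ => Finset.sum_nonneg fun σ _ => sq_nonneg _) (Finset.mem_univ i))
    refine Finset.sum_congr rfl fun σ _ => ?_
    congr 2
    rw [Finset.sum_eq_single i (by intro j _ h; simp [h]) (by simp)]; simp [L]
  have h2 : ∀ i, ‖∑ σ, x σ * ∑ τ, mono (fun _ => L) n i i σ τ * w τ‖ ≤ (l2 x * l2 w) * ‖Complex.sin (ζ - v)‖ ^ n := by
    intro i
    refine (norm_sum_le _ _).trans ?_
    simp only [norm_mul]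
    refine (Real.sum_mul_le_sqrt_mul_sqrt _ _ _).trans ?_
    rw [mul_assoc]
    refine mul_le_mul_of_nonneg_left ?_ (Real.sqrt_nonneg _)
    refine (Real.sqrt_le_sqrt (h1 i)).trans ?_
    rw [Real.sqrt_mul (by positivity), ← pow_mul, mul_comm 2 n, pow_mul, Real.sqrt_sq (by positivity), mul_comm, l2]
  have : bil (Complex.sin (ζ - v)) (Complex.sin v) (Complex.sin ζ) n x w =
    ∑ σ, x σ * ∑ τ, mono (fun _ => L) n false false σ τ * w τ + ∑ σ, x σ * ∑ τ, mono (fun _ => L) n true true σ τ * w τ := by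
    simp only [bil, TT, Matrix.add_apply, add_mul, Finset.sum_add_distrib, mul_add, L]
  rw [this]
  refine (norm_add_le _ _).trans ?_
  linarith [h2 false, h2 true]

def ng : (n : ℕ) → Ch n → Ch n
  | 0, c => c
  | n + 1, c => (!c.1, ng n c.2)

theorem ng_ng (n : ℕ) (c : Ch n) : ng n (ng n c) = c := by
  induction n with
  | zero => rfl
  | succ n ih => exact Prod.ext (Bool.not_not _) (ih _)

def ngE (n : ℕ) : Ch n ≃ Ch n := ⟨ng n, ng n, ng_ng n, ng_ng n⟩

theorem mono_cross (a b c : ℂ) (n : ℕ) (i j : Bool) (σ τ : Ch n) :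
    mono (fun _ => lw b a c c) n i j σ τ = mono (fun _ => lw a b c c) n i j (ng n τ) (ng n σ) := by
  induction n generalizing i with
  | zero => cases i <;> cases j <;> simp [mono] <;> rfl
  | succ n ih =>
    refine (mono_succ _ n i j σ.1 τ.1 σ.2 τ.2).trans (Eq.trans ?_ (mono_succ _ n i j (!τ.1) (!σ.1) (ng n τ.2) (ng n σ.2)).symm)
    refine Finset.sum_congr rfl fun k _ => ?_
    rw [ih]
    congr 1
    cases i <;> cases k <;> cases σ.1 <;> cases τ.1 <;> simp [lw]

theorem bil_cross (a b c : ℂ) (n : ℕ) (x w : Ch n → ℂ) :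
    bil b a c n x w = bil a b c n (w ∘ ng n) (x ∘ ng n) := by
  simp only [bil, Finset.mul_sum]
  rw [← (ngE n).sum_comp, Finset.sum_comm, ← (ngE n).sum_comp]
  refine Finset.sum_congr rfl fun σ _ => Finset.sum_congr rfl fun τ _ => ?_
  have h : ∀ σ, ngE n σ = ng n σ := fun _ => rfl
  simp only [TT, Matrix.add_apply, h, Function.comp]
  rw [mono_cross a b c n false false, mono_cross a b c n true true, ng_ng, ng_ng]
  ring

theorem l2_ng (n : ℕ) (x : Ch n → ℂ) : l2 (x ∘ ng n) = l2 x := by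
  rw [l2, l2]
  congr 1
  exact (ngE n).sum_comp (fun σ => ‖x σ‖ ^ 2)

theorem bil_bound' (ζ : ℝ) (v : ℂ) (hv : v.re = ζ) (n : ℕ) (x w : Ch n → ℂ) :
    ‖bil (Complex.sin (ζ - v)) (Complex.sin v) (Complex.sin ζ) n x w‖ ≤ 2 * (l2 x * l2 w) * ‖Complex.sin v‖ ^ n := by
  rw [bil_cross]
  have := bil_bound ζ (ζ - v) (by simp [hv]) n (w ∘ ng n) (x ∘ ng n)
  rw [sub_sub_cancel, l2_ng, l2_ng, mul_comm (l2 w)] at this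
  exact this

theorem int_expabs (b : ℝ) (hb : 0 < b) : Integrable (fun t : ℝ => Real.exp (-(b * |t|))) := by
  rw [← integrableOn_univ, ← Set.Iic_union_Ioi (a := (0:ℝ))]
  refine IntegrableOn.union ?_ ?_
  · refine (integrableOn_exp_mul_Iic hb 0).congr_fun (fun t ht => ?_) measurableSet_Iic
    simp only [Set.mem_Iic] at ht; simp only [abs_of_nonpos ht]; ring_nf
  · refine (integrableOn_exp_mul_Ioi (neg_lt_zero.2 hb) 0).congr_fun (fun t ht => ?_) measurableSet_Ioi
    simp only [Set.mem_Ioi] at ht; simp only [abs_of_pos ht]; ring_nf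

theorem norm_cosh_le (z : ℂ) : ‖Complex.cosh z‖ ≤ Real.exp |z.re| := by
  rw [Complex.cosh, norm_div]
  have h1 := norm_add_le (Complex.exp z) (Complex.exp (-z))
  rw [Complex.norm_exp, Complex.norm_exp, Complex.neg_re] at h1
  have h2 := Real.exp_le_exp.2 (le_abs_self z.re)
  have h3 := Real.exp_le_exp.2 (neg_le_abs z.re)
  simp only [Complex.norm_ofNat]
  linarith

theorem norm_sinh_le (z : ℂ) : ‖Complex.sinh z‖ ≤ ‖z‖ * Real.exp |z.re| := by
  have hconv : Convex ℝ {w : ℂ | |w.re| ≤ |z.re|} := by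
    have : {w : ℂ | |w.re| ≤ |z.re|} = Complex.reLm ⁻¹' (Set.Icc (-|z.re|) |z.re|) := by
      ext w; simp [abs_le]
    rw [this]; exact (convex_Icc _ _).linear_preimage _
  have := hconv.norm_image_sub_le_of_norm_deriv_le (f := Complex.sinh) (C := Real.exp |z.re|) (x := 0) (y := z)
    (fun w _ => Complex.differentiable_sinh w) (fun w hw => by
      rw [Complex.deriv_sinh]
      exact (norm_cosh_le w).trans (Real.exp_le_exp.2 hw)) (by simp) (by simp)
  simpa [mul_comm] using this

theorem norm_sinh_div_le (u : ℂ) (t k : ℝ) :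
    ‖Complex.sinh (u * t) * ((k / t : ℝ) : ℂ)‖ ≤ ‖u‖ * (Real.exp (|u.re| * |t|) * |k|) := by
  rcases eq_or_ne t 0 with rfl | ht
  · simp; positivity
  have h := norm_sinh_le (u * t)
  rw [norm_mul, Complex.norm_real, Complex.re_mul_ofReal, abs_mul, Real.norm_eq_abs] at h
  rw [norm_mul, Complex.norm_real, Real.norm_eq_abs, abs_div]
  have h3 : 0 < |t| := abs_pos.2 ht
  calc _ ≤ (‖u‖ * |t| * Real.exp (|u.re| * |t|)) * (|k| / |t|) := by gcongr
    _ = _ := by field_simp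

section G
variable (κ : ℝ → ℝ) (hm : Measurable κ) (C α : ℝ) (hκ : ∀ t, |κ t| ≤ C * Real.exp (-(α * |t|)))

def Isinh (κ : ℝ → ℝ) (u : ℂ) : ℂ := ∫ t : ℝ, Complex.sinh (u * t) * ((κ t / t : ℝ) : ℂ)
def Icosh (κ : ℝ → ℝ) (u : ℂ) : ℂ := ∫ t : ℝ, Complex.cosh (u * t) * ((κ t : ℝ) : ℂ)

include hm hκ

theorem meas_cosh (u : ℂ) : AEStronglyMeasurable (fun t : ℝ => Complex.cosh (u * t) * ((κ t : ℝ) : ℂ)) := by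
  have : Measurable (fun t : ℝ => Complex.cosh (u * t)) := (by fun_prop : Continuous fun t : ℝ => Complex.cosh (u * t)).measurable
  exact (this.mul (Complex.measurable_ofReal.comp hm)).aestronglyMeasurable

theorem meas_sinh (u : ℂ) : AEStronglyMeasurable (fun t : ℝ => Complex.sinh (u * t) * ((κ t / t : ℝ) : ℂ)) := by
  have : Measurable (fun t : ℝ => Complex.sinh (u * t)) := (by fun_prop : Continuous fun t : ℝ => Complex.sinh (u * t)).measurable
  exact (this.mul (Complex.measurable_ofReal.comp (hm.div measurable_id))).aestronglyMeasurable

theorem bd_exp (r : ℝ) (t : ℝ) : Real.exp (r * |t|) * |κ t| ≤ C * Real.exp (-((α - r) * |t|)) := by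
  calc _ ≤ Real.exp (r * |t|) * (C * Real.exp (-(α * |t|))) := by gcongr; exact hκ t
    _ = _ := by rw [mul_left_comm, ← Real.exp_add]; ring_nf

theorem int_cosh (u : ℂ) (hu : |u.re| < α) : Integrable (fun t : ℝ => Complex.cosh (u * t) * ((κ t : ℝ) : ℂ)) := by
  refine ((int_expabs (α - |u.re|) (by linarith)).const_mul C).mono' (meas_cosh κ hm C α hκ u) (ae_of_all _ fun t => ?_)
  refine le_trans ?_ (bd_exp κ hm C α hκ |u.re| t)
  rw [norm_mul, Complex.norm_real, Real.norm_eq_abs]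
  gcongr
  have := norm_cosh_le (u * t)
  rwa [Complex.re_mul_ofReal, abs_mul] at this

theorem int_sinh (u : ℂ) (hu : |u.re| < α) : Integrable (fun t : ℝ => Complex.sinh (u * t) * ((κ t / t : ℝ) : ℂ)) := by
  refine (((int_expabs (α - |u.re|) (by linarith)).const_mul C).const_mul ‖u‖).mono' (meas_sinh κ hm C α hκ u) (ae_of_all _ fun t => ?_)
  refine (norm_sinh_div_le u t (κ t)).trans ?_
  exact mul_le_mul_of_nonneg_left (bd_exp κ hm C α hκ |u.re| t) (norm_nonneg _)

theorem Isinh_bound (r : ℝ) (hr : r < α) (u : ℂ) (hu : |u.re| ≤ r) :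
    ‖Isinh κ u‖ ≤ ‖u‖ * ∫ t : ℝ, C * Real.exp (-((α - r) * |t|)) := by
  rw [Isinh, ← integral_const_mul]
  refine norm_integral_le_of_norm_le (((int_expabs (α - r) (by linarith)).const_mul C).const_mul ‖u‖) (ae_of_all _ fun t => ?_)
  refine (norm_sinh_div_le u t (κ t)).trans ?_
  refine mul_le_mul_of_nonneg_left (le_trans ?_ (bd_exp κ hm C α hκ r t)) (norm_nonneg _)
  gcongr

theorem Isinh_deriv (u : ℂ) (hu : |u.re| < α) : HasDerivAt (Isinh κ) (Icosh κ u) u := by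
  set ε := (α - |u.re|) / 2 with hε
  have hε0 : 0 < ε := by rw [hε]; linarith
  refine (hasDerivAt_integral_of_dominated_loc_of_deriv_le (Metric.ball_mem_nhds u hε0)
    (F := fun u t => Complex.sinh (u * t) * ((κ t / t : ℝ) : ℂ))
    (F' := fun u t => Complex.cosh (u * t) * ((κ t : ℝ) : ℂ))
    (bound := fun t => C * Real.exp (-(ε * |t|)))
    (Eventually.of_forall fun w => meas_sinh κ hm C α hκ w) (int_sinh κ hm C α hκ u hu) (meas_cosh κ hm C α hκ u)
    ?_ ((int_expabs ε hε0).const_mul C) ?_).2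
  · refine ae_of_all _ fun t w hw => ?_
    have hw1 : |w.re| ≤ α - ε := by
      have h1 : |(w - u).re| ≤ ‖w - u‖ := Complex.abs_re_le_norm _
      have h2 : ‖w - u‖ < ε := by rwa [mem_ball_iff_norm] at hw
      have h3 : |w.re| ≤ |u.re| + |(w - u).re| := by
        have : w.re = u.re + (w - u).re := by simp
        conv_lhs => rw [this]
        exact abs_add_le _ _
      rw [hε] at h2 ⊢; linarith
    have := bd_exp κ hm C α hκ (α - ε) t
    rw [sub_sub_cancel] at this
    refine le_trans ?_ this
    rw [norm_mul, Complex.norm_real, Real.norm_eq_abs]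
    gcongr
    have h4 := norm_cosh_le (w * t)
    rw [Complex.re_mul_ofReal, abs_mul] at h4
    refine h4.trans (Real.exp_le_exp.2 ?_)
    gcongr
  · have h0 : ∀ᵐ t : ℝ, t ≠ 0 := by simp [ae_iff]
    filter_upwards [h0] with t ht w hw
    have h1 : HasDerivAt (fun w : ℂ => Complex.sinh (w * t)) (Complex.cosh (w * t) * t) w := by
      have := ((hasDerivAt_id w).mul_const (t : ℂ)).csinh
      simpa using this
    have h2 := h1.mul_const (((κ t / t : ℝ) : ℂ))
    rw [mul_assoc, ← Complex.ofReal_mul, mul_div_cancel₀ _ ht] at h2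
    exact h2

end G

theorem tan_series (α : ℂ) (h : |α.re| < π) (h0 : α ≠ 0) :
    ∑' k : ℕ, (1 / ((2 * k + 1) * π - α) - 1 / ((2 * k + 1) * π + α)) = Complex.tan (α / 2) / 2 := by
  have hπ : (π : ℂ) ≠ 0 := by exact_mod_cast Real.pi_ne_zero
  have hint : ∀ w : ℂ, |w.re| < 1 → w ≠ 0 → w ∈ Complex.integerComplement := by
    rintro w hw hw0 ⟨n, rfl⟩
    simp only [Complex.intCast_re] at hw
    have : |n| < 1 := by exact_mod_cast hw
    rw [Int.abs_lt_one_iff] at this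
    simp [this] at hw0
  have hre : |(α / π).re| < 1 := by
    rw [Complex.div_ofReal_re, abs_div, abs_of_pos Real.pi_pos, div_lt_one Real.pi_pos]; exact h
  have hre2 : |(α / π / 2).re| < 1 := by
    rw [show (2:ℂ) = ((2:ℝ):ℂ) by simp, Complex.div_ofReal_re, abs_div, abs_two]; linarith [abs_nonneg (α / π).re]
  have hw := hint (α / π) hre (div_ne_zero h0 hπ)
  have hz := hint (α / π / 2) hre2 (div_ne_zero (div_ne_zero h0 hπ) two_ne_zero)
  have c1 := cot_series_rep' hw
  have c2 := cot_series_rep' hz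
  have s1 : Summable fun n : ℕ => (1 / (α / π - (n + 1)) + 1 / (α / π + (n + 1))) := summable_cotTerm hw
  have i1 : Function.Injective (fun k : ℕ => 2 * k) := fun a b h => by simpa using h
  have i2 : Function.Injective (fun k : ℕ => 2 * k + 1) := fun a b h => by simpa using h
  have c3 := tsum_even_add_odd (f := fun n : ℕ => (1 / (α / π - ((n:ℂ) + 1)) + 1 / (α / π + ((n:ℂ) + 1)))) (s1.comp_injective i1) (s1.comp_injective i2)
  rw [← c3] at c1
  clear c3 s1
  have e2 : ∑' k : ℕ, (1 / (α / π - (((2 * k + 1 : ℕ) : ℂ) + 1)) + 1 / (α / π + (((2 * k + 1 : ℕ):ℂ) + 1)))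
      = 1 / 2 * ∑' n : ℕ, (1 / (α / π / 2 - (n + 1)) + 1 / (α / π / 2 + (n + 1))) := by
    rw [← tsum_mul_left]
    congr 1; funext k
    have h1 : α / π - (((2 * k + 1 : ℕ) : ℂ) + 1) = 2 * (α / π / 2 - (k + 1)) := by push_cast; ring
    have h2 : α / π + (((2 * k + 1 : ℕ) : ℂ) + 1) = 2 * (α / π / 2 + (k + 1)) := by push_cast; ring
    rw [h1, h2, one_div_mul_eq_div, one_div, mul_inv, one_div, mul_inv]
    ring
  rw [e2, ← c2] at c1
  have e3 : ∑' k : ℕ, (1 / ((2 * k + 1) * π - α) - 1 / ((2 * k + 1) * π + α))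
      = -(1 / π) * ∑' k : ℕ, (1 / (α / π - (((2 * k : ℕ) : ℂ) + 1)) + 1 / (α / π + (((2 * k : ℕ):ℂ) + 1))) := by
    rw [← tsum_mul_left]
    congr 1; funext k
    have h1 : (2 * k + 1) * π - α = -(π * (α / π - (((2 * k : ℕ) : ℂ) + 1))) := by
      rw [mul_sub, mul_div_cancel₀ _ hπ]; push_cast; ring
    have h2 : (2 * k + 1) * π + α = π * (α / π + (((2 * k : ℕ) : ℂ) + 1)) := by
      rw [mul_add, mul_div_cancel₀ _ hπ]; push_cast; ring
    rw [h1, h2]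
    simp only [one_div, mul_inv, inv_neg]
    ring
  rw [e3]
  have e4 : ∑' k : ℕ, (1 / (α / π - (((2 * k : ℕ) : ℂ) + 1)) + 1 / (α / π + (((2 * k : ℕ):ℂ) + 1)))
    = π * Complex.cot α - π / 2 * Complex.cot (α / 2) := by
    have : (π:ℂ) * (α / π) = α := mul_div_cancel₀ _ hπ
    have h2 : (π:ℂ) * (α / π / 2) = α / 2 := by rw [← this]; field_simp
    rw [this, h2] at c1
    have h3 : 1 / (α / π / 2) = 2 * (1 / (α / π)) := by field_simp
    rw [h3] at c1
    linear_combination -c1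
  rw [e4]
  have hs : Complex.sin α ≠ 0 := by
    intro hs; rw [Complex.sin_eq_zero_iff] at hs
    obtain ⟨k, hk⟩ := hs
    exact hw ⟨k, by rw [hk]; field_simp⟩
  have hd := Complex.sin_two_mul (α / 2)
  have hd2 := Complex.cos_two_mul (α / 2)
  rw [mul_div_cancel₀ _ (two_ne_zero' ℂ)] at hd hd2
  have hs2 : Complex.sin (α / 2) ≠ 0 := by intro h; rw [hd, h] at hs; simp at hs
  have hc2 : Complex.cos (α / 2) ≠ 0 := by intro h; rw [hd, h] at hs; simp at hs
  rw [Complex.cot, Complex.cot, Complex.tan, hd2, hd]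
  field_simp
  have := Complex.sin_sq_add_cos_sq (α / 2)
  linear_combination -this

theorem sinh_int_Ioi (α : ℂ) (h : |α.re| < π) :
    ∫ t in Set.Ioi (0:ℝ), Complex.sinh (α * t) * ((1 / Real.sinh (π * t) : ℝ) : ℂ) = Complex.tan (α / 2) / 2 := by
  rcases eq_or_ne α 0 with rfl | h0
  · simp
  have h1 := abs_lt.1 h
  let F : ℕ → ℝ → ℂ := fun k t => Complex.exp ((α - (2 * k + 1) * π) * t) - Complex.exp ((-α - (2 * k + 1) * π) * t)
  have hkp : ∀ k : ℕ, 0 ≤ (k : ℝ) * π := fun k => by positivity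
  have hre1 : ∀ k : ℕ, (α - (2 * k + 1) * π).re < 0 := fun k => by
    have := hkp k; simp; nlinarith
  have hre2 : ∀ k : ℕ, (-α - (2 * k + 1) * π).re < 0 := fun k => by
    have := hkp k; simp; nlinarith
  have hFi : ∀ k, IntegrableOn (F k) (Set.Ioi 0) := fun k =>
    (integrableOn_exp_mul_complex_Ioi (hre1 k) 0).sub (integrableOn_exp_mul_complex_Ioi (hre2 k) 0)
  have hFv : ∀ k, ∫ t in Set.Ioi (0:ℝ), F k t = 1 / ((2 * k + 1) * π - α) - 1 / ((2 * k + 1) * π + α) := fun k => by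
    rw [integral_sub (integrableOn_exp_mul_complex_Ioi (hre1 k) 0) (integrableOn_exp_mul_complex_Ioi (hre2 k) 0),
      integral_exp_mul_complex_Ioi (hre1 k), integral_exp_mul_complex_Ioi (hre2 k)]
    simp only [Complex.ofReal_zero, mul_zero, Complex.exp_zero]
    rw [neg_div, neg_div, ← div_neg, ← div_neg]; ring_nf
  set δ := π - |α.re| with hδ
  have hδ0 : 0 < δ := by rw [hδ]; linarith
  have hFb : ∀ k, ∫ t in Set.Ioi (0:ℝ), ‖F k t‖ ≤ 2 * ‖α‖ * (1 / (2 * k * π + δ)) ^ 2 := fun k => by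
    have hp : 0 < 2 * k * π + δ := by have := hkp k; nlinarith
    have hG := Real.integral_rpow_mul_exp_neg_mul_Ioi (a := 2) two_pos hp
    rw [Real.Gamma_two, mul_one] at hG
    norm_num at hG
    have hGi : IntegrableOn (fun t : ℝ => t * Real.exp (-((2 * k * π + δ) * t))) (Set.Ioi 0) := by
      by_contra hn
      rw [integral_undef hn] at hG
      have : 0 < ((2 * k * π + δ) ^ 2)⁻¹ := by positivity
      linarith
    calc _ ≤ ∫ t in Set.Ioi (0:ℝ), 2 * ‖α‖ * (t * Real.exp (-((2 * k * π + δ) * t))) := by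
          refine setIntegral_mono_on (hFi k).norm (hGi.const_mul _) measurableSet_Ioi fun t ht => ?_
          have ht : 0 < t := ht
          have : F k t = 2 * (Complex.sinh (α * t) * Complex.exp ((-((2 * k + 1) * π * t) : ℝ))) := by
            simp only [F]; rw [Complex.sinh]; push_cast
            rw [show (2:ℂ) * ((Complex.exp (α * t) - Complex.exp (-(α * t))) / 2 * Complex.exp (-((2 * k + 1) * π * t))) = Complex.exp (α * t) * Complex.exp (-((2 * k + 1) * π * t)) - Complex.exp (-(α * t)) * Complex.exp (-((2 * k + 1) * π * t)) by ring, ← Complex.exp_add, ← Complex.exp_add]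
            ring_nf
          rw [this, norm_mul, norm_mul, ← Complex.ofReal_exp, Complex.norm_real, Real.norm_eq_abs, Real.abs_exp]
          have hs := norm_sinh_le (α * t)
          rw [norm_mul, Complex.norm_real, Complex.re_mul_ofReal, abs_mul, Real.norm_eq_abs, abs_of_pos ht] at hs
          simp only [Complex.norm_ofNat]
          calc _ ≤ 2 * ((‖α‖ * t * Real.exp (|α.re| * t)) * Real.exp (-((2 * k + 1) * π * t))) := by gcongr
            _ = _ := by
              rw [mul_assoc (‖α‖ * t), ← Real.exp_add, hδ]; ring_nf
      _ = _ := by rw [integral_const_mul, hG]; simp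
  have hsum : Summable fun k => ∫ t in Set.Ioi (0:ℝ), ‖F k t‖ := by
    refine Summable.of_nonneg_of_le (fun k => integral_nonneg fun t => norm_nonneg _) hFb (Summable.mul_left _ ?_)
    have hs : Summable fun k : ℕ => (1 / δ ^ 2) * (if k = 0 then 1 else 0 : ℝ) + 1 / (k : ℝ) ^ 2 := by
      refine (Summable.mul_left _ ?_).add (Real.summable_one_div_nat_pow.2 one_lt_two)
      exact (hasSum_ite_eq 0 (1:ℝ)).summable
    refine Summable.of_nonneg_of_le (fun k => by positivity) (fun k => ?_) hs
    rcases Nat.eq_zero_or_pos k with rfl | hk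
    · simp
    · have hk' : (0:ℝ) < k := by exact_mod_cast hk
      rw [if_neg hk.ne', mul_zero, zero_add, one_div_pow]
      apply one_div_le_one_div_of_le (by positivity)
      gcongr
      have := Real.pi_gt_three
      nlinarith
  have key := hasSum_integral_of_summable_integral_norm (F := F) hFi hsum
  simp only [hFv] at key
  rw [← tan_series α h h0, key.tsum_eq]
  refine setIntegral_congr_fun measurableSet_Ioi fun t ht => ?_
  have ht : 0 < t := ht
  have hq : ‖Complex.exp (-(2 * π * t))‖ < 1 := by
    rw [Complex.norm_exp]; simp; positivity
  have hg := (hasSum_geometric_of_norm_lt_one hq).mul_left (2 * Complex.sinh (α * t) * Complex.exp (-(π * t)))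
  have e : ∀ k, F k t = 2 * Complex.sinh (α * t) * Complex.exp (-(π * t)) * Complex.exp (-(2 * π * t)) ^ k := fun k => by
    rw [← Complex.exp_nat_mul, Complex.sinh, mul_assoc, ← Complex.exp_add, mul_div_cancel₀ _ (two_ne_zero' ℂ), sub_mul, ← Complex.exp_add, ← Complex.exp_add]
    simp only [F]; ring_nf
  simp only [e]
  rw [hg.tsum_eq, mul_assoc, mul_comm 2, mul_assoc]
  congr 1
  push_cast
  have hE : Complex.exp (π * t) ≠ 0 := Complex.exp_ne_zero _
  have hsn : Complex.exp (π * t) - Complex.exp (-(π * t)) ≠ 0 := by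
    have : Real.exp (π * t) - Real.exp (-(π * t)) ≠ 0 := by
      have := Real.exp_lt_exp.2 (show -(π * t) < π * t by have := Real.pi_pos; nlinarith)
      linarith
    exact_mod_cast this
  rw [Complex.sinh, show -(2 * π * t : ℂ) = -(π * t) + -(π * t) by ring, Complex.exp_add]
  have hn : 1 - Complex.exp (-(π * t)) * Complex.exp (-(π * t)) ≠ 0 := by
    rw [show (1:ℂ) = Complex.exp (π * t) * Complex.exp (-(π * t)) by rw [← Complex.exp_add]; simp, ← sub_mul]
    exact mul_ne_zero hsn (Complex.exp_ne_zero _)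
  field_simp
  have hX : Complex.exp (π * t) * Complex.exp (-(π * t)) = 1 := by rw [← Complex.exp_add]; simp
  generalize Complex.exp (-(π * t)) = X at *
  generalize Complex.exp (π * t) = Y at *
  rw [← sub_eq_zero]
  have hn2 : 1 - X ^ 2 ≠ 0 := by rwa [sq]
  field_simp
  linear_combination -hX

theorem sin_re (z : ℂ) : (Complex.sin z).re = Real.sin z.re * Real.cosh z.im := by
  conv_lhs => rw [← Complex.re_add_im z, Complex.sin_add, Complex.sin_mul_I, Complex.cos_mul_I]
  simp [← Complex.ofReal_sin, ← Complex.ofReal_cos, ← Complex.ofReal_sinh, ← Complex.ofReal_cosh]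

theorem sin_re_pos (z : ℂ) (h0 : 0 < z.re) (h1 : z.re < π) : 0 < (Complex.sin z).re := by
  rw [sin_re]
  exact mul_pos (Real.sin_pos_of_pos_of_lt_pi h0 h1) (Real.cosh_pos _)

theorem sin_ne (z : ℂ) (h0 : 0 < z.re) (h1 : z.re < π) : Complex.sin z ≠ 0 := by
  intro h; have := sin_re_pos z h0 h1; rw [h] at this; simp at this

theorem sinh_intOn (α : ℂ) (h : |α.re| < π) :
    IntegrableOn (fun t : ℝ => Complex.sinh (α * t) * ((1 / Real.sinh (π * t) : ℝ) : ℂ)) (Set.Ioi 0) := by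
  rcases eq_or_ne α 0 with rfl | h0
  · simp
  by_contra hn
  have h1 := sinh_int_Ioi α h
  rw [integral_undef hn, Complex.tan] at h1
  have h2 := abs_lt.1 h
  have hr : (α / 2).re = α.re / 2 := by simp
  rcases div_eq_zero_iff.1 h1.symm with h3 | h3
  · rcases div_eq_zero_iff.1 h3 with h3 | h3
    · rcases lt_trichotomy α.re 0 with h4 | h4 | h4
      · refine sin_ne (-(α / 2)) ?_ ?_ (by rw [Complex.sin_neg, h3, neg_zero]) <;> rw [Complex.neg_re, hr] <;> linarith
      · have : α / 2 = ((α.im / 2 : ℝ) : ℂ) * Complex.I := by apply Complex.ext <;> simp [h4]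
        rw [this, Complex.sin_mul_I, ← Complex.ofReal_sinh] at h3
        rw [mul_eq_zero, or_iff_left Complex.I_ne_zero, Complex.ofReal_eq_zero, Real.sinh_eq_zero] at h3
        replace h3 : α.im = 0 := by linarith
        exact h0 (Complex.ext h4 h3)
      · refine sin_ne (α / 2) ?_ ?_ h3 <;> rw [hr] <;> linarith
    · rw [← Complex.sin_add_pi_div_two] at h3
      refine sin_ne _ ?_ ?_ h3 <;> rw [Complex.add_re, hr] <;> simp <;> linarith
  · norm_num at h3

def κ0 (ζ t : ℝ) : ℝ := Real.sinh ((π - ζ) * t) / Real.sinh (π * t)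
def kk (ζ t : ℝ) : ℝ := κ0 ζ t / (2 * Real.cosh (ζ * t))

theorem κ0_meas (ζ : ℝ) : Measurable (κ0 ζ) := by
  unfold κ0; fun_prop
theorem kk_meas (ζ : ℝ) : Measurable (kk ζ) := by
  unfold kk; have := κ0_meas ζ; fun_prop

theorem κ0_even (ζ t : ℝ) : κ0 ζ (-t) = κ0 ζ t := by
  simp [κ0, Real.sinh_neg, neg_div_neg_eq]
theorem kk_even (ζ t : ℝ) : kk ζ (-t) = kk ζ t := by
  simp [kk, κ0_even, Real.cosh_neg]

section Z
variable (ζ : ℝ) (h0 : 0 < ζ) (hπ : ζ < π)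
include h0 hπ

theorem κ0_nonneg (t : ℝ) : 0 ≤ κ0 ζ t := by
  rcases le_total 0 t with ht | ht
  · unfold κ0
    apply div_nonneg <;> rw [Real.sinh_nonneg_iff] <;> apply mul_nonneg <;> linarith [Real.pi_pos]
  · rw [← κ0_even]; unfold κ0
    apply div_nonneg <;> rw [Real.sinh_nonneg_iff] <;> apply mul_nonneg <;> linarith [Real.pi_pos]

theorem κ0_bound (t : ℝ) : |κ0 ζ t| ≤ 1 * Real.exp (-(ζ * |t|)) := by
  have key : ∀ t, 0 < t → κ0 ζ t ≤ Real.exp (-(ζ * t)) := by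
    intro t ht
    have : 0 < Real.sinh (π * t) := Real.sinh_pos_iff.2 (by positivity)
    rw [κ0, div_le_iff₀ this, Real.sinh_eq, Real.sinh_eq, mul_div_assoc', mul_sub, ← Real.exp_add, ← Real.exp_add]
    have : Real.exp (-(ζ * t) + -(π * t)) ≤ Real.exp (-((π - ζ) * t)) := Real.exp_le_exp.2 (by nlinarith)
    rw [show -(ζ * t) + π * t = (π - ζ) * t by ring]
    linarith
  rw [one_mul, abs_of_nonneg (κ0_nonneg ζ h0 hπ t)]
  rcases lt_trichotomy t 0 with ht | rfl | ht
  · rw [← κ0_even, abs_of_neg ht]; exact key _ (by linarith)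
  · simp [κ0]
  · rw [abs_of_pos ht]; exact key _ ht

theorem kk_nonneg (t : ℝ) : 0 ≤ kk ζ t :=
  div_nonneg (κ0_nonneg ζ h0 hπ t) (by have := Real.cosh_pos (ζ * t); positivity)

theorem kk_bound (t : ℝ) : |kk ζ t| ≤ 1 * Real.exp (-(2 * ζ * |t|)) := by
  have hc := Real.cosh_pos (ζ * t)
  rw [kk, abs_div, abs_of_pos (show 0 < 2 * Real.cosh (ζ * t) by positivity), div_le_iff₀ (by positivity)]
  refine (κ0_bound ζ h0 hπ t).trans ?_
  have : Real.exp (ζ * |t|) ≤ 2 * Real.cosh (ζ * t) := by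
    rw [Real.cosh_eq]
    rcases abs_cases t with ⟨h, _⟩ | ⟨h, _⟩ <;> rw [h]
    · linarith [Real.exp_pos (-(ζ * t))]
    · rw [mul_neg]; linarith [Real.exp_pos (ζ * t)]
  calc _ = 1 * Real.exp (-(2 * ζ * |t|)) * Real.exp (ζ * |t|) := by rw [one_mul, one_mul, ← Real.exp_add]; ring_nf
    _ ≤ _ := by gcongr

theorem Icosh_κ0 (u : ℂ) (hu : |u.re| < ζ) : Icosh (κ0 ζ) u =
    (Complex.tan ((π - ζ + u) / 2) + Complex.tan ((π - ζ - u) / 2)) / 2 := by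
  have hu' := abs_lt.1 hu
  have hi := int_cosh (κ0 ζ) (κ0_meas ζ) 1 ζ (κ0_bound ζ h0 hπ) u hu
  have e1 : Icosh (κ0 ζ) u = 2 * ∫ t in Set.Ioi (0:ℝ), Complex.cosh (u * t) * ((κ0 ζ t : ℝ) : ℂ) := by
    rw [Icosh, ← intervalIntegral.integral_Iic_add_Ioi (b := 0) hi.integrableOn hi.integrableOn, two_mul]
    congr 1
    have := integral_comp_neg_Iic (0:ℝ) (fun t : ℝ => Complex.cosh (u * t) * ((κ0 ζ t : ℝ) : ℂ))
    rw [neg_zero] at this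
    rw [← this]
    simp [κ0_even, Complex.cosh_neg]
  have r1 : |((π:ℂ) - ζ + u).re| < π := by
    simp; rw [abs_lt]; constructor <;> linarith
  have r2 : |((π:ℂ) - ζ - u).re| < π := by
    simp; rw [abs_lt]; constructor <;> linarith
  have e2 : ∀ t : ℝ, Complex.cosh (u * t) * ((κ0 ζ t : ℝ) : ℂ) =
      1 / 2 * (Complex.sinh ((π - ζ + u) * t) * ((1 / Real.sinh (π * t) : ℝ) : ℂ)
        + Complex.sinh ((π - ζ - u) * t) * ((1 / Real.sinh (π * t) : ℝ) : ℂ)) := by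
    intro t
    rw [κ0, add_mul, sub_mul _ u, Complex.sinh_add, Complex.sinh_sub]
    push_cast; ring
  rw [e1]
  simp only [e2]
  rw [integral_const_mul, integral_add (sinh_intOn _ r1) (sinh_intOn _ r2), sinh_int_Ioi _ r1, sinh_int_Ioi _ r2]
  ring

theorem K_id (u : ℂ) (hu : |u.re| < ζ) :
    Complex.exp (Isinh (κ0 ζ) u) * Complex.sin ((ζ - u) / 2) = Complex.sin ((ζ + u) / 2) := by
  have hS : ∀ u : ℂ, |u.re| < ζ → Complex.sin ((ζ - u) / 2) ≠ 0 ∧ Complex.sin ((ζ + u) / 2) ≠ 0 := by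
    intro u hu
    have hu' := abs_lt.1 hu
    constructor <;> apply sin_ne <;> simp <;> linarith
  let f : ℂ → ℂ := fun u => Complex.exp (Isinh (κ0 ζ) u) * Complex.sin ((ζ - u) / 2) / Complex.sin ((ζ + u) / 2)
  have hset : {u : ℂ | |u.re| < ζ} = Complex.re ⁻¹' (Set.Ioo (-ζ) ζ) := by ext u; simp [abs_lt]
  have ho : IsOpen {u : ℂ | |u.re| < ζ} := by
    rw [hset]; exact isOpen_Ioo.preimage Complex.continuous_re
  have hc : IsPreconnected {u : ℂ | |u.re| < ζ} := by
    rw [hset]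
    exact ((convex_Ioo (-ζ) ζ).linear_preimage Complex.reLm).isPreconnected
  have hd : ∀ u : ℂ, |u.re| < ζ → HasDerivAt f 0 u := by
    intro u hu
    have d1 := (Isinh_deriv (κ0 ζ) (κ0_meas ζ) 1 ζ (κ0_bound ζ h0 hπ) u hu).cexp
    have d2 : HasDerivAt (fun u : ℂ => Complex.sin ((ζ - u) / 2)) (Complex.cos ((ζ - u) / 2) * (-1 / 2)) u := by
      have := (((hasDerivAt_id u).const_sub (ζ:ℂ)).div_const 2).csin
      simpa using this
    have d3 : HasDerivAt (fun u : ℂ => Complex.sin ((ζ + u) / 2)) (Complex.cos ((ζ + u) / 2) * (1 / 2)) u := by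
      have := (((hasDerivAt_id u).const_add (ζ:ℂ)).div_const 2).csin
      simpa using this
    have d := (d1.mul d2).div d3 (hS u hu).2
    have ht1 : Complex.tan ((π - ζ + u) / 2) = Complex.cos ((ζ - u) / 2) / Complex.sin ((ζ - u) / 2) := by
      rw [show ((π:ℂ) - ζ + u) / 2 = π / 2 - (ζ - u) / 2 by ring, Complex.tan, Complex.sin_pi_div_two_sub, Complex.cos_pi_div_two_sub]
    have ht2 : Complex.tan ((π - ζ - u) / 2) = Complex.cos ((ζ + u) / 2) / Complex.sin ((ζ + u) / 2) := by
      rw [show ((π:ℂ) - ζ - u) / 2 = π / 2 - (ζ + u) / 2 by ring, Complex.tan, Complex.sin_pi_div_two_sub, Complex.cos_pi_div_two_sub]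
    have hz : (0:ℂ) = ((Complex.exp (Isinh (κ0 ζ) u) * Icosh (κ0 ζ) u) * Complex.sin ((ζ - u) / 2) + Complex.exp (Isinh (κ0 ζ) u) * (Complex.cos ((ζ - u) / 2) * (-1 / 2))) * Complex.sin ((ζ + u) / 2) - Complex.exp (Isinh (κ0 ζ) u) * Complex.sin ((ζ - u) / 2) * (Complex.cos ((ζ + u) / 2) * (1 / 2)) := by
      rw [Icosh_κ0 ζ h0 hπ u hu, ht1, ht2]
      have := hS u hu
      have h1 := this.1
      have h2 := this.2
      field_simp
      ring
    rw [show (0:ℂ) = 0 / Complex.sin ((ζ + u) / 2) ^ 2 by simp]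
    rw [hz]
    exact d
  have key := ho.is_const_of_deriv_eq_zero hc (f := f) (fun u hu => (hd u hu).differentiableAt.differentiableWithinAt)
    (fun u hu => (hd u hu).deriv) hu (show |(0:ℂ).re| < ζ by simpa using h0)
  have h00 : f 0 = 1 := by
    have : Isinh (κ0 ζ) 0 = 0 := by simp [Isinh]
    simp only [f, this, Complex.exp_zero, one_mul, sub_zero, add_zero]
    have := (hS 0 (by simpa using h0)).1
    rw [sub_zero] at this
    exact div_self this
  rw [h00] at key
  exact (div_eq_one_iff_eq (hS u hu).2).1 key

/-- `J v - J (ζ - v) = Isinh κ0 (ζ - 2v)` -/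
theorem J_diff (v : ℂ) (hv0 : 0 < v.re) (hv1 : v.re < ζ) :
    Isinh (kk ζ) (2 * (ζ - v)) - Isinh (kk ζ) (2 * v) = Isinh (κ0 ζ) (ζ - 2 * v) := by
  have i1 := int_sinh (kk ζ) (kk_meas ζ) 1 (2 * ζ) (kk_bound ζ h0 hπ) (2 * (ζ - v)) (by simp; rw [abs_lt]; constructor <;> linarith)
  have i2 := int_sinh (kk ζ) (kk_meas ζ) 1 (2 * ζ) (kk_bound ζ h0 hπ) (2 * v) (by simp; rw [abs_lt]; constructor <;> linarith)
  rw [Isinh, Isinh, ← integral_sub i1 i2, Isinh]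
  congr 1; funext t
  have hc : Complex.cosh (ζ * t) ≠ 0 := by
    rw [← Complex.ofReal_mul, ← Complex.ofReal_cosh]; exact_mod_cast (Real.cosh_pos _).ne'
  have e : Complex.sinh (2 * (ζ - v) * t) - Complex.sinh (2 * v * t) = 2 * Complex.cosh (ζ * t) * Complex.sinh ((ζ - 2 * v) * t) := by
    rw [show 2 * (ζ - v) * t = ζ * t + (ζ - 2 * v) * t by ring, show 2 * v * t = ζ * t - (ζ - 2 * v) * t by ring,
      Complex.sinh_add, Complex.sinh_sub]; ring
  rw [← sub_mul, e, kk]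
  push_cast
  field_simp

theorem E_symm (v : ℂ) (hv0 : 0 < v.re) (hv1 : v.re < ζ) :
    Complex.sin v * Complex.exp (Isinh (kk ζ) (2 * (ζ - v))) = Complex.sin (ζ - v) * Complex.exp (Isinh (kk ζ) (2 * v)) := by
  have h1 := J_diff ζ h0 hπ v hv0 hv1
  have h2 := K_id ζ h0 hπ (ζ - 2 * v) (by simp; rw [abs_lt]; constructor <;> linarith)
  rw [← h1, show ((ζ:ℂ) - (ζ - 2 * v)) / 2 = v by ring, show ((ζ:ℂ) + (ζ - 2 * v)) / 2 = ζ - v by ring,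
    Complex.exp_sub, div_mul_eq_mul_div, div_eq_iff (Complex.exp_ne_zero _)] at h2
  rw [mul_comm, h2]
end Z

theorem Isinh_re (κ : ℝ → ℝ) (hm : Measurable κ) (C α : ℝ) (hκ : ∀ t, |κ t| ≤ C * Real.exp (-(α * |t|)))
    (u : ℂ) (hu : |u.re| < α) :
    (Isinh κ u).re = ∫ t : ℝ, Real.sinh (u.re * t) * Real.cos (u.im * t) * (κ t / t) := by
  rw [Isinh]
  refine Eq.trans (integral_re (int_sinh κ hm C α hκ u hu)).symm ?_
  congr 1; funext t
  show (Complex.sinh (u * t) * ((κ t / t : ℝ) : ℂ)).re = _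
  rw [Complex.re_mul_ofReal]
  congr 1
  conv_lhs => rw [← Complex.re_add_im u, add_mul, show (u.im * Complex.I) * (t:ℂ) = ((u.im * t : ℝ):ℂ) * Complex.I by push_cast; ring,
    ← Complex.ofReal_mul, Complex.sinh_add, Complex.sinh_mul_I, Complex.cosh_mul_I]
  simp [← Complex.ofReal_sin, ← Complex.ofReal_cos, ← Complex.ofReal_sinh, ← Complex.ofReal_cosh, -Complex.ofReal_mul]

theorem lw_diff (f g : ℂ → ℂ) (c : ℂ) (hf : Differentiable ℂ f) (hg : Differentiable ℂ g) (i j s t : Bool) :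
    Differentiable ℂ fun v => lw (f v) (g v) c c i j s t := by
  cases i <;> cases j <;> cases s <;> cases t <;> simp only [lw] <;> fun_prop

theorem mono_diff (f g : ℂ → ℂ) (c : ℂ) (hf : Differentiable ℂ f) (hg : Differentiable ℂ g) (n : ℕ) (i j : Bool) (σ τ : Ch n) :
    Differentiable ℂ fun v => mono (fun _ => lw (f v) (g v) c c) n i j σ τ := by
  induction n generalizing i j with
  | zero => exact differentiable_const _
  | succ n ih =>
    have : (fun v => mono (fun _ => lw (f v) (g v) c c) (n+1) i j σ τ) =
      fun v => ∑ k, lw (f v) (g v) c c i k σ.1 τ.1 * mono (fun _ => lw (f v) (g v) c c) n k j σ.2 τ.2 := by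
      funext v; exact mono_succ _ n i j σ.1 τ.1 σ.2 τ.2
    rw [this]
    have h1 := lw_diff f g c hf hg
    fun_prop (disch := assumption)

theorem mono_bd (a b c : ℂ) (m : ℝ) (hm : 1 ≤ m) (ha : ‖a‖ ≤ m) (hb : ‖b‖ ≤ m) (hc : ‖c‖ ≤ m) (n : ℕ) (i j : Bool) (σ τ : Ch n) :
    ‖mono (fun _ => lw a b c c) n i j σ τ‖ ≤ (2 * m) ^ n := by
  induction n generalizing i j with
  | zero =>
    show ‖(if i = j then (1 : Matrix (Ch 0) (Ch 0) ℂ) else 0) σ τ‖ ≤ 1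
    split_ifs
    · rw [Matrix.one_apply]; split_ifs <;> simp
    · simp
  | succ n ih =>
    have hl : ∀ i k s t, ‖lw a b c c i k s t‖ ≤ m := by
      intro i k s t
      cases i <;> cases k <;> cases s <;> cases t <;> simp only [lw] <;> first | assumption | (rw [norm_zero]; linarith)
    have : mono (fun _ => lw a b c c) (n+1) i j σ τ = ∑ k, lw a b c c i k σ.1 τ.1 * mono (fun _ => lw a b c c) n k j σ.2 τ.2 :=
      mono_succ _ n i j σ.1 τ.1 σ.2 τ.2
    rw [this]
    refine (norm_sum_le _ _).trans ?_
    have h : ∀ k, ‖lw a b c c i k σ.1 τ.1 * mono (fun _ => lw a b c c) n k j σ.2 τ.2‖ ≤ m * (2 * m) ^ n := fun k => by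
      rw [norm_mul]; exact mul_le_mul (hl _ _ _ _) (ih _ _ _ _) (norm_nonneg _) (by linarith)
    rw [Fintype.sum_bool, pow_succ]
    linarith [h true, h false]

theorem bil_diff (ζ : ℝ) (n : ℕ) (x w : Ch n → ℂ) :
    Differentiable ℂ fun v : ℂ => bil (Complex.sin (ζ - v)) (Complex.sin v) (Complex.sin ζ) n x w := by
  have h := mono_diff (fun v => Complex.sin (ζ - v)) (fun v => Complex.sin v) (Complex.sin ζ) (by fun_prop) (by fun_prop) n
  simp only [bil, TT, Matrix.add_apply]
  fun_prop (disch := assumption)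

theorem norm_csin_le (z : ℂ) : ‖Complex.sin z‖ ≤ Real.exp ‖z‖ := by
  have h := norm_sinh_le
  rw [Complex.sin, norm_div, norm_mul, Complex.norm_I, mul_one]
  have h1 := norm_sub_le (Complex.exp (-z * Complex.I)) (Complex.exp (z * Complex.I))
  have h2 := Complex.norm_exp_le_exp_norm (-z * Complex.I)
  have h3 := Complex.norm_exp_le_exp_norm (z * Complex.I)
  simp at h2 h3
  rw [Complex.norm_ofNat]
  simp at h1 ⊢
  linarith

theorem bil_bd (ζ : ℝ) (n : ℕ) (x w : Ch n → ℂ) : ∃ A : ℝ, 0 ≤ A ∧ ∀ v : ℂ,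
    ‖bil (Complex.sin (ζ - v)) (Complex.sin v) (Complex.sin ζ) n x w‖ ≤ A * Real.exp ‖v‖ ^ n := by
  refine ⟨∑ σ, ‖x σ‖ * ∑ τ, (2 * (2 * Real.exp |ζ|) ^ n) * ‖w τ‖, by positivity, fun v => ?_⟩
  have hm : ∀ i σ τ, ‖mono (fun _ => lw (Complex.sin (ζ - v)) (Complex.sin v) (Complex.sin ζ) (Complex.sin ζ)) n i i σ τ‖
      ≤ (2 * (Real.exp |ζ| * Real.exp ‖v‖)) ^ n := by
    intro i σ τ
    rw [← Real.exp_add]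
    apply mono_bd
    · exact Real.one_le_exp (by positivity)
    · refine (norm_csin_le _).trans (Real.exp_le_exp.2 ((norm_sub_le _ _).trans ?_)); simp
    · refine (norm_csin_le _).trans (Real.exp_le_exp.2 ?_); simp
    · refine (norm_csin_le _).trans (Real.exp_le_exp.2 ?_); simp
  rw [bil, Finset.sum_mul]
  refine (norm_sum_le _ _).trans (Finset.sum_le_sum fun σ _ => ?_)
  rw [norm_mul, mul_assoc]
  refine mul_le_mul_of_nonneg_left ?_ (norm_nonneg _)
  rw [Finset.sum_mul]
  refine (norm_sum_le _ _).trans (Finset.sum_le_sum fun τ _ => ?_)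
  rw [norm_mul, TT, Matrix.add_apply, mul_right_comm]
  refine mul_le_mul_of_nonneg_right ((norm_add_le _ _).trans ?_) (norm_nonneg _)
  have h1 := hm false σ τ
  have h2 := hm true σ τ
  rw [← mul_assoc, mul_pow] at h1 h2
  linarith

def EL (ζ : ℝ) (v : ℂ) : ℂ := Complex.sin (ζ - v) * Complex.exp (Isinh (kk ζ) (2 * v))
def EE (ζ : ℝ) (v : ℂ) : ℂ := if v.re < ζ / 2 then EL ζ v else EL ζ (ζ - v)

section Z
variable (ζ : ℝ) (h0 : 0 < ζ) (hπ : ζ < π)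
include h0 hπ

theorem EL_symm (v : ℂ) (hv0 : 0 < v.re) (hv1 : v.re < ζ) : EL ζ (ζ - v) = EL ζ v := by
  rw [EL, EL, sub_sub_cancel]; exact E_symm ζ h0 hπ v hv0 hv1

theorem EE_eq (v : ℂ) (hv1 : v.re < ζ) : EE ζ v = EL ζ v := by
  rw [EE]; split_ifs with h
  · rfl
  · exact EL_symm ζ h0 hπ v (by linarith) hv1

theorem EE_eq' (v : ℂ) (hv0 : 0 < v.re) : EE ζ v = EL ζ (ζ - v) := by
  rw [EE]; split_ifs with h
  · exact (EL_symm ζ h0 hπ v hv0 (by linarith)).symm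
  · rfl

theorem Isinh_kk_deriv (u : ℂ) (hu : |u.re| < 2 * ζ) : HasDerivAt (Isinh (kk ζ)) (Icosh (kk ζ) u) u :=
  Isinh_deriv (kk ζ) (kk_meas ζ) 1 (2 * ζ) (kk_bound ζ h0 hπ) u hu

theorem EL_diff (v : ℂ) (hv : |v.re| < ζ) : DifferentiableAt ℂ (EL ζ) v := by
  unfold EL
  have h1 : DifferentiableAt ℂ (fun v => Isinh (kk ζ) (2 * v)) v := by
    have h2 := (Isinh_kk_deriv ζ h0 hπ (2 * v) (by simp [abs_mul]; exact hv)).differentiableAt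
    exact DifferentiableAt.comp (g := Isinh (kk ζ)) (f := fun v => 2 * v) v h2 (by fun_prop)
  have h3 : DifferentiableAt ℂ (fun v => Complex.sin (ζ - v)) v := by fun_prop
  exact h3.mul h1.cexp

theorem EE_diff (v : ℂ) (hv0 : 0 ≤ v.re) (hv1 : v.re ≤ ζ) : DifferentiableAt ℂ (EE ζ) v := by
  by_cases h : v.re < ζ
  · refine (EL_diff ζ h0 hπ v (abs_lt.2 ⟨by linarith, h⟩)).congr_of_eventuallyEq ?_
    filter_upwards [(isOpen_Iio.preimage Complex.continuous_re).mem_nhds (show v ∈ Complex.re ⁻¹' Set.Iio ζ from h)] with w hw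
    exact EE_eq ζ h0 hπ w hw
  · have h1 : DifferentiableAt ℂ (fun v => EL ζ (ζ - v)) v :=
      DifferentiableAt.comp (g := EL ζ) (f := fun v => (ζ:ℂ) - v) v (EL_diff ζ h0 hπ _ (by simp; rw [abs_lt]; constructor <;> linarith)) (by fun_prop)
    refine h1.congr_of_eventuallyEq ?_
    filter_upwards [(isOpen_Ioi.preimage Complex.continuous_re).mem_nhds (show v ∈ Complex.re ⁻¹' Set.Ioi 0 by simp; linarith)] with w hw
    exact EE_eq' ζ h0 hπ w hw

theorem EL_lower : ∃ A C : ℝ, 0 < A ∧ 0 ≤ C ∧ ∀ v : ℂ, 0 ≤ v.re → v.re ≤ ζ / 2 → 1 ≤ ‖EL ζ v‖ * (A * Real.exp (C * ‖v‖)) := by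
  have s1 : 0 < Real.sin (ζ / 2) := Real.sin_pos_of_pos_of_lt_pi (by linarith) (by linarith)
  have s2 : 0 < Real.sin ζ := Real.sin_pos_of_pos_of_lt_pi (by linarith) (by linarith)
  set s := min (Real.sin (ζ / 2)) (Real.sin ζ) with hs
  have s0 : 0 < s := lt_min s1 s2
  set I := ∫ t : ℝ, 1 * Real.exp (-((2 * ζ - ζ) * |t|)) with hI
  have hI0 : 0 ≤ I := integral_nonneg fun t => by positivity
  refine ⟨1 / s, 2 * I, by positivity, by positivity, fun v hv0 hv1 => ?_⟩
  have e1 : s ≤ ‖Complex.sin (ζ - v)‖ := by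
    refine le_trans ?_ (Complex.re_le_norm _)
    rw [sin_re]
    have hr : ((ζ:ℂ) - v).re = ζ - v.re := by simp
    rw [hr]
    have hc := strictConcaveOn_sin_Icc.concaveOn
    have hmin := hc.min_le_of_mem_Icc (x := ζ / 2) (y := ζ) (z := ζ - v.re) ⟨by linarith, by linarith⟩ ⟨by linarith, by linarith⟩
      ⟨by linarith, by linarith⟩
    have h2 := Real.one_le_cosh ((ζ:ℂ) - v).im
    calc s ≤ Real.sin (ζ - v.re) := hmin
      _ ≤ _ := le_mul_of_one_le_right (s0.le.trans hmin) h2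
  have e2 := Isinh_bound (kk ζ) (kk_meas ζ) 1 (2 * ζ) (kk_bound ζ h0 hπ) ζ (by linarith) (2 * v) (by simp [abs_mul]; rw [abs_of_nonneg hv0]; linarith)
  rw [← hI, norm_mul, Complex.norm_ofNat] at e2
  have e3 : Real.exp (-(2 * I * ‖v‖)) ≤ ‖Complex.exp (Isinh (kk ζ) (2 * v))‖ := by
    rw [Complex.norm_exp]
    apply Real.exp_le_exp.2
    have := Complex.abs_re_le_norm (Isinh (kk ζ) (2 * v))
    have := neg_abs_le (Isinh (kk ζ) (2 * v)).re
    nlinarith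
  rw [EL, norm_mul]
  calc (1:ℝ) = s * Real.exp (-(2 * I * ‖v‖)) * (1 / s * Real.exp (2 * I * ‖v‖)) := by
        rw [Real.exp_neg]; field_simp
    _ ≤ _ := by gcongr

theorem EE_lower : ∃ A C : ℝ, 0 < A ∧ 0 ≤ C ∧ ∀ v : ℂ, 0 ≤ v.re → v.re ≤ ζ → 1 ≤ ‖EE ζ v‖ * (A * Real.exp (C * ‖v‖)) := by
  obtain ⟨A, C, hA, hC, h⟩ := EL_lower ζ h0 hπ
  refine ⟨A * Real.exp (C * ζ), C, by positivity, hC, fun v hv0 hv1 => ?_⟩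
  by_cases hv : v.re < ζ / 2
  · rw [EE, if_pos hv]
    refine (h v hv0 hv.le).trans ?_
    gcongr
    exact le_mul_of_one_le_right hA.le (Real.one_le_exp (by positivity))
  · rw [EE, if_neg hv]
    refine (h (ζ - v) (by simp; linarith) (by simp; linarith)).trans ?_
    rw [mul_assoc A, ← Real.exp_add, ← mul_add]
    gcongr
    refine (norm_sub_le _ _).trans ?_
    simp [abs_of_pos h0]

theorem EL_norm_im (v : ℂ) (hv : v.re = 0) : ‖EL ζ v‖ = ‖Complex.sin (ζ - v)‖ := by
  rw [EL, norm_mul, Complex.norm_exp, Isinh_re (kk ζ) (kk_meas ζ) 1 (2 * ζ) (kk_bound ζ h0 hπ) (2 * v) (by simp [hv, h0])]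
  simp [hv]

theorem PL_bound (n : ℕ) (x w : Ch n → ℂ) (v : ℂ) (hv0 : 0 ≤ v.re) (hv1 : v.re ≤ ζ) :
    ‖bil (Complex.sin (ζ - v)) (Complex.sin v) (Complex.sin ζ) n x w‖ ≤ 2 * (l2 x * l2 w) * ‖EE ζ v‖ ^ n := by
  obtain ⟨A, C, hA, hC, hE⟩ := EE_lower ζ h0 hπ
  obtain ⟨B, hB0, hB⟩ := bil_bd ζ n x w
  have hne : ∀ v : ℂ, 0 ≤ v.re → v.re ≤ ζ → EE ζ v ≠ 0 := fun v h1 h2 h3 => by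
    have := hE v h1 h2; rw [h3] at this; norm_num at this
  set F : ℂ → ℂ := fun v => bil (Complex.sin (ζ - v)) (Complex.sin v) (Complex.sin ζ) n x w / EE ζ v ^ n with hF
  have hFd : ∀ v : ℂ, 0 ≤ v.re → v.re ≤ ζ → DifferentiableAt ℂ F v := fun v h1 h2 =>
    ((bil_diff ζ n x w) v).div ((EE_diff ζ h0 hπ v h1 h2).pow n) (pow_ne_zero _ (hne v h1 h2))
  have key : ‖F v‖ ≤ 2 * (l2 x * l2 w) := by
    refine PhragmenLindelof.vertical_strip (f := F) (a := 0) (b := ζ) ?_ ?_ ?_ ?_ hv0 hv1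
    · apply DifferentiableOn.diffContOnCl
      have hcl : closure (Complex.re ⁻¹' Set.Ioo 0 ζ) ⊆ Complex.re ⁻¹' Set.Icc 0 ζ :=
        closure_minimal (Set.preimage_mono Set.Ioo_subset_Icc_self) (isClosed_Icc.preimage Complex.continuous_re)
      exact fun v hv => (hFd v (hcl hv).1 (hcl hv).2).differentiableWithinAt
    · set c := π / (ζ - 0) / 2 with hc
      have hp : 0 < π / (ζ - 0) := div_pos Real.pi_pos (by linarith)
      have hc0 : 0 < c := by positivity
      refine ⟨c, by rw [hc]; linarith, (n * (1 + C)) / c, ?_⟩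
      refine Asymptotics.IsBigO.of_bound (B * A ^ n * Real.exp (n * (1 + C) * ζ)) ?_
      refine eventually_inf_principal.2 (Eventually.of_forall fun z hz => ?_)
      have hz1 : 0 < z.re := hz.1
      have hz2 : z.re < ζ := hz.2
      have hn : ‖z‖ ≤ ζ + |z.im| := by
        refine (Complex.norm_le_abs_re_add_abs_im z).trans ?_
        rw [abs_of_pos hz1]; linarith
      have e1 : 1 ≤ ‖EE ζ z‖ ^ n * (A * Real.exp (C * ‖z‖)) ^ n := by
        rw [← mul_pow]; exact one_le_pow₀ (hE z hz1.le hz2.le)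
      have e2 : ‖F z‖ ≤ B * A ^ n * Real.exp (n * (1 + C) * ‖z‖) := by
        rw [hF]; simp only [norm_div, norm_pow]
        have : 0 < ‖EE ζ z‖ ^ n := by have := norm_pos_iff.2 (hne z hz1.le hz2.le); positivity
        rw [div_le_iff₀ this]
        calc _ ≤ B * Real.exp ‖z‖ ^ n * 1 := by rw [mul_one]; exact hB z
          _ ≤ B * Real.exp ‖z‖ ^ n * (‖EE ζ z‖ ^ n * (A * Real.exp (C * ‖z‖)) ^ n) := by gcongr
          _ = _ := by
            rw [show n * (1 + C) * ‖z‖ = n * ‖z‖ + n * (C * ‖z‖) by ring, Real.exp_add, Real.exp_nat_mul, Real.exp_nat_mul, mul_pow]; ring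
      refine e2.trans ?_
      rw [Real.norm_eq_abs, Real.abs_exp, mul_assoc _ (Real.exp _), ← Real.exp_add]
      gcongr
      have e3 : c * |z.im| ≤ Real.exp (c * |z.im|) := by linarith [Real.add_one_le_exp (c * |z.im|)]
      calc n * (1 + C) * ‖z‖ ≤ n * (1 + C) * (ζ + |z.im|) := by gcongr
        _ = n * (1 + C) * ζ + n * (1 + C) / c * (c * |z.im|) := by field_simp
        _ ≤ _ := by gcongr
    · intro z hz
      have hEz : ‖EE ζ z‖ = ‖Complex.sin (ζ - z)‖ := by
        rw [EE_eq ζ h0 hπ z (by linarith), EL_norm_im ζ h0 hπ z hz]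
      rw [hF]; simp only [norm_div, norm_pow]
      have : 0 < ‖EE ζ z‖ ^ n := by have := norm_pos_iff.2 (hne z hz.ge (by linarith)); positivity
      rw [div_le_iff₀ this, hEz]
      exact bil_bound ζ z hz n x w
    · intro z hz
      have hEz : ‖EE ζ z‖ = ‖Complex.sin z‖ := by
        rw [EE_eq' ζ h0 hπ z (by linarith), EL_norm_im ζ h0 hπ _ (by simp [hz]), sub_sub_cancel]
      rw [hF]; simp only [norm_div, norm_pow]
      have : 0 < ‖EE ζ z‖ ^ n := by have := norm_pos_iff.2 (hne z (by linarith) hz.le); positivity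
      rw [div_le_iff₀ this, hEz]
      exact bil_bound' ζ z hz n x w
  have hp : 0 < ‖EE ζ v‖ ^ n := by have := norm_pos_iff.2 (hne v hv0 hv1); positivity
  rw [hF] at key; simp only [norm_div, norm_pow] at key
  rwa [div_le_iff₀ hp] at key

theorem eig_bound (n : ℕ) (v : ℂ) (hv0 : 0 ≤ v.re) (hv1 : v.re ≤ ζ) (t : ℂ)
    (ht : t ∈ spectrum ℂ (TT (Complex.sin (ζ - v)) (Complex.sin v) (Complex.sin ζ) n)) :
    ‖t‖ ≤ 2 * ‖EE ζ v‖ ^ n := by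
  set T := TT (Complex.sin (ζ - v)) (Complex.sin v) (Complex.sin ζ) n with hT
  rw [spectrum.mem_iff, Matrix.isUnit_iff_isUnit_det, isUnit_iff_ne_zero, not_not, ← Matrix.exists_mulVec_eq_zero_iff] at ht
  obtain ⟨w, hw0, hw⟩ := ht
  have hw1 : ∀ σ, ∑ τ, T σ τ * w τ = t * w σ := by
    intro σ
    have := congrFun hw σ
    rw [Matrix.sub_mulVec, Pi.sub_apply, Pi.zero_apply, sub_eq_zero] at this
    rw [Matrix.algebraMap_eq_diagonal, Matrix.mulVec_diagonal] at this
    simp at this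
    rw [this]; rfl
  have h := PL_bound ζ h0 hπ n (fun σ => star (w σ)) w v hv0 hv1
  have hb : bil (Complex.sin (ζ - v)) (Complex.sin v) (Complex.sin ζ) n (fun σ => star (w σ)) w = t * ((∑ σ, ‖w σ‖ ^ 2 : ℝ) : ℂ) := by
    rw [bil]
    simp only [← hT, hw1]
    push_cast; rw [Finset.mul_sum]
    refine Finset.sum_congr rfl fun σ _ => ?_
    have : star (w σ) * w σ = (‖w σ‖:ℂ) ^ 2 := by exact_mod_cast Complex.conj_mul' (w σ)
    rw [mul_left_comm, this]
  have hl : l2 (fun σ => star (w σ)) = l2 w := by simp [l2]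
  have hs : 0 < ∑ σ, ‖w σ‖ ^ 2 := by
    obtain ⟨σ, hσ⟩ := Function.ne_iff.1 hw0
    exact Finset.sum_pos' (fun _ _ => by positivity) ⟨σ, Finset.mem_univ _, by have := norm_pos_iff.2 hσ; positivity⟩
  rw [hb, hl, norm_mul, Complex.norm_real, Real.norm_eq_abs, abs_of_pos hs, l2, Real.mul_self_sqrt hs.le] at h
  have : ‖t‖ * ∑ σ, ‖w σ‖ ^ 2 ≤ (2 * ‖EE ζ v‖ ^ n) * ∑ σ, ‖w σ‖ ^ 2 := by linarith
  exact le_of_mul_le_mul_right this hs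
end Z

def qq (ζ : ℝ) : ℂ := -Complex.exp (-(ζ * Complex.I))
def qp (ζ : ℝ) : ℂ := -Complex.exp (ζ * Complex.I)
def ex (v : ℂ) : ℂ := Complex.exp (2 * (v * Complex.I))
def e2 (v : ℂ) : ℂ := 2 * Complex.I * Complex.exp (v * Complex.I)

theorem sin_form (s d : ℂ) : Complex.exp (s + d * Complex.I) - Complex.exp (s - d * Complex.I) = 2 * Complex.I * Complex.exp s * Complex.sin d := by
  rw [Complex.exp_add, Complex.exp_sub, Complex.sin, neg_mul, Complex.exp_neg]
  have := Complex.exp_ne_zero (d * Complex.I)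
  field_simp
  rw [Complex.I_sq]; ring

theorem f1 (ζ : ℝ) (α β : ℂ) : ex α * qq ζ - ex β * qp ζ = e2 (α + β) * Complex.sin (β - α + ζ) := by
  rw [e2, ← sin_form, ex, ex, qq, qp, mul_neg, mul_neg, ← Complex.exp_add, ← Complex.exp_add, sub_neg_eq_add, neg_add_eq_sub]
  congr 2 <;> ring
theorem f2 (ζ : ℝ) (α β : ℂ) : ex α * qp ζ - ex β * qq ζ = e2 (α + β) * Complex.sin (β - α - ζ) := by
  rw [e2, ← sin_form, ex, ex, qq, qp, mul_neg, mul_neg, ← Complex.exp_add, ← Complex.exp_add, sub_neg_eq_add, neg_add_eq_sub]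
  congr 2 <;> ring
theorem f3 (α β : ℂ) : ex α - ex β = e2 (α + β) * Complex.sin (α - β) := by
  rw [e2, ← sin_form, ex, ex]
  congr 2 <;> ring
theorem ex0 : ex 0 = 1 := by simp [ex]
theorem f1' (ζ : ℝ) (α : ℂ) : ex α * qq ζ - qp ζ = e2 α * Complex.sin (ζ - α) := by
  have := f1 ζ α 0
  rwa [ex0, one_mul, add_zero, zero_sub, neg_add_eq_sub] at this
theorem f3' (α : ℂ) : ex α - 1 = e2 α * Complex.sin α := by
  have := f3 α 0
  rwa [ex0, add_zero, sub_zero] at this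
theorem e2_ne (α : ℂ) : e2 α ≠ 0 := mul_ne_zero (mul_ne_zero two_ne_zero Complex.I_ne_zero) (Complex.exp_ne_zero _)

theorem qqp (ζ : ℝ) : qq ζ - qp ζ = 2 * Complex.I * Complex.sin ζ := by
  have := f1' ζ 0
  rwa [ex0, one_mul, sub_zero, e2, zero_mul, Complex.exp_zero, mul_one] at this

def gg (v : ℂ) (i : Bool) : ℂ := if i then 1 else Complex.exp (v * Complex.I)
theorem gg_ne (v : ℂ) (i : Bool) : gg v i ≠ 0 := by
  cases i <;> simp [gg, Complex.exp_ne_zero]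

theorem L_gauge (ζ : ℝ) (v : ℂ) (m : ℕ) (i k s t : Bool) :
    Lq (qq ζ) (qp ζ) (fun _ => 1) (ex v) m i k s t =
      e2 v * (gg v i * lw (Complex.sin (ζ - v)) (Complex.sin v) (Complex.sin ζ) (Complex.sin ζ) i k s t * (gg v k)⁻¹) := by
  have h1 := f1' ζ v
  have h2 := f3' v
  have h3 : (qq ζ - qp ζ) * ex v = e2 v * (Complex.exp (v * Complex.I) * Complex.sin ζ) := by
    rw [qqp, e2, ex, two_mul (v * Complex.I), Complex.exp_add]; ring
  have h4 : qq ζ - qp ζ = e2 v * (Complex.sin ζ * (Complex.exp (v * Complex.I))⁻¹) := by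
    have := Complex.exp_ne_zero (v * Complex.I)
    rw [qqp, e2]; field_simp
  have hx : ex v = Complex.exp (v * Complex.I) * Complex.exp (v * Complex.I) := by
    rw [ex, two_mul, Complex.exp_add]
  have hE := Complex.exp_ne_zero (v * Complex.I)
  have hE' : Complex.exp (v * Complex.I) * (Complex.exp (v * Complex.I))⁻¹ = 1 := mul_inv_cancel₀ hE
  cases i <;> cases k <;> cases s <;> cases t <;> simp [Lq, lw, gg, h1, h2, h3, h4] <;> first | done | (rw [mul_right_comm, hE', one_mul]; done) | (left; rw [mul_right_comm, hE', one_mul]; done) | (rw [hx]; field_simp)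

theorem mono_gauge (ζ : ℝ) (v : ℂ) (n : ℕ) (i j : Bool) (σ τ : Ch n) :
    mono (Lq (qq ζ) (qp ζ) (fun _ => 1) (ex v)) n i j σ τ =
      e2 v ^ n * (gg v i * mono (fun _ => lw (Complex.sin (ζ - v)) (Complex.sin v) (Complex.sin ζ) (Complex.sin ζ)) n i j σ τ * (gg v j)⁻¹) := by
  induction n generalizing i j with
  | zero =>
    show (if i = j then (1 : Matrix (Ch 0) (Ch 0) ℂ) else 0) σ τ = e2 v ^ 0 * (gg v i * (if i = j then (1 : Matrix (Ch 0) (Ch 0) ℂ) else 0) σ τ * (gg v j)⁻¹)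
    split_ifs with h
    · subst h; rw [mul_right_comm, mul_inv_cancel₀ (gg_ne v i)]; simp
    · simp
  | succ n ih =>
    refine (mono_succ _ n i j σ.1 τ.1 σ.2 τ.2).trans ?_
    rw [show mono (fun _ => lw (Complex.sin (ζ - v)) (Complex.sin v) (Complex.sin ζ) (Complex.sin ζ)) (n+1) i j σ τ = _ from mono_succ _ n i j σ.1 τ.1 σ.2 τ.2]
    rw [Finset.mul_sum, Finset.sum_mul, Finset.mul_sum]
    refine Finset.sum_congr rfl fun k _ => ?_
    rw [ih, L_gauge]
    have := gg_ne v k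
    field_simp
    ring

theorem Tq_gauge (ζ : ℝ) (v : ℂ) (n : ℕ) :
    Tq (qq ζ) (qp ζ) (fun _ => 1) (ex v) n = e2 v ^ n • TT (Complex.sin (ζ - v)) (Complex.sin v) (Complex.sin ζ) n := by
  ext σ τ
  rw [Tq, Matrix.smul_apply, TT, Matrix.add_apply, Matrix.add_apply, mono_gauge, mono_gauge, smul_eq_mul,
    mul_right_comm (gg v false), mul_right_comm (gg v true), mul_inv_cancel₀ (gg_ne _ _), mul_inv_cancel₀ (gg_ne _ _)]
  ring

def vj (ζ lam : ℝ) : ℂ := ζ / 2 + lam * Complex.I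
theorem vj_re (ζ lam : ℝ) : (vj ζ lam).re = ζ / 2 := by simp [vj]

def tA (ζ : ℝ) (n : ℕ) (lam : Fin n → ℝ) (v : ℂ) : ℂ :=
  Complex.sin (ζ - v) ^ (2 * n) * ∏ j, (Complex.sin (v - vj ζ (lam j) + ζ) / Complex.sin (v - vj ζ (lam j)))
def tB (ζ : ℝ) (n : ℕ) (lam : Fin n → ℝ) (v : ℂ) : ℂ :=
  Complex.sin v ^ (2 * n) * ∏ j, (Complex.sin (v - vj ζ (lam j) - ζ) / Complex.sin (v - vj ζ (lam j)))

theorem bethe_eig (ζ : ℝ) (h0 : 0 < ζ) (hπ : ζ < π) (n : ℕ) (lam : Fin n → ℝ) (hinj : Function.Injective lam)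
    (hbae : ∀ j, Complex.sin (ζ - vj ζ (lam j)) ^ (2 * n) * ∏ k ∈ Finset.univ.erase j, Complex.sin (vj ζ (lam j) - vj ζ (lam k) + ζ)
      = Complex.sin (vj ζ (lam j)) ^ (2 * n) * ∏ k ∈ Finset.univ.erase j, Complex.sin (vj ζ (lam j) - vj ζ (lam k) - ζ))
    (v : ℂ) (hv0 : 0 < v.re) (hv1 : v.re < ζ / 2) :
    (-1) ^ n * (tA ζ n lam v + tB ζ n lam v) ∈ spectrum ℂ (TT (Complex.sin (ζ - v)) (Complex.sin v) (Complex.sin ζ) (2 * n)) := by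
  let z : ℕ → ℂ := fun j => if h : j < n then ex (vj ζ (lam ⟨j, h⟩)) else 1
  have hzj : ∀ j : Fin n, z j = ex (vj ζ (lam j)) := fun j => by simp [z]
  have hlt : ∀ {P : ℕ → Prop}, (∀ j : Fin n, P j) → ∀ j < n, P j := fun h j hj => h ⟨j, hj⟩
  have hsn : ∀ j, Complex.sin (v - vj ζ (lam j)) ≠ 0 := fun j => by
    rw [← neg_ne_zero, ← Complex.sin_neg]
    apply sin_ne <;> simp [vj_re] <;> linarith
  have key := bethe_hom (qq ζ) (qp ζ) (by rw [qq, qp, neg_mul_neg, ← Complex.exp_add]; simp)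
    (by rw [qqp]; exact mul_ne_zero (mul_ne_zero two_ne_zero Complex.I_ne_zero) (sin_ne _ (by simpa using h0) (by simpa using hπ)))
    n z ?_ ?_ ?_ (ex v) ?_ ?_ ?_
  · rw [spectrum.mem_iff, Matrix.isUnit_iff_isUnit_det, isUnit_iff_ne_zero, not_not]
    rw [Tq_gauge] at key
    have ht : (ex v * qq ζ - qp ζ) ^ (2 * n) * ∏ j : Fin n, ((z j * qq ζ - ex v * qp ζ) / (z j - ex v)) +
        (ex v - 1) ^ (2 * n) * ∏ j : Fin n, ((z j * qp ζ - ex v * qq ζ) / (z j - ex v))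
        = e2 v ^ (2 * n) * ((-1) ^ n * (tA ζ n lam v + tB ζ n lam v)) := by
      simp only [hzj, f1, f2, f3, f1', f3', tA, tB]
      have hd : ∀ (j : Fin n) (s : ℂ), e2 (vj ζ (lam j) + v) * s / (e2 (vj ζ (lam j) + v) * Complex.sin (vj ζ (lam j) - v))
          = (-1) * (s / Complex.sin (v - vj ζ (lam j))) := by
        intro j s
        rw [mul_div_mul_left _ _ (e2_ne _), ← neg_sub v, Complex.sin_neg, div_neg]; ring
      simp only [hd, Finset.prod_mul_distrib, Finset.prod_const, Finset.card_univ, Fintype.card_fin]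
      ring
    rw [ht] at key
    have hs : algebraMap ℂ (Matrix (Ch (2*n)) (Ch (2*n)) ℂ) ((-1) ^ n * (tA ζ n lam v + tB ζ n lam v)) - TT (Complex.sin (ζ - v)) (Complex.sin v) (Complex.sin ζ) (2 * n)
        = (-(e2 v ^ (2 * n))⁻¹) • (e2 v ^ (2 * n) • TT (Complex.sin (ζ - v)) (Complex.sin v) (Complex.sin ζ) (2 * n) - Matrix.scalar _ (e2 v ^ (2 * n) * ((-1) ^ n * (tA ζ n lam v + tB ζ n lam v)))) := by
      have h2 : e2 v ^ (2 * n) ≠ 0 := pow_ne_zero _ (e2_ne v)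
      rw [smul_sub, smul_smul, neg_mul, inv_mul_cancel₀ h2]
      ext σ τ
      simp only [Matrix.sub_apply, Matrix.smul_apply, Matrix.algebraMap_matrix_apply, Matrix.scalar_apply, Matrix.diagonal_apply]
      split_ifs
      · simp; field_simp; ring
      · simp
    rw [hs, Matrix.det_smul, key, mul_zero]
  · exact hlt (P := fun j => z j ≠ 0) fun j => by rw [hzj]; exact Complex.exp_ne_zero _
  · intro i hi j hj hij h
    have h1 : z i = _ := hzj ⟨i, hi⟩
    have h2 : z j = _ := hzj ⟨j, hj⟩
    rw [h1, h2] at h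
    have h3 := congrArg norm h
    rw [ex, ex, Complex.norm_exp, Complex.norm_exp, Real.exp_eq_exp] at h3
    simp [vj] at h3
    exact hij (by simpa using hinj h3)
  · intro i hi j hj
    have h1 : z i = _ := hzj ⟨i, hi⟩
    have h2 : z j = _ := hzj ⟨j, hj⟩
    rw [h1, h2, f1]
    exact mul_ne_zero (e2_ne _) (sin_ne _ (by simp [vj_re]; linarith) (by simp [vj_re]; linarith))
  · exact hlt (P := fun j => ex v ≠ z j) fun j => by
      rw [hzj, ← sub_ne_zero, f3]; exact mul_ne_zero (e2_ne _) (hsn j)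
  · exact hlt (P := fun j => _ ∨ z j * qq ζ - ex v * qp ζ ≠ 0) fun j => by
      right; rw [hzj, f1]
      exact mul_ne_zero (e2_ne _) (sin_ne _ (by simp [vj_re]; linarith) (by simp [vj_re]; linarith))
  · intro j
    have h := hbae j
    simp only [hzj, f1, f2, f1', f3', Finset.prod_mul_distrib, mul_pow]
    rw [show ∏ k ∈ Finset.univ.erase j, e2 (vj ζ (lam k) + vj ζ (lam j)) = ∏ k ∈ Finset.univ.erase j, e2 (vj ζ (lam k) + vj ζ (lam j)) from rfl]
    linear_combination (e2 (vj ζ (lam j)) ^ (2 * n) * ∏ k ∈ Finset.univ.erase j, e2 (vj ζ (lam k) + vj ζ (lam j))) * h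

def ph (c y : ℝ) : ℝ := 2 * Real.arctan (Real.cos c / Real.sin c * Real.tanh y)
theorem tanh_cont : Continuous Real.tanh := by
  have : Real.tanh = fun y => Real.sinh y / Real.cosh y := funext Real.tanh_eq_sinh_div_cosh
  rw [this]; exact Real.continuous_sinh.div Real.continuous_cosh fun y => (Real.cosh_pos y).ne'
theorem ph_cont (c : ℝ) : Continuous (ph c) :=
  continuous_const.mul (Real.continuous_arctan.comp (continuous_const.mul tanh_cont))
theorem ph_neg (c y : ℝ) : ph c (-y) = -ph c y := by
  rw [ph, ph, Real.tanh_neg, mul_neg, Real.arctan_neg, mul_neg]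
theorem ph_abs (c y : ℝ) : |ph c y| ≤ π := by
  have h1 := Real.neg_pi_div_two_lt_arctan (Real.cos c / Real.sin c * Real.tanh y)
  have h2 := Real.arctan_lt_pi_div_two (Real.cos c / Real.sin c * Real.tanh y)
  rw [ph, abs_le]; constructor <;> linarith
theorem tanh_lim : Tendsto Real.tanh atTop (nhds 1) := by
  have h : Real.tanh = fun y => (1 - Real.exp (-(2*y))) / (1 + Real.exp (-(2*y))) := by
    funext y
    rw [Real.tanh_eq_sinh_div_cosh, Real.sinh_eq, Real.cosh_eq, show -(2*y) = -y + -y by ring, Real.exp_add, Real.exp_neg]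
    have := Real.exp_pos y
    field_simp
  rw [h]
  have h0 : Tendsto (fun y : ℝ => Real.exp (-(2*y))) atTop (nhds 0) :=
    Real.tendsto_exp_neg_atTop_nhds_zero.comp (tendsto_id.const_mul_atTop (by norm_num : (0:ℝ) < 2))
  have h2 : Tendsto (fun y : ℝ => (1 - Real.exp (-(2*y))) / (1 + Real.exp (-(2*y)))) atTop (nhds ((1 - 0) / (1 + 0))) :=
    (h0.const_sub 1).div (h0.const_add 1) (by norm_num)
  simpa using h2
theorem ph_lim (c : ℝ) (h0 : 0 < c) (hπ : c < π) : Tendsto (ph c) atTop (nhds (π - 2 * c)) := by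
  have h1 : Tendsto (ph c) atTop (nhds (2 * Real.arctan (Real.cos c / Real.sin c * 1))) :=
    ((Real.continuous_arctan.tendsto _).comp (tanh_lim.const_mul _)).const_mul _
  have h2 : Real.arctan (Real.cos c / Real.sin c * 1) = π / 2 - c := by
    apply Real.arctan_eq_of_tan_eq
    · rw [Real.tan_eq_sin_div_cos, Real.sin_pi_div_two_sub, Real.cos_pi_div_two_sub, mul_one]
    · constructor <;> linarith
  rw [h2] at h1
  convert h1 using 2; ring

def Pp (c y : ℝ) : ℝ := ∫ s in (0:ℝ)..y, ph c s
theorem Pp_deriv (c y : ℝ) : HasDerivAt (Pp c) (ph c y) y :=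
  (ph_cont c).integral_hasStrictDerivAt 0 y |>.hasDerivAt
theorem Pp_neg (c y : ℝ) : Pp c (-y) = Pp c y := by
  have := intervalIntegral.integral_comp_neg (fun s => ph c s) (a := 0) (b := y)
  simp only [ph_neg, intervalIntegral.integral_neg, neg_zero] at this
  rw [Pp, Pp, intervalIntegral.integral_symm, ← this, neg_neg]
theorem Pp_asymp (c : ℝ) (h0 : 0 < c) (hπ : c < π) (ε : ℝ) (hε : 0 < ε) :
    ∃ C, ∀ y, abs (Pp c y - (π - 2 * c) * |y|) ≤ ε * |y| + C := by
  obtain ⟨Y, hY0, hY⟩ : ∃ Y : ℝ, 0 ≤ Y ∧ ∀ y ≥ Y, |ph c y - (π - 2 * c)| ≤ ε := by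
    have := (Metric.tendsto_nhds.1 (ph_lim c h0 hπ) ε hε)
    obtain ⟨Y, hY⟩ := eventually_atTop.1 this
    refine ⟨max Y 0, le_max_right _ _, fun y hy => ?_⟩
    have := hY y (le_trans (le_max_left _ _) hy)
    rw [Real.dist_eq] at this; exact this.le
  have hi : ∀ u w, IntervalIntegrable (fun s => ph c s - (π - 2 * c)) volume u w := fun u w =>
    ((ph_cont c).sub continuous_const).intervalIntegrable _ _
  have hP : ∀ y, Pp c y - (π - 2 * c) * y = ∫ s in (0:ℝ)..y, (ph c s - (π - 2 * c)) := by
    intro y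
    rw [intervalIntegral.integral_sub ((ph_cont c).intervalIntegrable _ _) (continuous_const.intervalIntegrable _ _)]
    rw [intervalIntegral.integral_const, Pp, smul_eq_mul]; ring
  have hb : ∀ y, 0 ≤ y → y ≤ Y → |∫ s in (0:ℝ)..y, (ph c s - (π - 2 * c))| ≤ 2 * π * Y := by
    intro y hy hyY
    have := intervalIntegral.norm_integral_le_of_norm_le_const (a := 0) (b := y) (C := 2 * π) (f := fun s => ph c s - (π - 2 * c)) (fun s _ => by
      have := abs_le.1 (ph_abs c s)
      rw [Real.norm_eq_abs, abs_le]; constructor <;> linarith [this.1, this.2])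
    rw [Real.norm_eq_abs, sub_zero, abs_of_nonneg hy] at this
    nlinarith [Real.pi_pos]
  have key : ∀ y, 0 ≤ y → |Pp c y - (π - 2 * c) * y| ≤ ε * y + 2 * π * Y := by
    intro y hy
    rw [hP]
    rcases le_total y Y with h | h
    · have := hb y hy h
      nlinarith
    · rw [← intervalIntegral.integral_add_adjacent_intervals (hi 0 Y) (hi Y y)]
      have h1 := hb Y hY0 le_rfl
      have h2 := intervalIntegral.norm_integral_le_of_norm_le_const (a := Y) (b := y) (C := ε) (f := fun s => ph c s - (π - 2 * c)) (fun s hs => by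
        rw [Set.uIoc_of_le h] at hs
        exact hY s hs.1.le)
      rw [Real.norm_eq_abs, abs_of_nonneg (sub_nonneg.2 h)] at h2
      refine (abs_add_le _ _).trans ?_
      nlinarith
  refine ⟨2 * π * Y, fun y => ?_⟩
  rcases le_total 0 y with h | h
  · rw [abs_of_nonneg h]; exact key y h
  · rw [abs_of_nonpos h, ← Pp_neg]; exact key _ (by linarith)

def sg {n : ℕ} (j k : Fin n) : ℝ := if k < j then 1 else if j < k then -1 else 0
theorem sg_anti {n : ℕ} (j k : Fin n) : sg k j = -sg j k := by
  unfold sg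
  rcases lt_trichotomy j k with h | h | h
  · simp [h, not_lt_of_gt h]
  · simp [h]
  · simp [h, not_lt_of_gt h]
theorem sg_abs {n : ℕ} (j k : Fin n) : |sg j k| ≤ 1 := by
  unfold sg; split_ifs <;> simp

theorem dsum_anti {n : ℕ} (r : Fin n → Fin n → ℝ) (hr : ∀ j k, r k j = -r j k) (h : Fin n → ℝ) :
    ∑ j, ∑ k, r j k * (h j - h k) = 2 * ∑ j, h j * ∑ k, r j k := by
  have h1 : ∑ j, ∑ k, r j k * h k = - ∑ j, ∑ k, r j k * h j := by
    rw [Finset.sum_comm, ← Finset.sum_neg_distrib]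
    refine Finset.sum_congr rfl fun j _ => ?_
    rw [← Finset.sum_neg_distrib]
    exact Finset.sum_congr rfl fun k _ => by rw [hr]; ring
  simp only [mul_sub, Finset.sum_sub_distrib, h1]
  rw [sub_neg_eq_add, ← two_mul]
  congr 1
  refine Finset.sum_congr rfl fun j _ => ?_
  rw [Finset.mul_sum]
  exact Finset.sum_congr rfl fun k _ => by ring

theorem bethe_exists (ζ : ℝ) (h0 : 0 < ζ) (hπ : ζ < π) (n : ℕ) :
    ∃ lam : Fin n → ℝ, ∀ j, 2 * n * ph (ζ/2) (lam j) = ∑ k, (ph ζ (lam j - lam k) + π * sg j k) := by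
  let S : (Fin n → ℝ) → ℝ := fun x => 2 * n * ∑ j, Pp (ζ/2) (x j) - (1/2) * ∑ j, ∑ k, (Pp ζ (x j - x k) + π * sg j k * (x j - x k))
  have hPc : ∀ c, Continuous (Pp c) := fun c => continuous_iff_continuousAt.2 fun y => (Pp_deriv c y).continuousAt
  have hc : Continuous S := by
    have h1 := hPc (ζ/2)
    have h2 := hPc ζ
    fun_prop
  have hlim : Tendsto S (cocompact _) atTop := by
    set ε : ℝ := (π - ζ) / (4 * n + 4) with hεd
    have hε : 0 < ε := div_pos (by linarith) (by positivity)
    have hεe : ε * (4 * n + 4) = π - ζ := by rw [hεd]; field_simp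
    obtain ⟨C1, hC1⟩ := Pp_asymp (ζ/2) (by linarith) (by linarith) ε hε
    obtain ⟨C2, hC2⟩ := Pp_asymp ζ h0 hπ ε hε
    have hb : ∀ x, (π - ζ) * ‖x‖ - (2 * n * (n * C1) + 1/2 * (n * (n * C2))) ≤ S x := by
      intro x
      set A := ∑ j, |x j| with hA
      have hA0 : ‖x‖ ≤ A := by
        rw [pi_norm_le_iff_of_nonneg (Finset.sum_nonneg fun _ _ => abs_nonneg _)]
        intro i
        exact Finset.single_le_sum (f := fun j => |x j|) (fun _ _ => abs_nonneg _) (Finset.mem_univ i)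
      have hAnn : 0 ≤ A := Finset.sum_nonneg fun _ _ => abs_nonneg _
      have e1 : (π - ζ - ε) * A - n * C1 ≤ ∑ j, Pp (ζ/2) (x j) := by
        calc (π - ζ - ε) * A - n * C1 = ∑ j, ((π - ζ - ε) * |x j| - C1) := by
              rw [Finset.sum_sub_distrib, ← Finset.mul_sum]; simp [hA]
          _ ≤ _ := Finset.sum_le_sum fun j _ => by
              have := (abs_le.1 (hC1 (x j))).1
              nlinarith
      have e2 : ∑ j, ∑ k, |x j - x k| ≤ (2 * n - 2) * A := by
        have : ∀ j, ∑ k, |x j - x k| ≤ (n - 2) * |x j| + A := by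
          intro j
          have hj : |x j - x j| = 0 := by simp
          calc ∑ k, |x j - x k| = ∑ k ∈ Finset.univ.erase j, |x j - x k| := by
                rw [← Finset.add_sum_erase _ _ (Finset.mem_univ j), hj, zero_add]
            _ ≤ ∑ k ∈ Finset.univ.erase j, (|x j| + |x k|) := Finset.sum_le_sum fun k _ => abs_sub _ _
            _ = _ := by
              have h2 : A = |x j| + ∑ k ∈ Finset.univ.erase j, |x k| := (Finset.add_sum_erase _ _ (Finset.mem_univ j)).symm
              have hn : 1 ≤ n := j.pos
              rw [Finset.sum_add_distrib, h2, Finset.sum_const, Finset.card_erase_of_mem (Finset.mem_univ j), Finset.card_univ, Fintype.card_fin, nsmul_eq_mul, Nat.cast_sub hn]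
              push_cast; ring
        refine (Finset.sum_le_sum fun j _ => this j).trans_eq ?_
        rw [Finset.sum_add_distrib, ← Finset.mul_sum, Finset.sum_const, Finset.card_univ, Fintype.card_fin, nsmul_eq_mul]
        ring
      have e3 : ∑ j, ∑ k, (Pp ζ (x j - x k) + π * sg j k * (x j - x k)) ≤ (2 * (π - ζ) + ε) * ((2 * n - 2) * A) + n * (n * C2) := by
        calc _ ≤ ∑ j, ∑ k, ((2 * (π - ζ) + ε) * |x j - x k| + C2) := by
              refine Finset.sum_le_sum fun j _ => Finset.sum_le_sum fun k _ => ?_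
              have a1 := (abs_le.1 (hC2 (x j - x k))).2
              have a2 : sg j k * (x j - x k) ≤ |x j - x k| := by
                refine (le_abs_self _).trans ?_
                rw [abs_mul]
                exact mul_le_of_le_one_left (abs_nonneg _) (sg_abs j k)
              nlinarith [Real.pi_pos]
          _ = (2 * (π - ζ) + ε) * ∑ j, ∑ k, |x j - x k| + n * (n * C2) := by
              simp [Finset.sum_add_distrib, Finset.mul_sum]
          _ ≤ _ := by
              have : 0 ≤ 2 * (π - ζ) + ε := by linarith
              nlinarith
      have hn0 : (0:ℝ) ≤ n := Nat.cast_nonneg n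
      have m1 : 2 * n * ((π - ζ - ε) * A - n * C1) ≤ 2 * n * ∑ j, Pp (ζ/2) (x j) := mul_le_mul_of_nonneg_left e1 (by positivity)
      have m2 : (π - ζ) * ‖x‖ ≤ (π - ζ) * A := mul_le_mul_of_nonneg_left hA0 (by linarith)
      have m3 : ε * (3 * n - 1) * A ≤ (π - ζ) * A := mul_le_mul_of_nonneg_right (by rw [← hεe]; nlinarith) hAnn
      have m4 : 0 ≤ (π - ζ) * A := mul_nonneg (by linarith) hAnn
      show _ ≤ 2 * n * ∑ j, Pp (ζ/2) (x j) - (1/2) * ∑ j, ∑ k, (Pp ζ (x j - x k) + π * sg j k * (x j - x k))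
      nlinarith
    refine tendsto_atTop_mono hb ?_
    exact tendsto_atTop_add_const_right _ _ (tendsto_norm_cocompact_atTop.const_mul_atTop (by linarith))
  obtain ⟨x, hx⟩ := hc.exists_forall_le hlim
  refine ⟨x, ?_⟩
  let r : Fin n → Fin n → ℝ := fun j k => ph ζ (x j - x k) + π * sg j k
  have hr : ∀ j k, r k j = -r j k := fun j k => by
    show ph ζ (x k - x j) + π * sg k j = -(ph ζ (x j - x k) + π * sg j k)
    rw [← neg_sub, ph_neg, sg_anti]; ring
  have hd : ∀ h : Fin n → ℝ, ∑ j, h j * (2 * n * ph (ζ/2) (x j) - ∑ k, r j k) = 0 := by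
    intro h
    have hD : HasDerivAt (fun s : ℝ => S (fun j => x j + s * h j))
        (2 * n * ∑ j, ph (ζ/2) (x j) * h j - (1/2) * ∑ j, ∑ k, r j k * (h j - h k)) 0 := by
      have l1 : ∀ j, HasDerivAt (fun s : ℝ => x j + s * h j) (h j) 0 := fun j => by
        simpa using ((hasDerivAt_id (0:ℝ)).mul_const (h j)).const_add (x j)
      refine HasDerivAt.sub (HasDerivAt.const_mul _ ?_) (HasDerivAt.const_mul _ ?_)
      · refine HasDerivAt.fun_sum fun j _ => ?_
        have := Pp_deriv (ζ/2) (x j + 0 * h j)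
        have q := this.comp (0:ℝ) (l1 j)
        rw [zero_mul, add_zero] at q
        exact q
      · refine HasDerivAt.fun_sum fun j _ => HasDerivAt.fun_sum fun k _ => ?_
        have l2 : HasDerivAt (fun s : ℝ => (x j + s * h j) - (x k + s * h k)) (h j - h k) 0 := (l1 j).sub (l1 k)
        have := Pp_deriv ζ ((x j + 0 * h j) - (x k + 0 * h k))
        have : HasDerivAt (fun s : ℝ => Pp ζ ((x j + s * h j) - (x k + s * h k)) + π * sg j k * ((x j + s * h j) - (x k + s * h k))) _ 0 :=
          (this.comp (0:ℝ) l2).add (l2.const_mul (π * sg j k))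
        rw [zero_mul, zero_mul, add_zero, add_zero, ← add_mul] at this
        exact this
    have hmin : IsLocalMin (fun s : ℝ => S (fun j => x j + s * h j)) 0 := by
      refine Filter.Eventually.of_forall fun s => ?_
      have : (fun j => x j + (0:ℝ) * h j) = x := by simp
      simp only [this]
      exact hx _
    have := hmin.hasDerivAt_eq_zero hD
    rw [dsum_anti r hr] at this
    rw [← this]
    simp only [mul_sub, Finset.sum_sub_distrib, Finset.mul_sum]
    congr 1
    · exact Finset.sum_congr rfl fun j _ => by ring
    · exact Finset.sum_congr rfl fun j _ => Finset.sum_congr rfl fun k _ => by ring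
  intro j
  have := hd (Pi.single j 1)
  rw [Finset.sum_eq_single j] at this
  · rw [Pi.single_eq_same, one_mul, sub_eq_zero] at this; exact this
  · intro k _ hk; rw [Pi.single_eq_of_ne hk, zero_mul]
  · simp

theorem bethe_inj (ζ : ℝ) (n : ℕ) (lam : Fin n → ℝ)
    (h : ∀ j, 2 * n * ph (ζ/2) (lam j) = ∑ k, (ph ζ (lam j - lam k) + π * sg j k)) : Function.Injective lam := by
  have key : ∀ i j : Fin n, i < j → lam i ≠ lam j := by
    intro i j hij he
    have h1 := h i
    have h2 := h j
    rw [he, h2, Finset.sum_add_distrib, Finset.sum_add_distrib, add_right_inj] at h1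
    have : ∑ k, π * sg i k < ∑ k, π * sg j k := by
      refine Finset.sum_lt_sum (fun k _ => mul_le_mul_of_nonneg_left ?_ Real.pi_pos.le) ⟨i, Finset.mem_univ _, mul_lt_mul_of_pos_left ?_ Real.pi_pos⟩
      · unfold sg
        split_ifs <;> first | (exfalso; omega) | norm_num
      · unfold sg; simp [hij]
    linarith
  intro i j he
  rcases lt_trichotomy i j with hl | hl | hl
  · exact absurd he (key i j hl)
  · exact hl
  · exact absurd he.symm (key j i hl)

theorem sin_polar (c y : ℝ) (hs : Real.sin c ≠ 0) :
    Complex.sin (c + y * Complex.I) = ((Real.sin c * Real.cosh y * Real.sqrt (1 + (Real.cos c / Real.sin c * Real.tanh y)^2) : ℝ) : ℂ) * Complex.exp ((ph c y / 2 : ℝ) * Complex.I) := by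
  have hq : Real.sqrt (1 + (Real.cos c / Real.sin c * Real.tanh y)^2) ≠ 0 := (Real.sqrt_pos.2 (by positivity)).ne'
  have hch := (Real.cosh_pos y).ne'
  rw [Complex.exp_mul_I, ← Complex.ofReal_cos, ← Complex.ofReal_sin, show ph c y / 2 = Real.arctan (Real.cos c / Real.sin c * Real.tanh y) by rw [ph]; ring,
    Real.cos_arctan, Real.sin_arctan, Complex.sin_add, Complex.cos_mul_I, Complex.sin_mul_I, ← Complex.ofReal_sin, ← Complex.ofReal_cos, ← Complex.ofReal_sinh, ← Complex.ofReal_cosh]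
  rw [Real.tanh_eq_sinh_div_cosh] at *
  set Q := Real.sqrt (1 + (Real.cos c / Real.sin c * (Real.sinh y / Real.cosh y))^2)
  have e1 : Real.sin c * Real.cosh y * Q * (1/Q) = Real.sin c * Real.cosh y := by field_simp
  have e2 : Real.sin c * Real.cosh y * Q * (Real.cos c / Real.sin c * (Real.sinh y / Real.cosh y)/Q) = Real.cos c * Real.sinh y := by field_simp
  rw [mul_add, ← Complex.ofReal_mul (_ * Q), ← mul_assoc (Complex.ofReal (_ * Q)), ← Complex.ofReal_mul (_ * Q), e1, e2]
  push_cast; ring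

theorem sin_conj_polar (c y : ℝ) (hs : Real.sin c ≠ 0) :
    Complex.sin (c + y * Complex.I) = Complex.exp ((ph c y : ℝ) * Complex.I) * Complex.sin (c - y * Complex.I) := by
  have h1 := sin_polar c y hs
  have h2 := sin_polar c (-y) hs
  rw [ph_neg, Real.tanh_neg, Real.cosh_neg, mul_neg, neg_sq] at h2
  rw [show (c:ℂ) - y * Complex.I = c + ((-y:ℝ):ℂ) * Complex.I by push_cast; ring, h1, h2, mul_left_comm, ← Complex.exp_add]
  congr 2; push_cast; ring

theorem bethe_bae (ζ : ℝ) (h0 : 0 < ζ) (hπ : ζ < π) (n : ℕ) (lam : Fin n → ℝ)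
    (h : ∀ j, 2 * n * ph (ζ/2) (lam j) = ∑ k, (ph ζ (lam j - lam k) + π * sg j k)) (j : Fin n) :
    Complex.sin (ζ - vj ζ (lam j)) ^ (2 * n) * ∏ k ∈ Finset.univ.erase j, Complex.sin (vj ζ (lam j) - vj ζ (lam k) + ζ)
      = Complex.sin (vj ζ (lam j)) ^ (2 * n) * ∏ k ∈ Finset.univ.erase j, Complex.sin (vj ζ (lam j) - vj ζ (lam k) - ζ) := by
  have s1 : Real.sin (ζ/2) ≠ 0 := (Real.sin_pos_of_pos_of_lt_pi (by linarith) (by linarith)).ne'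
  have s2 : Real.sin ζ ≠ 0 := (Real.sin_pos_of_pos_of_lt_pi (by linarith) (by linarith)).ne'
  have a1 : Complex.sin (vj ζ (lam j)) = Complex.exp ((ph (ζ/2) (lam j) : ℝ) * Complex.I) * Complex.sin (ζ - vj ζ (lam j)) := by
    have := sin_conj_polar (ζ/2) (lam j) s1
    rw [vj]; convert this using 3
    · push_cast; ring
    · push_cast; ring
  have a2 : ∀ k ∈ Finset.univ.erase j, Complex.sin (vj ζ (lam j) - vj ζ (lam k) + ζ) =
      Complex.exp ((ph ζ (lam j - lam k) + π * sg j k : ℝ) * Complex.I) * Complex.sin (vj ζ (lam j) - vj ζ (lam k) - ζ) := by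
    intro k hk
    have hk' : k ≠ j := Finset.ne_of_mem_erase hk
    have := sin_conj_polar ζ (lam j - lam k) s2
    have e1 : vj ζ (lam j) - vj ζ (lam k) + ζ = ζ + ((lam j - lam k : ℝ) : ℂ) * Complex.I := by simp [vj]; ring
    have e2 : vj ζ (lam j) - vj ζ (lam k) - ζ = -(ζ - ((lam j - lam k : ℝ) : ℂ) * Complex.I) := by simp [vj]; ring
    have e3 : Complex.exp (((π * sg j k : ℝ) : ℂ) * Complex.I) = -1 := by
      rcases lt_or_gt_of_ne hk' with hl | hl
      · simp [sg, hl]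
      · simp [sg, hl, not_lt_of_gt hl, Complex.exp_neg]
    rw [e1, e2, this, Complex.sin_neg, Complex.ofReal_add, add_mul, Complex.exp_add, e3]; ring
  have a3 : Complex.exp ((ph (ζ/2) (lam j) : ℝ) * Complex.I) ^ (2 * n) = ∏ k ∈ Finset.univ.erase j, Complex.exp ((ph ζ (lam j - lam k) + π * sg j k : ℝ) * Complex.I) := by
    rw [← Complex.exp_nat_mul, ← Complex.exp_sum, ← Finset.sum_mul, ← Complex.ofReal_sum]
    have := h j
    rw [← Finset.add_sum_erase _ _ (Finset.mem_univ j)] at this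
    rw [show ph ζ (lam j - lam j) + π * sg j j = 0 by simp [sg, ph], zero_add] at this
    rw [← this]
    congr 1; push_cast; ring
  rw [a1, Finset.prod_congr rfl a2, Finset.prod_mul_distrib, mul_pow, a3]; ring

def BAE (ζ : ℝ) (n : ℕ) (s : Fin n → Fin n → ℝ) (lam : Fin n → ℝ) : Prop :=
  (∀ j k, s k j = -s j k) ∧ (∀ j k, |s j k| ≤ 1) ∧
    ∀ j, 2 * n * ph (ζ/2) (lam j) = ∑ k, (ph ζ (lam j - lam k) + π * s j k)

theorem BAE.neg {ζ : ℝ} {n : ℕ} {s : Fin n → Fin n → ℝ} {lam : Fin n → ℝ} (h : BAE ζ n s lam) :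
    BAE ζ n (fun j k => -s j k) (fun j => -lam j) := by
  refine ⟨fun j k => by simp only [h.1 j k], fun j k => by rw [abs_neg]; exact h.2.1 j k, fun j => ?_⟩
  rw [ph_neg, mul_neg, h.2.2 j, ← Finset.sum_neg_distrib]
  refine Finset.sum_congr rfl fun k _ => ?_
  rw [show -lam j - -lam k = -(lam j - lam k) by ring, ph_neg]; ring

def cnt {n : ℕ} (lam : Fin n → ℝ) (Y : ℝ) : Finset (Fin n) := Finset.univ.filter fun j => Y < lam j

theorem cnt_anti {n : ℕ} (lam : Fin n → ℝ) {X Y : ℝ} (h : X ≤ Y) : cnt lam Y ⊆ cnt lam X := fun j hj => by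
  simp only [cnt, Finset.mem_filter, Finset.mem_univ, true_and] at *; linarith

theorem dsum_zero {n : ℕ} (r : Fin n → Fin n → ℝ) (hr : ∀ j k, r k j = -r j k) (U : Finset (Fin n)) :
    ∑ j ∈ U, ∑ k ∈ U, r j k = 0 := by
  have : ∑ j ∈ U, ∑ k ∈ U, r j k = - ∑ j ∈ U, ∑ k ∈ U, r j k := by
    conv_lhs => rw [Finset.sum_comm]
    rw [← Finset.sum_neg_distrib]
    refine Finset.sum_congr rfl fun j _ => ?_
    rw [← Finset.sum_neg_distrib]
    exact Finset.sum_congr rfl fun k _ => hr j k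
  linarith

theorem tight_step (ζ : ℝ) (n : ℕ) (s : Fin n → Fin n → ℝ) (lam : Fin n → ℝ) (h : BAE ζ n s lam)
    (Y P S : ℝ) (hY : 0 ≤ Y) (hP : ∀ y ≥ Y, P ≤ ph (ζ/2) y) (hS : ∀ y ≥ Y/2, ph ζ y ≤ S) (hne : 0 < (cnt lam Y).card) :
    2 * n * P ≤ (n - (cnt lam (Y/2)).card) * (S + π) + 2 * π * ((cnt lam (Y/2)).card - (cnt lam Y).card) := by
  set U := cnt lam Y with hU
  set V := cnt lam (Y/2) with hV
  have hUV : U ⊆ V := cnt_anti lam (by linarith)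
  have memU : ∀ j, j ∈ U ↔ Y < lam j := fun j => by simp [hU, cnt]
  have memV : ∀ j, j ∈ V ↔ Y/2 < lam j := fun j => by simp [hV, cnt]
  let r : Fin n → Fin n → ℝ := fun j k => ph ζ (lam j - lam k) + π * s j k
  have hr : ∀ j k, r k j = -r j k := fun j k => by
    show ph ζ (lam k - lam j) + π * s k j = -(ph ζ (lam j - lam k) + π * s j k)
    rw [← neg_sub, ph_neg, h.1]; ring
  have hs1 : ∀ j k, π * s j k ≤ π := fun j k => by
    have := (abs_le.1 (h.2.1 j k)).2
    nlinarith [Real.pi_pos]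
  have e1 : ∑ j ∈ U, ∑ k, r j k = ∑ j ∈ U, ∑ k ∈ Uᶜ, r j k := by
    have : ∀ j, ∑ k, r j k = ∑ k ∈ U, r j k + ∑ k ∈ Uᶜ, r j k := fun j => (Finset.sum_add_sum_compl U _).symm
    simp only [this, Finset.sum_add_distrib, dsum_zero r hr, zero_add]
  have e2 : ∀ j ∈ U, ∑ k ∈ Uᶜ, r j k ≤ (n - V.card) * (S + π) + 2 * π * (V.card - U.card) := by
    intro j hj
    have hj' := (memU j).1 hj
    have hsub : Vᶜ ⊆ Uᶜ := Finset.compl_subset_compl.2 hUV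
    rw [← Finset.sum_sdiff hsub]
    have b1 : ∑ k ∈ Vᶜ, r j k ≤ ∑ k ∈ Vᶜ, (S + π) := Finset.sum_le_sum fun k hk => by
      rw [Finset.mem_compl, memV, not_lt] at hk
      exact add_le_add (hS _ (by linarith)) (hs1 j k)
    have b2 : ∑ k ∈ Uᶜ \ Vᶜ, r j k ≤ ∑ k ∈ Uᶜ \ Vᶜ, (2 * π) := Finset.sum_le_sum fun k hk => by
      have := (abs_le.1 (ph_abs ζ (lam j - lam k))).2
      have := hs1 j k
      show ph ζ (lam j - lam k) + π * s j k ≤ 2 * π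
      linarith
    rw [Finset.sum_const, nsmul_eq_mul] at b1 b2
    have c1 : ((Vᶜ.card : ℕ) : ℝ) = n - V.card := by
      have := Finset.card_add_card_compl V
      rw [Fintype.card_fin] at this
      have t : (V.card : ℝ) + Vᶜ.card = n := by exact_mod_cast this
      linarith
    have c2 : (((Uᶜ \ Vᶜ).card : ℕ) : ℝ) = V.card - U.card := by
      have := Finset.card_sdiff_add_card_eq_card hsub
      have hh := Finset.card_add_card_compl U
      rw [Fintype.card_fin] at hh
      have t1 : ((Uᶜ \ Vᶜ).card : ℝ) + Vᶜ.card = Uᶜ.card := by exact_mod_cast this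
      have t2 : (U.card : ℝ) + Uᶜ.card = n := by exact_mod_cast hh
      linarith
    rw [c1] at b1; rw [c2] at b2
    linarith
  have e3 : ∑ j ∈ U, 2 * n * P ≤ ∑ j ∈ U, ((n - V.card) * (S + π) + 2 * π * ((V.card : ℝ) - U.card)) := by
    calc ∑ j ∈ U, 2 * n * P ≤ ∑ j ∈ U, 2 * n * ph (ζ/2) (lam j) := Finset.sum_le_sum fun j hj =>
          mul_le_mul_of_nonneg_left (hP _ ((memU j).1 hj).le) (by positivity)
      _ = ∑ j ∈ U, ∑ k, r j k := Finset.sum_congr rfl fun j _ => h.2.2 j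
      _ = _ := e1
      _ ≤ _ := Finset.sum_le_sum e2
  rw [Finset.sum_const, Finset.sum_const, nsmul_eq_mul, nsmul_eq_mul] at e3
  exact le_of_mul_le_mul_left e3 (by exact_mod_cast hne)

theorem tight_up (ζ : ℝ) (h0 : 0 < ζ) (hπ : ζ < π) (ε : ℝ) (hε : 0 < ε) :
    ∃ Y : ℝ, ∀ (n : ℕ) (s : Fin n → Fin n → ℝ) (lam : Fin n → ℝ), BAE ζ n s lam → ((cnt lam Y).card : ℝ) ≤ ε * n := by
  set η := ε * (π - ζ) / 3 with hη
  have hη0 : 0 < η := by have : 0 < π - ζ := by linarith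
                         positivity
  obtain ⟨Y0, hY0, hP, hS⟩ : ∃ Y0 : ℝ, 0 < Y0 ∧ (∀ y ≥ Y0, π - ζ - η ≤ ph (ζ/2) y) ∧ (∀ y ≥ Y0, ph ζ y ≤ π - 2 * ζ + η) := by
    have a1 := (ph_lim (ζ/2) (by linarith) (by linarith)).eventually (lt_mem_nhds (show π - ζ - η < π - 2 * (ζ/2) by linarith))
    have a2 := (ph_lim ζ h0 hπ).eventually (gt_mem_nhds (show π - 2 * ζ < π - 2 * ζ + η by linarith))
    obtain ⟨Y, hY⟩ := eventually_atTop.1 (a1.and a2)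
    exact ⟨max Y 1, by positivity, fun y hy => (hY y (le_trans (le_max_left _ _) hy)).1.le, fun y hy => (hY y (le_trans (le_max_left _ _) hy)).2.le⟩
  set δ := ε * (π - ζ) / (2 * π) with hδ
  have hδ0 : 0 < δ := by have : 0 < π - ζ := by linarith
                         positivity
  have hδe : 2 * π * δ = ε * (π - ζ) := by rw [hδ]; field_simp
  have hηe : 3 * η = ε * (π - ζ) := by rw [hη]; ring
  obtain ⟨M, hM⟩ := exists_nat_ge (1 / δ)
  refine ⟨2 ^ M * Y0, fun n s lam h => ?_⟩
  have key : ∀ m : ℕ, ε * n < (cnt lam (2 ^ m * Y0)).card → ((cnt lam (2 ^ m * Y0)).card : ℝ) ≤ n - m * δ * n := by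
    intro m
    induction m with
    | zero =>
      intro _
      have := Finset.card_le_univ (cnt lam (2 ^ 0 * Y0))
      rw [Fintype.card_fin] at this
      have : ((cnt lam (2 ^ 0 * Y0)).card : ℝ) ≤ n := by exact_mod_cast this
      simpa using this
    | succ m ih =>
      intro hm
      have hh : 2 ^ (m+1) * Y0 / 2 = 2 ^ m * Y0 := by rw [pow_succ]; ring
      have hpm : (1:ℝ) ≤ 2 ^ m := one_le_pow₀ (by norm_num)
      have hge : Y0 ≤ 2 ^ m * Y0 := by nlinarith
      have hge' : Y0 ≤ 2 ^ (m+1) * Y0 := by rw [pow_succ]; nlinarith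
      have hst := tight_step ζ n s lam h (2 ^ (m+1) * Y0) (π - ζ - η) (π - 2 * ζ + η) (by linarith)
        (fun y hy => hP y (by linarith)) (fun y hy => hS y (by rw [hh] at hy; linarith))
        (by
          have : (0:ℝ) < (cnt lam (2 ^ (m+1) * Y0)).card := lt_of_le_of_lt (by positivity) hm
          exact_mod_cast this)
      rw [hh] at hst
      have hmon : ((cnt lam (2 ^ (m+1) * Y0)).card : ℝ) ≤ (cnt lam (2 ^ m * Y0)).card := by
        have hle : 2 ^ m * Y0 ≤ 2 ^ (m+1) * Y0 := by rw [pow_succ]; nlinarith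
        exact_mod_cast Finset.card_le_card (cnt_anti lam hle)
      have hm' := ih (lt_of_lt_of_le hm hmon)
      set t := ((cnt lam (2 ^ m * Y0)).card : ℝ)
      set t' := ((cnt lam (2 ^ (m+1) * Y0)).card : ℝ)
      have hπp := Real.pi_pos
      have ht : ε * n < t := lt_of_lt_of_le hm hmon
      have ht0 : 0 ≤ t := le_trans (by positivity) ht.le
      have hn0 : (0:ℝ) ≤ n := Nat.cast_nonneg n
      have q1 : (π - ζ) * (ε * n) ≤ (π - ζ) * t := mul_le_mul_of_nonneg_left ht.le (by linarith)
      have q2 : 2 * π * (δ * n) ≤ 2 * π * (t - t') := by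
        have : 0 ≤ η * t := by positivity
        have e4 : 2 * π * (δ * n) = (π - ζ) * (ε * n) := by rw [← mul_assoc, hδe]; ring
        have e5 : 3 * η * n = (π - ζ) * (ε * n) := by rw [hηe]; ring
        nlinarith
      have q3 : δ * n ≤ t - t' := le_of_mul_le_mul_left q2 (by positivity)
      push_cast; nlinarith
  by_contra hcon
  push Not at hcon
  have h1 := key M hcon
  have h2 : 1 ≤ M * δ := by rwa [div_le_iff₀ hδ0] at hM
  have hn0 : (0:ℝ) ≤ n := Nat.cast_nonneg n
  rcases hn0.eq_or_lt with h3 | h3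
  · rw [← h3] at h1 hcon; linarith
  · have : 0 < ε * n := by positivity
    nlinarith

theorem Isinh_re_bound (κ : ℝ → ℝ) (hm : Measurable κ) (C α : ℝ) (hκ : ∀ t, |κ t| ≤ C * Real.exp (-(α * |t|)))
    (r : ℝ) (hr : r < α) (u : ℂ) (hu : |u.re| ≤ r) :
    |(Isinh κ u).re| ≤ r * ∫ t : ℝ, C * Real.exp (-((α - r) * |t|)) := by
  rw [Isinh_re κ hm C α hκ u (by linarith), ← integral_const_mul, ← Real.norm_eq_abs]
  refine norm_integral_le_of_norm_le (((int_expabs (α - r) (by linarith)).const_mul C).const_mul r) (ae_of_all _ fun t => ?_)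
  have h1 := norm_sinh_div_le (u.re : ℂ) t (κ t)
  rw [← Complex.ofReal_mul, ← Complex.ofReal_sinh, ← Complex.ofReal_mul, Complex.norm_real, Complex.norm_real, Complex.ofReal_re, Real.norm_eq_abs, Real.norm_eq_abs] at h1
  have h2 := bd_exp κ hm C α hκ r t
  have h3 : Real.exp (|u.re| * |t|) * |κ t| ≤ Real.exp (r * |t|) * |κ t| := by gcongr
  rw [Real.norm_eq_abs, mul_right_comm, abs_mul]
  have hr0 : 0 ≤ r := (abs_nonneg _).trans hu
  calc _ ≤ |Real.sinh (u.re * t) * (κ t / t)| * 1 := by gcongr; exact Real.abs_cos_le_one _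
    _ ≤ _ := by
      rw [mul_one]
      refine h1.trans ?_
      exact mul_le_mul hu (h3.trans h2) (by positivity) hr0

def Gl (Z : ℝ) (w : ℂ) : ℂ := Complex.log (Complex.sin ((Z + w) / 2)) - Complex.log (Complex.sin ((Z - w) / 2))

section G
variable (Z : ℝ) (h0 : 0 < Z) (hπ : Z < π)
include h0 hπ

theorem Gl_args (w : ℂ) (hw : |w.re| < Z) :
    0 < (Complex.sin ((Z + w) / 2)).re ∧ 0 < (Complex.sin ((Z - w) / 2)).re := by
  rw [abs_lt] at hw
  constructor
  · apply sin_re_pos <;> simp <;> linarith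
  · apply sin_re_pos <;> simp <;> linarith

theorem Gl_diff (w : ℂ) (hw : |w.re| < Z) : DifferentiableAt ℂ (Gl Z) w := by
  obtain ⟨h1, h2⟩ := Gl_args Z h0 hπ w hw
  unfold Gl
  refine DifferentiableAt.sub (DifferentiableAt.clog ?_ (Or.inl h1)) (DifferentiableAt.clog ?_ (Or.inl h2))
  · fun_prop
  · fun_prop

theorem ne_of_re_pos {z : ℂ} (h : 0 < z.re) : z ≠ 0 := fun h' => by simp [h'] at h

theorem RK_eq (w : ℂ) (hw : |w.re| < Z) :
    (Isinh (κ0 Z) w).re = Real.log ‖Complex.sin ((Z + w) / 2)‖ - Real.log ‖Complex.sin ((Z - w) / 2)‖ := by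
  obtain ⟨h1, h2⟩ := Gl_args Z h0 hπ w hw
  have h2' := norm_ne_zero_iff.2 (ne_of_re_pos Z h0 hπ h2)
  rw [← K_id Z h0 hπ w hw, norm_mul, Real.log_mul (norm_ne_zero_iff.2 (Complex.exp_ne_zero _)) h2', Complex.norm_exp, Real.log_exp]
  ring

theorem Gl_re (w : ℂ) (hw : |w.re| < Z) : (Gl Z w).re = (Isinh (κ0 Z) w).re := by
  rw [RK_eq Z h0 hπ w hw, Gl, Complex.sub_re, Complex.log_re, Complex.log_re]

theorem RK_bound (r : ℝ) (hr : r < Z) : ∃ B, ∀ w : ℂ, |w.re| ≤ r → |(Isinh (κ0 Z) w).re| ≤ B :=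
  ⟨_, fun w hw => Isinh_re_bound (κ0 Z) (κ0_meas Z) 1 Z (κ0_bound Z h0 hπ) r hr w hw⟩

theorem Gl_bound (r : ℝ) (hr : r < Z) : ∃ B, ∀ w : ℂ, |w.re| ≤ r → ‖Gl Z w‖ ≤ B := by
  obtain ⟨B, hB⟩ := RK_bound Z h0 hπ r hr
  refine ⟨B + 2 * π, fun w hw => (Complex.norm_le_abs_re_add_abs_im _).trans (add_le_add ?_ ?_)⟩
  · rw [Gl_re Z h0 hπ w (by linarith)]; exact hB w hw
  · rw [Gl, Complex.sub_im, Complex.log_im, Complex.log_im]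
    refine (abs_sub _ _).trans ?_
    linarith [Complex.abs_arg_le_pi (Complex.sin ((Z + w) / 2)), Complex.abs_arg_le_pi (Complex.sin ((Z - w) / 2))]
end G

theorem conv_hol (μ : Measure ℝ) [IsProbabilityMeasure μ] (G : ℂ → ℂ) (a b B : ℝ)
    (hd : ∀ z : ℂ, a < z.re → z.re < b → DifferentiableAt ℂ G z) (hB : ∀ z : ℂ, a < z.re → z.re < b → ‖G z‖ ≤ B)
    (v : ℂ) (hav : a < v.re) (hvb : v.re < b) :
    Integrable (fun l : ℝ => G (v - l * Complex.I)) μ ∧ DifferentiableAt ℂ (fun v => ∫ l : ℝ, G (v - l * Complex.I) ∂μ) v := by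
  have hre : ∀ (z : ℂ) (l : ℝ), (z - l * Complex.I).re = z.re := fun z l => by simp
  have hm : ∀ z : ℂ, a < z.re → z.re < b → AEStronglyMeasurable (fun l : ℝ => G (z - l * Complex.I)) μ := by
    intro z h1 h2
    refine Continuous.aestronglyMeasurable (continuous_iff_continuousAt.2 fun l => ?_)
    have := (hd (z - l * Complex.I) (by rwa [hre]) (by rwa [hre])).continuousAt
    exact ContinuousAt.comp (f := fun l : ℝ => z - l * Complex.I) this (by fun_prop)
  have hi : ∀ z : ℂ, a < z.re → z.re < b → Integrable (fun l : ℝ => G (z - l * Complex.I)) μ := by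
    intro z h1 h2
    exact Integrable.of_bound (hm z h1 h2) B (ae_of_all _ fun l => hB _ (by rwa [hre]) (by rwa [hre]))
  refine ⟨hi v hav hvb, ?_⟩
  obtain ⟨ε, hε, hε1, hε2⟩ : ∃ ε > 0, a + 2 * ε < v.re ∧ v.re + 2 * ε < b :=
    ⟨min (v.re - a) (b - v.re) / 4, by have := lt_min (sub_pos.2 hav) (sub_pos.2 hvb); linarith,
      by have := min_le_left (v.re - a) (b - v.re); linarith, by have := min_le_right (v.re - a) (b - v.re); linarith⟩
  have hball : ∀ (z y : ℂ), ‖y - z‖ ≤ ε → z.re - ε ≤ y.re ∧ y.re ≤ z.re + ε := by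
    intro z y h
    have := (Complex.abs_re_le_norm (y - z)).trans h
    rw [Complex.sub_re, abs_le] at this
    constructor <;> linarith [this.1, this.2]
  refine (hasDerivAt_integral_of_dominated_loc_of_deriv_le (Metric.ball_mem_nhds v hε)
    (F := fun v (l : ℝ) => G (v - l * Complex.I)) (F' := fun v (l : ℝ) => deriv G (v - l * Complex.I))
    (bound := fun _ => B / ε) ?_ (hi v hav hvb) ?_ ?_ (integrable_const _) ?_).2.differentiableAt
  · filter_upwards [Metric.ball_mem_nhds v hε] with z hz
    rw [mem_ball_iff_norm] at hz
    have := hball v z hz.le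
    exact hm z (by linarith) (by linarith)
  · exact ((measurable_deriv G).comp (by fun_prop)).aestronglyMeasurable
  · refine ae_of_all _ fun l z hz => ?_
    rw [mem_ball_iff_norm] at hz
    have h1 := hball v z hz.le
    have hs : ∀ y, ‖y - (z - l * Complex.I)‖ ≤ ε → a < y.re ∧ y.re < b := by
      intro y hy
      have := hball _ y hy
      rw [hre] at this
      constructor <;> linarith
    refine Complex.norm_deriv_le_of_forall_mem_sphere_norm_le hε ?_ ?_
    · apply DifferentiableOn.diffContOnCl
      rw [closure_ball _ hε.ne']
      intro y hy
      rw [mem_closedBall_iff_norm] at hy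
      exact (hd y (hs y hy).1 (hs y hy).2).differentiableWithinAt
    · intro y hy
      rw [mem_sphere_iff_norm] at hy
      exact hB y (hs y hy.le).1 (hs y hy.le).2
  · refine ae_of_all _ fun l z hz => ?_
    rw [mem_ball_iff_norm] at hz
    have h1 := hball v z hz.le
    have h2 := (hd (z - l * Complex.I) (by rw [hre]; linarith) (by rw [hre]; linarith)).hasDerivAt
    exact h2.comp_sub_const z (l * Complex.I)

/-- nonzero real-analytic functions are nonzero densely -/
theorem dense_ne {E : Type*} [NormedAddCommGroup E] [NormedSpace ℝ E] (f : E → ℝ) (s : Set E) (ho : IsOpen s) (hs : IsPreconnected s)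
    (hf : AnalyticOnNhd ℝ f s) (z0 : E) (h0 : z0 ∈ s) (hz0 : f z0 ≠ 0) (x : E) (hx : x ∈ s) :
    ∃ᶠ y in nhds x, y ∈ s ∧ f y ≠ 0 := by
  intro h
  have h2 : f =ᶠ[nhds x] 0 := by
    filter_upwards [h, ho.mem_nhds hx] with y hy hys
    by_contra hc
    exact hy ⟨hys, hc⟩
  exact hz0 (hf.eqOn_zero_of_preconnected_of_eventuallyEq_zero hs hx h2 h0)

def hR (ζ : ℝ) (μ : Measure ℝ) (v : ℂ) : ℝ :=
  (Isinh (kk ζ) (2 * v)).re - (1/2) * ∫ l : ℝ, (Isinh (κ0 ζ) (2 * (v - l * Complex.I))).re ∂μ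
def Dd (ζ : ℝ) (μ : Measure ℝ) (v : ℂ) : ℝ :=
  2 * (Real.log ‖Complex.sin v‖ - Real.log ‖Complex.sin (ζ - v)‖) + ∫ l : ℝ, (Isinh (κ0 (2 * ζ)) (ζ - 2 * (v - l * Complex.I))).re ∂μ
def strip (ζ : ℝ) : Set ℂ := {v | 0 < v.re ∧ v.re < ζ / 2}
theorem strip_open (ζ : ℝ) : IsOpen (strip ζ) :=
  (isOpen_lt continuous_const Complex.continuous_re).inter (isOpen_lt Complex.continuous_re continuous_const)
theorem strip_pre (ζ : ℝ) : IsPreconnected (strip ζ) := by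
  have : Convex ℝ (strip ζ) := (convex_halfSpace_re_gt 0).inter (convex_halfSpace_re_lt (ζ/2))
  exact this.isPreconnected

section G
variable (ζ : ℝ) (h0 : 0 < ζ) (hπ : ζ < π) (μ : Measure ℝ) [IsProbabilityMeasure μ]
include h0 hπ

theorem re_two (v : ℂ) (l : ℝ) : (2 * (v - l * Complex.I)).re = 2 * v.re := by simp

theorem hR_cont (v : ℂ) (hv : v ∈ strip ζ) : ContinuousAt (hR ζ μ) v := by
  obtain ⟨hv0, hv1⟩ := hv
  obtain ⟨r, hr1, hr2⟩ := exists_between hv1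
  obtain ⟨B, hB⟩ := Gl_bound ζ h0 hπ (2 * r) (by linarith)
  have hc := conv_hol μ (fun z => Gl ζ (2 * z)) (-r) r B
    (fun z h1 h2 => by
      have := Gl_diff ζ h0 hπ (2 * z) (by rw [show (2 * z).re = 2 * z.re by simp, abs_lt]; constructor <;> linarith)
      exact DifferentiableAt.comp (g := Gl ζ) (f := fun z => 2 * z) z this (by fun_prop))
    (fun z h1 h2 => hB _ (by rw [show (2 * z).re = 2 * z.re by simp, abs_le]; constructor <;> linarith))
  have h1 := ((Complex.continuous_re.continuousAt).comp (hc v (by linarith) hr1).2.continuousAt)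
  have h2 : ContinuousAt (fun v : ℂ => ∫ l : ℝ, (Isinh (κ0 ζ) (2 * (v - l * Complex.I))).re ∂μ) v := by
    refine h1.congr ?_
    have ho : IsOpen {z : ℂ | -r < z.re ∧ z.re < r} := (isOpen_lt continuous_const Complex.continuous_re).inter (isOpen_lt Complex.continuous_re continuous_const)
    filter_upwards [ho.mem_nhds (show -r < v.re ∧ v.re < r from ⟨by linarith, hr1⟩)] with z hz
    show (∫ l : ℝ, Gl ζ (2 * (z - l * Complex.I)) ∂μ).re = _
    refine (integral_re (hc z hz.1 hz.2).1).symm.trans ?_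
    refine integral_congr_ae (ae_of_all _ fun l => ?_)
    exact Gl_re ζ h0 hπ _ (by rw [re_two ζ h0 hπ, abs_lt]; constructor <;> linarith [hz.1, hz.2])
  have h3 : ContinuousAt (fun v : ℂ => (Isinh (kk ζ) (2 * v)).re) v := by
    have := (Isinh_deriv (kk ζ) (kk_meas ζ) 1 (2 * ζ) (kk_bound ζ h0 hπ) (2 * v) (by rw [show (2 * v).re = 2 * v.re by simp, abs_lt]; constructor <;> linarith)).continuousAt
    exact Complex.continuous_re.continuousAt.comp (ContinuousAt.comp (g := Isinh (kk ζ)) (f := fun v => 2 * v) this (by fun_prop))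
  exact h3.sub (h2.const_mul _)

variable (hζ2 : ζ < π / 2)
include hζ2

theorem Dd_an : AnalyticOnNhd ℝ (Dd ζ μ) (strip ζ) := by
  obtain ⟨B, hB⟩ := Gl_bound (2 * ζ) (by linarith) (by linarith) ζ (by linarith)
  have hc := conv_hol μ (fun z => Gl (2 * ζ) (ζ - 2 * z)) 0 (ζ / 2) B
    (fun z h1 h2 => by
      have := Gl_diff (2 * ζ) (by linarith) (by linarith) (ζ - 2 * z) (by simp [abs_lt]; constructor <;> linarith)
      exact DifferentiableAt.comp (g := Gl (2 * ζ)) (f := fun z : ℂ => (ζ : ℂ) - 2 * z) z this (by fun_prop))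
    (fun z h1 h2 => hB _ (by simp [abs_le]; constructor <;> linarith))
  let Ψ : ℂ → ℂ := fun v => 2 * (Complex.log (Complex.sin v) - Complex.log (Complex.sin (ζ - v))) + ∫ l : ℝ, Gl (2 * ζ) (ζ - 2 * (v - l * Complex.I)) ∂μ
  have hd : DifferentiableOn ℂ Ψ (strip ζ) := by
    intro v hv
    obtain ⟨hv0, hv1⟩ := hv
    apply DifferentiableAt.differentiableWithinAt
    refine DifferentiableAt.add (DifferentiableAt.const_mul (DifferentiableAt.sub (DifferentiableAt.clog ?_ (Or.inl ?_)) (DifferentiableAt.clog ?_ (Or.inl ?_))) _) (hc v hv0 hv1).2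
    · fun_prop
    · exact sin_re_pos _ hv0 (by linarith)
    · fun_prop
    · apply sin_re_pos <;> simp <;> linarith
  have ha : AnalyticOnNhd ℝ Ψ (strip ζ) := fun z hz => (hd.analyticOnNhd (strip_open ζ) z hz).restrictScalars
  have ha2 : AnalyticOnNhd ℝ (fun v => (Ψ v).re) (strip ζ) := fun z hz =>
    (Complex.reCLM.analyticAt _).comp (ha z hz)
  refine ha2.congr (strip_open ζ) fun v hv => ?_
  obtain ⟨hv0, hv1⟩ := hv
  have e1 : (∫ l : ℝ, Gl (2 * ζ) (ζ - 2 * (v - l * Complex.I)) ∂μ).re = ∫ l : ℝ, (Isinh (κ0 (2 * ζ)) (ζ - 2 * (v - l * Complex.I))).re ∂μ := by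
    refine (integral_re (hc v hv0 hv1).1).symm.trans ?_
    refine integral_congr_ae (ae_of_all _ fun l => ?_)
    exact Gl_re (2 * ζ) (by linarith) (by linarith) _ (by simp [abs_lt]; constructor <;> linarith)
  simp only [Ψ, Dd]
  rw [Complex.add_re, e1, Complex.mul_re, Complex.sub_re, Complex.log_re, Complex.log_re]
  simp

theorem Dd_neg : ∃ x : ℝ, 0 < x ∧ x < ζ / 2 ∧ Dd ζ μ x < 0 := by
  obtain ⟨B, hB⟩ := RK_bound (2 * ζ) (by linarith) (by linarith) ζ (by linarith)
  have hs : 0 < Real.sin (ζ / 2) := Real.sin_pos_of_pos_of_lt_pi (by linarith) (by linarith)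
  set x := min (ζ / 4) (Real.sin (ζ / 2) * Real.exp (-(B/2) - 1)) with hx
  have hx0 : 0 < x := lt_min (by linarith) (by positivity)
  have hx1 : x ≤ ζ / 4 := min_le_left _ _
  have hx2 : x ≤ Real.sin (ζ / 2) * Real.exp (-(B/2) - 1) := min_le_right _ _
  refine ⟨x, hx0, by linarith, ?_⟩
  have hsx : 0 < Real.sin x := Real.sin_pos_of_pos_of_lt_pi hx0 (by linarith)
  have hsζ : Real.sin (ζ / 2) ≤ Real.sin (ζ - x) := Real.sin_le_sin_of_le_of_le_pi_div_two (by linarith) (by linarith) (by linarith)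
  have h1 : Real.log (Real.sin x) ≤ Real.log (Real.sin (ζ/2)) + (-(B/2) - 1) := by
    rw [← Real.log_exp (-(B/2) - 1), ← Real.log_mul hs.ne' (Real.exp_ne_zero _)]
    exact Real.log_le_log hsx ((Real.sin_le hx0.le).trans hx2)
  have h2 : Real.log (Real.sin (ζ/2)) ≤ Real.log (Real.sin (ζ - x)) := Real.log_le_log hs hsζ
  have h3 : ∫ l : ℝ, (Isinh (κ0 (2 * ζ)) (ζ - 2 * (x - l * Complex.I))).re ∂μ ≤ B := by
    have := norm_integral_le_of_norm_le_const (μ := μ) (C := B) (f := fun l : ℝ => (Isinh (κ0 (2 * ζ)) (ζ - 2 * (x - l * Complex.I))).re)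
      (ae_of_all _ fun l => by
        rw [Real.norm_eq_abs]
        exact hB _ (by simp [abs_le]; constructor <;> linarith))
    simp at this
    exact (le_abs_self _).trans this
  rw [Dd, ← Complex.ofReal_sub, ← Complex.ofReal_sin, ← Complex.ofReal_sin, Complex.norm_real, Complex.norm_real, Real.norm_eq_abs, Real.norm_eq_abs, Real.log_abs, Real.log_abs]
  linarith

theorem Dd_dense (v : ℂ) (hv : v ∈ strip ζ) : ∃ᶠ w in nhds v, w ∈ strip ζ ∧ Dd ζ μ w ≠ 0 := by
  obtain ⟨x, hx0, hx1, hx⟩ := Dd_neg ζ h0 hπ μ hζ2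
  exact dense_ne (Dd ζ μ) _ (strip_open ζ) (strip_pre ζ) (Dd_an ζ h0 hπ μ hζ2) x (by simpa [strip] using ⟨hx0, hx1⟩) hx.ne v hv

theorem Dd_dense_real (r : ℝ) (hr : r ∈ Set.Ioo 0 (ζ/2)) : ∃ᶠ x : ℝ in nhds r, x ∈ Set.Ioo 0 (ζ/2) ∧ Dd ζ μ x ≠ 0 := by
  obtain ⟨x, hx0, hx1, hx⟩ := Dd_neg ζ h0 hπ μ hζ2
  refine dense_ne (fun x : ℝ => Dd ζ μ x) _ isOpen_Ioo isPreconnected_Ioo (fun y hy => ?_) x ⟨hx0, hx1⟩ hx.ne r hr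
  exact (Dd_an ζ h0 hπ μ hζ2 y (by simpa [strip] using hy)).comp (Complex.ofRealCLM.analyticAt y)
end G

section FT
open scoped FourierTransform

theorem gauss_lim (f : ℝ → ℂ) (hf : Integrable f) (hc : ContinuousAt f 0) :
    Tendsto (fun c : ℝ => ∫ w : ℝ, Complex.exp (- c⁻¹ * ‖w‖ ^ 2) • (𝓕 f) w) atTop (nhds (f 0)) := by
  refine (Real.tendsto_integral_gaussian_smul' hf hc).congr' ?_
  filter_upwards [Ioi_mem_atTop 0] with c (hc : 0 < c)
  have J : Integrable (fun w : ℝ => Complex.exp (- c⁻¹ * ‖w‖ ^ 2 + 2 * π * Complex.I * (inner ℝ (0:ℝ) w : ℝ))) :=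
    GaussianFourier.integrable_cexp_neg_mul_sq_norm_add (by simpa) _ _
  have e := (VectorFourier.integral_fourierIntegral_smul_eq_flip (L := innerₗ ℝ)
      Real.continuous_fourierChar continuous_inner J hf).symm
  have e2 : ∫ w : ℝ, Complex.exp (- c⁻¹ * ‖w‖ ^ 2) • (𝓕 f) w = ∫ w : ℝ, 𝓕 (fun w : ℝ => Complex.exp (- c⁻¹ * ‖w‖ ^ 2 + 2 * π * Complex.I * (inner ℝ (0:ℝ) w : ℝ))) w • f w := by
    have e' := e
    simp only [inner_zero_left, Complex.ofReal_zero, mul_zero, add_zero] at e' ⊢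
    simpa using! e'
  rw [e2]
  congr with w
  rw [fourier_gaussian_innerProductSpace' (by simpa)]
  simp only [Complex.ofReal_inv, div_inv_eq_mul]
  congr 3
  ring

section G
variable (ζ : ℝ) (h0 : 0 < ζ) (hπ : ζ < π) (μ : Measure ℝ) [IsProbabilityMeasure μ]
include h0 hπ

def mm (μ : Measure ℝ) (t : ℝ) : ℂ := ∫ l : ℝ, Complex.exp ((2 * l * t : ℝ) * Complex.I) ∂μ
theorem mm_cont : Continuous (mm μ) := by
  unfold mm
  refine continuous_of_dominated (bound := fun _ => 1) (fun t => ?_) (fun t => ae_of_all _ fun l => ?_) (integrable_const _) (ae_of_all _ fun l => ?_)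
  · exact Continuous.aestronglyMeasurable (by fun_prop)
  · rw [Complex.norm_exp_ofReal_mul_I]
  · fun_prop
theorem mm_zero : mm μ 0 = 1 := by simp [mm]

theorem kk_cosh (t : ℝ) : Real.cosh (ζ * t) * kk ζ t = κ0 ζ t / 2 := by
  have := (Real.cosh_pos (ζ * t)).ne'
  rw [kk]; field_simp

theorem rigid (r : ℝ) (hr0 : 0 < r) (hr1 : r < ζ / 2) (hp : ∀ y : ℝ, 0 ≤ hR ζ μ (r + y * Complex.I)) : hR ζ μ r = 0 := by
  let u : ℂ := ((2 * r : ℝ) : ℂ)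
  have hu : |u.re| < ζ := by simp [u, abs_of_pos hr0]; linarith
  let P : ℝ → ℂ := fun t => Complex.sinh (u * t) * ((kk ζ t / t : ℝ) : ℂ)
  let g : ℝ → ℂ := fun t => (1/2) * (Complex.sinh (u * t) * ((κ0 ζ t / t : ℝ) : ℂ))
  have hP : Integrable P := int_sinh (kk ζ) (kk_meas ζ) 1 (2 * ζ) (kk_bound ζ h0 hπ) u (by linarith)
  have hg : Integrable g := (int_sinh (κ0 ζ) (κ0_meas ζ) 1 ζ (κ0_bound ζ h0 hπ) u hu).const_mul _
  have hgP : ∀ t, g t = P t * Real.cosh (ζ * t) := fun t => by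
    have : ((κ0 ζ t / t : ℝ) : ℂ) = 2 * (((kk ζ t / t : ℝ) : ℂ) * Real.cosh (ζ * t)) := by
      rw [← Complex.ofReal_mul, show kk ζ t / t * Real.cosh (ζ * t) = κ0 ζ t / 2 / t by rw [← kk_cosh ζ h0 hπ]; ring]
      push_cast; ring
    simp only [g, P]; rw [this]; ring
  let f : ℝ → ℂ := fun t => P t - g t * mm μ t
  have hmb : ∀ t, ‖mm μ t‖ ≤ 1 := fun t => by
    have := norm_integral_le_of_norm_le_const (μ := μ) (C := 1) (f := fun l : ℝ => Complex.exp ((2 * l * t : ℝ) * Complex.I)) (ae_of_all _ fun l => by rw [Complex.norm_exp_ofReal_mul_I])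
    simpa [mm] using this
  have hgm : Integrable (fun t => g t * mm μ t) := hg.mul_bdd (c := 1) (mm_cont ζ h0 hπ μ).aestronglyMeasurable (ae_of_all _ hmb)
  have hf : Integrable f := hP.sub hgm
  have hf0 : f 0 = 0 := by simp [f, P, g]
  have hfc : ContinuousAt f 0 := by
    rw [ContinuousAt, hf0]
    have hb : ∀ t, ‖f t‖ ≤ ‖u‖ * Real.exp (|u.re| * |t|) * ‖1 - Real.cosh (ζ * t) * mm μ t‖ := by
      intro t
      have : f t = P t * (1 - Real.cosh (ζ * t) * mm μ t) := by simp only [f]; rw [hgP]; ring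
      rw [this, norm_mul]
      refine mul_le_mul_of_nonneg_right ((norm_sinh_div_le u t (kk ζ t)).trans ?_) (norm_nonneg _)
      rw [← mul_assoc]
      refine mul_le_of_le_one_right (by positivity) ((kk_bound ζ h0 hπ t).trans ?_)
      rw [one_mul, Real.exp_le_one_iff]
      have : 0 ≤ 2 * ζ * |t| := by positivity
      linarith
    refine squeeze_zero_norm hb ?_
    have hmc := mm_cont ζ h0 hπ μ
    have hc : Continuous (fun t : ℝ => ‖u‖ * Real.exp (|u.re| * |t|) * ‖1 - Real.cosh (ζ * t) * mm μ t‖) := by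
      fun_prop
    have := hc.tendsto 0
    simpa [mm_zero ζ h0 hπ] using this
  have hF : ∀ y : ℝ, ((𝓕 f) y).re = hR ζ μ (r + (π * y : ℝ) * Complex.I) := by
    intro y
    let e : ℝ → ℂ := fun t => Complex.exp ((-2 * π * t * y : ℝ) * Complex.I)
    have he : Continuous e := by fun_prop
    have heb : ∀ t, ‖e t‖ = 1 := fun t => Complex.norm_exp_ofReal_mul_I _
    rw [Real.fourier_real_eq_integral_exp_smul]
    have s1 : ∫ t : ℝ, e t • f t = (∫ t : ℝ, e t * P t) - (∫ t : ℝ, e t * (g t * mm μ t)) := by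
      rw [← integral_sub]
      · refine integral_congr_ae (ae_of_all _ fun t => ?_)
        simp only [f, smul_eq_mul]; ring
      · exact hP.bdd_mul (c := 1) he.aestronglyMeasurable (ae_of_all _ fun t => (heb t).le)
      · exact hgm.bdd_mul (c := 1) he.aestronglyMeasurable (ae_of_all _ fun t => (heb t).le)
    have hprod : Integrable (Function.uncurry fun (t l : ℝ) => e t * g t * Complex.exp ((2 * l * t : ℝ) * Complex.I)) (volume.prod μ) := by
      have : Integrable (fun p : ℝ × ℝ => g p.1) (volume.prod μ) := hg.comp_fst μ
      have h2 : Continuous (fun p : ℝ × ℝ => e p.1 * Complex.exp ((2 * p.2 * p.1 : ℝ) * Complex.I)) := by fun_prop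
      refine (this.bdd_mul (c := 1) h2.aestronglyMeasurable (ae_of_all _ fun p => ?_)).congr (ae_of_all _ fun p => ?_)
      · rw [norm_mul, heb, Complex.norm_exp_ofReal_mul_I, one_mul]
      · simp only [Function.uncurry]; ring
    have s2 : ∫ t : ℝ, e t * (g t * mm μ t) = ∫ l : ℝ, (∫ t : ℝ, e t * g t * Complex.exp ((2 * l * t : ℝ) * Complex.I)) ∂μ := by
      rw [← integral_integral_swap hprod]
      refine integral_congr_ae (ae_of_all _ fun t => ?_)
      simp only [mm]
      rw [integral_const_mul]; ring
    have hcosre : ∀ (κ : ℝ → ℝ) (c t : ℝ), (Complex.exp ((c : ℝ) * Complex.I) * (Complex.sinh (u * t) * ((κ t / t : ℝ) : ℂ))).re = Real.sinh (2 * r * t) * Real.cos c * (κ t / t) := by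
      intro κ c t
      rw [← Complex.ofReal_mul, ← Complex.ofReal_sinh, ← Complex.ofReal_mul, Complex.re_mul_ofReal, Complex.exp_ofReal_mul_I_re]; ring
    have s3 : (∫ t : ℝ, e t * P t).re = (Isinh (kk ζ) (2 * (r + (π * y : ℝ) * Complex.I))).re := by
      rw [Isinh_re (kk ζ) (kk_meas ζ) 1 (2 * ζ) (kk_bound ζ h0 hπ) _ (by simp [abs_of_pos hr0]; linarith)]
      refine (integral_re (hP.bdd_mul (c := 1) he.aestronglyMeasurable (ae_of_all _ fun t => (heb t).le))).symm.trans ?_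
      refine integral_congr_ae (ae_of_all _ fun t => ?_)
      refine (hcosre (kk ζ) _ t).trans ?_
      rw [show -2 * π * t * y = -(2 * (π * y) * t) by ring, Real.cos_neg]
      simp
    have hint : ∀ l : ℝ, Integrable (fun t : ℝ => e t * g t * Complex.exp ((2 * l * t : ℝ) * Complex.I)) := fun l => by
      have h2 : Continuous (fun t : ℝ => e t * Complex.exp ((2 * l * t : ℝ) * Complex.I)) := by fun_prop
      refine (hg.bdd_mul (c := 1) h2.aestronglyMeasurable (ae_of_all _ fun p => ?_)).congr (ae_of_all _ fun p => ?_)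
      · rw [norm_mul, heb, Complex.norm_exp_ofReal_mul_I, one_mul]
      · ring
    have s4 : (∫ l : ℝ, (∫ t : ℝ, e t * g t * Complex.exp ((2 * l * t : ℝ) * Complex.I)) ∂μ).re =
        (1/2) * ∫ l : ℝ, (Isinh (κ0 ζ) (2 * ((r + (π * y : ℝ) * Complex.I) - l * Complex.I))).re ∂μ := by
      refine (integral_re hprod.integral_prod_right).symm.trans ?_
      rw [← integral_const_mul]
      refine integral_congr_ae (ae_of_all _ fun l => ?_)
      refine (integral_re (hint l)).symm.trans ?_
      simp only
      rw [Isinh_re (κ0 ζ) (κ0_meas ζ) 1 ζ (κ0_bound ζ h0 hπ) _ (by simp [abs_of_pos hr0]; linarith), ← integral_const_mul]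
      refine integral_congr_ae (ae_of_all _ fun t => ?_)
      have : e t * g t * Complex.exp ((2 * l * t : ℝ) * Complex.I) = ((1/2 : ℝ) : ℂ) * (Complex.exp ((-(2 * (π * y - l) * t) : ℝ) * Complex.I) * (Complex.sinh (u * t) * ((κ0 ζ t / t : ℝ) : ℂ))) := by
        simp only [e, g]
        rw [show ((-(2 * (π * y - l) * t) : ℝ) : ℂ) * Complex.I = ((-2 * π * t * y : ℝ) : ℂ) * Complex.I + ((2 * l * t : ℝ) : ℂ) * Complex.I by push_cast; ring, Complex.exp_add]
        push_cast; ring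
      simp only [this, RCLike.re_to_complex]
      rw [Complex.re_ofReal_mul, hcosre, Real.cos_neg]
      simp
    show (∫ t : ℝ, e t • f t).re = _
    rw [s1, s2, Complex.sub_re, s3, s4, hR]
  have hFc : Continuous (𝓕 f) := VectorFourier.fourierIntegral_continuous Real.continuous_fourierChar (L := innerₗ ℝ) continuous_inner hf
  have hFb : ∀ y, ‖(𝓕 f) y‖ ≤ ∫ t, ‖f t‖ := fun y => VectorFourier.norm_fourierIntegral_le_integral_norm _ _ _ _ _
  let H : ℝ → ℝ := fun y => ((𝓕 f) y).re
  have hH0 : ∀ y, 0 ≤ H y := fun y => by simp only [H]; rw [hF]; exact hp _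
  have hHc : Continuous H := Complex.continuous_re.comp hFc
  have hHb : ∀ y, ‖H y‖ ≤ ∫ t, ‖f t‖ := fun y => (Complex.abs_re_le_norm _).trans (hFb y)
  have hgi : ∀ c : ℝ, 0 < c → Integrable (fun w : ℝ => Real.exp (-c * w ^ 2)) := fun c hc => integrable_exp_neg_mul_sq hc
  have hHi : ∀ c : ℝ, 0 < c → Integrable (fun w : ℝ => Real.exp (-c * w ^ 2) * H w) := fun c hc =>
    (hgi c hc).mul_bdd hHc.aestronglyMeasurable (ae_of_all _ hHb)
  have hlim : Tendsto (fun c : ℝ => ∫ w : ℝ, Real.exp (-c⁻¹ * w ^ 2) * H w) atTop (nhds 0) := by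
    have h1 := (Complex.continuous_re.tendsto _).comp (gauss_lim f hf hfc)
    rw [hf0, Complex.zero_re] at h1
    refine h1.congr' ?_
    filter_upwards [Ioi_mem_atTop 0] with c (hc : 0 < c)
    have e1 : ∀ w : ℝ, Complex.exp (- c⁻¹ * ‖w‖ ^ 2) • (𝓕 f) w = ((Real.exp (-c⁻¹ * w ^ 2) : ℝ) : ℂ) * (𝓕 f) w := fun w => by
      rw [smul_eq_mul, Complex.ofReal_exp]; congr 2; push_cast; congr 1
      rw [← Complex.ofReal_pow, Real.norm_eq_abs, sq_abs, Complex.ofReal_pow]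
    simp only [Function.comp, e1]
    have hi : Integrable (fun w : ℝ => ((Real.exp (-c⁻¹ * w ^ 2) : ℝ) : ℂ) * (𝓕 f) w) :=
      (hgi c⁻¹ (inv_pos.2 hc)).ofReal.mul_bdd hFc.aestronglyMeasurable (ae_of_all _ hFb)
    refine (integral_re hi).symm.trans ?_
    refine integral_congr_ae (ae_of_all _ fun w => ?_)
    simp only [RCLike.re_to_complex]
    rw [Complex.re_ofReal_mul]
  have hle : ∫ w : ℝ, Real.exp (-1 * w ^ 2) * H w ≤ 0 := by
    refine ge_of_tendsto hlim ?_
    filter_upwards [Ici_mem_atTop 1] with c (hc : 1 ≤ c)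
    refine integral_mono (hHi 1 one_pos) (hHi c⁻¹ (inv_pos.2 (by linarith))) fun w => ?_
    refine mul_le_mul_of_nonneg_right (Real.exp_le_exp.2 ?_) (hH0 w)
    have := inv_le_one_of_one_le₀ hc
    nlinarith [sq_nonneg w]
  have hnn : 0 ≤ fun w : ℝ => Real.exp (-1 * w ^ 2) * H w := fun w => mul_nonneg (Real.exp_pos _).le (hH0 w)
  have hz := (integral_eq_zero_iff_of_nonneg hnn (hHi 1 one_pos)).1 (le_antisymm hle (integral_nonneg hnn))
  have hzz := (Continuous.ae_eq_iff_eq volume (by fun_prop) (by fun_prop)).1 hz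
  have := congrFun hzz 0
  simp [H] at this
  rw [hF] at this
  simpa using this
end G
end FT

def emp (n : ℕ) (lam : Fin n → ℝ) : Measure ℝ := ∑ j, (n : ENNReal)⁻¹ • Measure.dirac (lam j)

theorem emp_int (n : ℕ) (lam : Fin n → ℝ) (f : ℝ → ℝ) (hf : Continuous f) (hn : 0 < n) :
    ∫ x, f x ∂(emp n lam) = (∑ j, f (lam j)) / n := by
  rw [emp, integral_finset_sum_measure]
  · simp only [integral_smul_measure, integral_dirac]
    rw [← Finset.smul_sum, smul_eq_mul, ENNReal.toReal_inv, ENNReal.toReal_natCast]; field_simp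
  · intro j _
    exact (integrable_dirac (by simp)).smul_measure (by simp; omega)

theorem emp_meas (n : ℕ) (lam : Fin n → ℝ) (s : Set ℝ) (hs : MeasurableSet s) (T : Finset (Fin n)) (h : ∀ j, lam j ∈ s → j ∈ T) :
    emp n lam s ≤ (n : ENNReal)⁻¹ * T.card := by
  classical
  rw [emp, Measure.finset_sum_apply]
  simp only [Measure.smul_apply, Measure.dirac_apply' _ hs, smul_eq_mul]
  rw [← Finset.mul_sum]
  gcongr
  rw [Finset.card_eq_sum_ones, Nat.cast_sum, ← Finset.sum_subset (Finset.subset_univ T)]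
  · refine Finset.sum_le_sum fun j _ => ?_
    rw [Set.indicator_apply]; split_ifs <;> simp
  · intro j _ hj
    exact Set.indicator_of_notMem (fun h' => hj (h j h')) _

theorem emp_prob (n : ℕ) (hn : 0 < n) (lam : Fin n → ℝ) : IsProbabilityMeasure (emp n lam) := by
  constructor
  rw [emp, Measure.finset_sum_apply]
  simp
  exact ENNReal.mul_inv_cancel (by simp; omega) (by simp)

theorem emp_lim (ζ : ℝ) (h0 : 0 < ζ) (hπ : ζ < π) (U : Ultrafilter ℕ) (lam : ∀ n, Fin (n+1) → ℝ)
    (hlam : ∀ n, BAE ζ (n+1) sg (lam n)) :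
    ∃ μ : Measure ℝ, IsProbabilityMeasure μ ∧ ∀ f : ℝ → ℝ, Continuous f → (∃ B, ∀ x, |f x| ≤ B) →
      Tendsto (fun n => (∑ j, f (lam n j)) / ((n+1 : ℕ) : ℝ)) U (nhds (∫ x, f x ∂μ)) := by
  let p : ℕ → ProbabilityMeasure ℝ := fun n => ⟨emp (n+1) (lam n), emp_prob _ (by omega) _⟩
  have ht : IsTightMeasureSet {((μ : ProbabilityMeasure ℝ) : Measure ℝ) | μ ∈ Set.range p} := by
    rw [isTightMeasureSet_iff_exists_isCompact_measure_compl_le]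
    intro ε hε
    obtain ⟨δ, hδ0, hδ⟩ := ENNReal.lt_iff_exists_nnreal_btwn.1 hε
    have hδ0' : (0:ℝ) < δ := by simpa using hδ0
    obtain ⟨Y, hY⟩ := tight_up ζ h0 hπ (δ/2) (by positivity)
    refine ⟨Set.Icc (-Y) Y, isCompact_Icc, ?_⟩
    rintro _ ⟨_, ⟨n, rfl⟩, rfl⟩
    have h1 := hY _ _ _ (hlam n)
    have h2 : ((cnt (-lam n) Y).card : ℝ) ≤ _ := hY _ _ _ (hlam n).neg
    refine (emp_meas (n+1) (lam n) _ measurableSet_Icc.compl (cnt (lam n) Y ∪ cnt (-lam n) Y) ?_).trans (le_trans ?_ hδ.le)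
    · intro j hj
      simp only [cnt, Finset.mem_union, Finset.mem_filter, Finset.mem_univ, true_and, Pi.neg_apply]
      by_contra hh
      push Not at hh
      exact hj ⟨by linarith [hh.2], hh.1⟩
    · have h3 : ((cnt (lam n) Y ∪ cnt (-lam n) Y).card : ℝ) ≤ δ * ((n+1 : ℕ) : ℝ) := by
        have : ((cnt (lam n) Y ∪ cnt (-lam n) Y).card : ℝ) ≤ (cnt (lam n) Y).card + (cnt (-lam n) Y).card := by
          exact_mod_cast Finset.card_union_le _ _
        linarith
      have h4 : ((cnt (lam n) Y ∪ cnt (-lam n) Y).card : ENNReal) ≤ δ * ((n+1 : ℕ) : ENNReal) := by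
        have : ((cnt (lam n) Y ∪ cnt (-lam n) Y).card : NNReal) ≤ δ * ((n+1 : ℕ) : NNReal) := by
          rw [← NNReal.coe_le_coe]; push_cast; push_cast at h3; exact h3
        exact_mod_cast this
      calc _ ≤ ((n+1 : ℕ) : ENNReal)⁻¹ * (δ * ((n+1 : ℕ) : ENNReal)) := by gcongr
        _ = δ * (((n+1 : ℕ) : ENNReal)⁻¹ * ((n+1 : ℕ) : ENNReal)) := by ring
        _ = δ := by rw [ENNReal.inv_mul_cancel (by simp) (by simp), mul_one]
        _ ≤ δ := le_rfl
  have hc := isCompact_closure_of_isTightMeasureSet ht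
  obtain ⟨μ, -, hμ⟩ := hc.ultrafilter_le_nhds (U.map p) (by
    rw [le_principal_iff]
    exact Filter.mem_map.2 (Filter.univ_mem' fun n => subset_closure ⟨n, rfl⟩))
  refine ⟨μ, inferInstance, fun f hf ⟨B, hB⟩ => ?_⟩
  have hμ' : Tendsto p U (nhds μ) := hμ
  have := (ProbabilityMeasure.tendsto_iff_forall_integral_tendsto.1 hμ') (BoundedContinuousFunction.ofNormedAddCommGroup f hf B hB)
  refine this.congr fun n => ?_
  exact emp_int (n+1) (lam n) f hf (by omega)

theorem lam_exists (ζ : ℝ) (h0 : 0 < ζ) (hπ : ζ < π) : ∃ lam : ∀ n, Fin (n+1) → ℝ,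
    (∀ n, BAE ζ (n+1) sg (lam n)) ∧ ∀ n (v : ℂ), 0 < v.re → v.re < ζ / 2 →
      (-1) ^ (n+1) * (tA ζ (n+1) (lam n) v + tB ζ (n+1) (lam n) v) ∈ spectrum ℂ (TT (Complex.sin (ζ - v)) (Complex.sin v) (Complex.sin ζ) (2 * (n+1))) := by
  choose lam h using fun n => bethe_exists ζ h0 hπ (n+1)
  exact ⟨lam, fun n => ⟨sg_anti, sg_abs, h n⟩, fun n v h1 h2 =>
    bethe_eig ζ h0 hπ (n+1) (lam n) (bethe_inj ζ _ _ (h n)) (bethe_bae ζ h0 hπ _ _ (h n)) v h1 h2⟩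

theorem nsin_sq (z : ℂ) : ‖Complex.sin z‖ ^ 2 = Real.sin z.re ^ 2 + Real.sinh z.im ^ 2 := by
  have h1 : Complex.sin z = (Real.sin z.re * Real.cosh z.im : ℝ) + (Real.cos z.re * Real.sinh z.im : ℝ) * Complex.I := by
    conv_lhs => rw [← Complex.re_add_im z, Complex.sin_add, Complex.sin_mul_I, Complex.cos_mul_I]
    push_cast; ring
  rw [h1, Complex.sq_norm, Complex.normSq_add_mul_I]
  have := Real.cosh_sq z.im
  have := Real.sin_sq_add_cos_sq z.re
  rw [mul_pow, mul_pow, Real.cosh_sq]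
  linear_combination (Real.sinh z.im ^ 2) * this

section G
variable (ζ : ℝ) (h0 : 0 < ζ) (hπ : ζ < π)
include h0 hπ

theorem tA_log (m : ℕ) (lam : Fin m → ℝ) (v : ℂ) (hv : v ∈ strip ζ) : tA ζ m lam v ≠ 0 ∧
    Real.log ‖tA ζ m lam v‖ = 2 * m * Real.log ‖Complex.sin (ζ - v)‖ + ∑ j, (Isinh (κ0 ζ) (2 * (v - lam j * Complex.I))).re := by
  obtain ⟨hv0, hv1⟩ := hv
  have hs : Complex.sin (ζ - v) ≠ 0 := sin_ne _ (by simp; linarith) (by simp; linarith)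
  have hw : ∀ j, |(2 * (v - lam j * Complex.I)).re| < ζ := fun j => by
    rw [re_two ζ h0 hπ, abs_lt]; constructor <;> linarith
  have e1 : ∀ j, ((ζ : ℂ) + 2 * (v - lam j * Complex.I)) / 2 = v - vj ζ (lam j) + ζ := fun j => by rw [vj]; ring
  have e2 : ∀ j, ((ζ : ℂ) - 2 * (v - lam j * Complex.I)) / 2 = -(v - vj ζ (lam j)) := fun j => by rw [vj]; ring
  have n1 : ∀ j, Complex.sin (v - vj ζ (lam j) + ζ) ≠ 0 := fun j => by
    have := (Gl_args ζ h0 hπ _ (hw j)).1; rw [e1] at this; exact ne_of_re_pos ζ h0 hπ this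
  have n2 : ∀ j, Complex.sin (v - vj ζ (lam j)) ≠ 0 := fun j => by
    have := (Gl_args ζ h0 hπ _ (hw j)).2; rw [e2, Complex.sin_neg] at this; exact neg_ne_zero.1 (ne_of_re_pos ζ h0 hπ this)
  have hp : ∏ j, (Complex.sin (v - vj ζ (lam j) + ζ) / Complex.sin (v - vj ζ (lam j))) ≠ 0 :=
    Finset.prod_ne_zero_iff.2 fun j _ => div_ne_zero (n1 j) (n2 j)
  refine ⟨mul_ne_zero (pow_ne_zero _ hs) hp, ?_⟩
  rw [tA, norm_mul, Real.log_mul (norm_ne_zero_iff.2 (pow_ne_zero _ hs)) (norm_ne_zero_iff.2 hp), norm_pow, Real.log_pow, norm_prod, Real.log_prod (fun j _ => norm_ne_zero_iff.2 (div_ne_zero (n1 j) (n2 j)))]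
  congr 1
  · push_cast; ring
  · refine Finset.sum_congr rfl fun j _ => ?_
    rw [RK_eq ζ h0 hπ _ (hw j), e1, e2, Complex.sin_neg, norm_neg, norm_div, Real.log_div (norm_ne_zero_iff.2 (n1 j)) (norm_ne_zero_iff.2 (n2 j))]

theorem tB_log (hζ2 : ζ < π / 2) (m : ℕ) (lam : Fin m → ℝ) (v : ℂ) (hv : v ∈ strip ζ) : tB ζ m lam v ≠ 0 ∧
    Real.log ‖tB ζ m lam v‖ - Real.log ‖tA ζ m lam v‖ = 2 * m * (Real.log ‖Complex.sin v‖ - Real.log ‖Complex.sin (ζ - v)‖) + ∑ j, (Isinh (κ0 (2 * ζ)) (ζ - 2 * (v - lam j * Complex.I))).re := by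
  obtain ⟨hA0, hA⟩ := tA_log ζ h0 hπ m lam v hv
  obtain ⟨hv0, hv1⟩ := hv
  have hs : Complex.sin v ≠ 0 := sin_ne _ (by linarith) (by linarith)
  have hw : ∀ j, |(2 * (v - lam j * Complex.I)).re| < ζ := fun j => by
    rw [re_two ζ h0 hπ, abs_lt]; constructor <;> linarith
  have hw' : ∀ j, |((ζ:ℂ) - 2 * (v - lam j * Complex.I)).re| < 2 * ζ := fun j => by
    rw [Complex.sub_re, re_two ζ h0 hπ, Complex.ofReal_re, abs_lt]; constructor <;> linarith
  have e1 : ∀ j, ((ζ : ℂ) + 2 * (v - lam j * Complex.I)) / 2 = v - vj ζ (lam j) + ζ := fun j => by rw [vj]; ring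
  have e2 : ∀ j, ((ζ : ℂ) - 2 * (v - lam j * Complex.I)) / 2 = -(v - vj ζ (lam j)) := fun j => by rw [vj]; ring
  have e3 : ∀ j, (((2 * ζ : ℝ) : ℂ) + (ζ - 2 * (v - lam j * Complex.I))) / 2 = -(v - vj ζ (lam j) - ζ) := fun j => by rw [vj]; push_cast; ring
  have e4 : ∀ j, (((2 * ζ : ℝ) : ℂ) - (ζ - 2 * (v - lam j * Complex.I))) / 2 = v - vj ζ (lam j) + ζ := fun j => by rw [vj]; push_cast; ring
  have n2 : ∀ j, Complex.sin (v - vj ζ (lam j)) ≠ 0 := fun j => by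
    have := (Gl_args ζ h0 hπ _ (hw j)).2; rw [e2, Complex.sin_neg] at this; exact neg_ne_zero.1 (ne_of_re_pos ζ h0 hπ this)
  have n3 : ∀ j, Complex.sin (v - vj ζ (lam j) - ζ) ≠ 0 := fun j => by
    have := (Gl_args (2 * ζ) (by linarith) (by linarith) _ (hw' j)).1; rw [e3, Complex.sin_neg] at this; exact neg_ne_zero.1 (ne_of_re_pos ζ h0 hπ this)
  have hp : ∏ j, (Complex.sin (v - vj ζ (lam j) - ζ) / Complex.sin (v - vj ζ (lam j))) ≠ 0 :=
    Finset.prod_ne_zero_iff.2 fun j _ => div_ne_zero (n3 j) (n2 j)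
  refine ⟨mul_ne_zero (pow_ne_zero _ hs) hp, ?_⟩
  rw [hA, tB, norm_mul, Real.log_mul (norm_ne_zero_iff.2 (pow_ne_zero _ hs)) (norm_ne_zero_iff.2 hp), norm_pow, Real.log_pow, norm_prod, Real.log_prod (fun j _ => norm_ne_zero_iff.2 (div_ne_zero (n3 j) (n2 j)))]
  have : ∀ j, Real.log ‖Complex.sin (v - vj ζ (lam j) - ζ) / Complex.sin (v - vj ζ (lam j))‖ = (Isinh (κ0 (2 * ζ)) (ζ - 2 * (v - lam j * Complex.I))).re + (Isinh (κ0 ζ) (2 * (v - lam j * Complex.I))).re := fun j => by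
    rw [RK_eq ζ h0 hπ _ (hw j), RK_eq (2 * ζ) (by linarith) (by linarith) _ (hw' j), e1, e2, e3, e4, Complex.sin_neg, norm_neg, norm_div, Real.log_div (norm_ne_zero_iff.2 (n3 j)) (norm_ne_zero_iff.2 (n2 j)), Complex.sin_neg, norm_neg]
    ring
  simp only [this, Finset.sum_add_distrib]
  push_cast; ring

theorem tB_le (hζ2 : π / 2 ≤ ζ) (m : ℕ) (lam : Fin m → ℝ) (v : ℂ) (hv : v ∈ strip ζ) :
    ‖tB ζ m lam v‖ ≤ (‖Complex.sin v‖ / ‖Complex.sin (ζ - v)‖) ^ (2 * m) * ‖tA ζ m lam v‖ := by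
  obtain ⟨hv0, hv1⟩ := hv
  have hs : Complex.sin (ζ - v) ≠ 0 := sin_ne _ (by simp; linarith) (by simp; linarith)
  have hs' := norm_pos_iff.2 hs
  rw [tA, tB, norm_mul, norm_mul, norm_pow, norm_pow, div_pow, ← mul_assoc, div_mul_cancel₀ _ (by positivity), norm_prod, norm_prod]
  gcongr with j _
  rw [norm_div, norm_div]
  gcongr
  rw [← sq_le_sq₀ (norm_nonneg _) (norm_nonneg _), nsin_sq, nsin_sq]
  have hr : (v - vj ζ (lam j)).re = v.re - ζ / 2 := by rw [Complex.sub_re, vj_re]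
  simp only [Complex.sub_re _ (ζ : ℂ), Complex.add_re _ (ζ : ℂ), Complex.sub_im _ (ζ : ℂ), Complex.add_im _ (ζ : ℂ), Complex.ofReal_im, Complex.ofReal_re, sub_zero, add_zero, hr]
  set x := v.re - ζ / 2 with hx
  have h1 : Real.sin (x + ζ) ^ 2 - Real.sin (x - ζ) ^ 2 = Real.sin (2 * x) * Real.sin (2 * ζ) := by
    rw [Real.sin_add x ζ, Real.sin_sub x ζ, Real.sin_two_mul, Real.sin_two_mul]; ring
  have h2 : Real.sin (2 * x) ≤ 0 := Real.sin_nonpos_of_nonpos_of_neg_pi_le (by linarith) (by linarith)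
  have h3 : Real.sin (2 * ζ) ≤ 0 := by
    have := Real.sin_nonneg_of_nonneg_of_le_pi (x := 2 * ζ - π) (by linarith) (by linarith)
    rw [Real.sin_sub_pi] at this; linarith
  nlinarith

theorem q_lt (v : ℂ) (hv : v ∈ strip ζ) : ‖Complex.sin v‖ < ‖Complex.sin (ζ - v)‖ := by
  obtain ⟨hv0, hv1⟩ := hv
  rw [← sq_lt_sq₀ (norm_nonneg _) (norm_nonneg _), nsin_sq, nsin_sq]
  simp only [Complex.sub_re, Complex.sub_im, Complex.ofReal_im, Complex.ofReal_re, zero_sub, Real.sinh_neg, neg_sq]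
  have h1 : Real.sin (ζ - v.re) ^ 2 - Real.sin v.re ^ 2 = Real.sin ζ * Real.sin (ζ - 2 * v.re) := by
    rw [Real.sin_sub, Real.sin_sub, Real.sin_two_mul, Real.cos_two_mul]
    have e1 := Real.sin_sq_add_cos_sq v.re
    have e2 := Real.sin_sq_add_cos_sq ζ
    linear_combination (Real.sin v.re ^ 2) * e2 - (Real.sin ζ ^ 2) * e1
  have h2 : 0 < Real.sin ζ := Real.sin_pos_of_pos_of_lt_pi h0 hπ
  have h3 : 0 < Real.sin (ζ - 2 * v.re) := Real.sin_pos_of_pos_of_lt_pi (by linarith) (by linarith)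
  nlinarith [mul_pos h2 h3]
end G

section G
variable (ζ : ℝ) (h0 : 0 < ζ) (hπ : ζ < π)
include h0 hπ

theorem RK_cont (v w : ℂ) (h : ∀ l : ℝ, |(v + w * (l * Complex.I)).re| < ζ) :
    Continuous fun l : ℝ => (Isinh (κ0 ζ) (v + w * (l * Complex.I))).re := by
  refine Complex.continuous_re.comp (continuous_iff_continuousAt.2 fun l => ?_)
  have := (Isinh_deriv (κ0 ζ) (κ0_meas ζ) 1 ζ (κ0_bound ζ h0 hπ) _ (h l)).continuousAt
  exact ContinuousAt.comp (g := Isinh (κ0 ζ)) (f := fun l : ℝ => v + w * (l * Complex.I)) this (by fun_prop)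

variable (U : Ultrafilter ℕ) (hU : (U : Filter ℕ) ≤ atTop) (lam : ∀ n, Fin (n+1) → ℝ) (μ : Measure ℝ) [IsProbabilityMeasure μ]
  (hμ : ∀ f : ℝ → ℝ, Continuous f → (∃ B, ∀ x, |f x| ≤ B) →
      Tendsto (fun n => (∑ j, f (lam n j)) / ((n+1 : ℕ) : ℝ)) U (nhds (∫ x, f x ∂μ)))
  (hsp : ∀ n (v : ℂ), 0 < v.re → v.re < ζ / 2 →
      (-1) ^ (n+1) * (tA ζ (n+1) (lam n) v + tB ζ (n+1) (lam n) v) ∈ spectrum ℂ (TT (Complex.sin (ζ - v)) (Complex.sin v) (Complex.sin ζ) (2 * (n+1))))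

def Good (ζ : ℝ) (U : Ultrafilter ℕ) (lam : ∀ n, Fin (n+1) → ℝ) (v : ℂ) : Prop :=
  ∀ᶠ n in (U : Filter ℕ), 1/2 * ‖tA ζ (n+1) (lam n) v‖ ≤ ‖tA ζ (n+1) (lam n) v + tB ζ (n+1) (lam n) v‖

include hμ in
theorem tA_lim (v : ℂ) (hv : v ∈ strip ζ) :
    Tendsto (fun n => Real.log ‖tA ζ (n+1) (lam n) v‖ / (2 * ((n+1 : ℕ) : ℝ))) U (nhds (Real.log ‖EE ζ v‖ - hR ζ μ v)) := by
  have hv' := hv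
  obtain ⟨hv0, hv1⟩ := hv
  have hs : Complex.sin (ζ - v) ≠ 0 := sin_ne _ (by simp; linarith) (by simp; linarith)
  have hw : ∀ l : ℝ, |(2 * (v - l * Complex.I)).re| ≤ 2 * v.re := fun j => by
    rw [re_two ζ h0 hπ, abs_le]; constructor <;> linarith
  obtain ⟨B, hB⟩ := RK_bound ζ h0 hπ (2 * v.re) (by linarith)
  have hc : Continuous fun l : ℝ => (Isinh (κ0 ζ) (2 * (v - l * Complex.I))).re := by
    have := RK_cont ζ h0 hπ (2 * v) (-2) (fun l => by
      rw [show 2 * v + -2 * (l * Complex.I) = 2 * (v - l * Complex.I) by ring]; exact (hw l).trans_lt (by linarith))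
    refine this.congr fun l => ?_
    congr 2; ring
  have h1 := (hμ _ hc ⟨B, fun l => hB _ (hw l)⟩).const_mul (1/2)
  have h2 := h1.const_add (Real.log ‖Complex.sin (ζ - v)‖)
  have e : Real.log ‖EE ζ v‖ - hR ζ μ v = Real.log ‖Complex.sin (ζ - v)‖ + 1/2 * ∫ l : ℝ, (Isinh (κ0 ζ) (2 * (v - l * Complex.I))).re ∂μ := by
    rw [EE_eq ζ h0 hπ v (by linarith), EL, norm_mul, Real.log_mul (norm_ne_zero_iff.2 hs) (norm_ne_zero_iff.2 (Complex.exp_ne_zero _)), Complex.norm_exp, Real.log_exp, hR]; ring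
  rw [e]
  refine h2.congr fun n => ?_
  rw [(tA_log ζ h0 hπ _ _ v hv').2]
  have : (0:ℝ) < ((n+1 : ℕ) : ℝ) := by positivity
  generalize (∑ j, (Isinh (κ0 ζ) (2 * (v - (lam n j : ℂ) * Complex.I))).re) = S
  field_simp

include hμ hU in
theorem good_lt (hζ2 : ζ < π / 2) (v : ℂ) (hv : v ∈ strip ζ) (hD : Dd ζ μ v ≠ 0) : Good ζ U lam v := by
  have hv' := hv
  obtain ⟨hv0, hv1⟩ := hv
  have hw : ∀ l : ℝ, |((ζ:ℂ) - 2 * (v - l * Complex.I)).re| ≤ ζ := fun j => by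
    rw [Complex.sub_re, re_two ζ h0 hπ, Complex.ofReal_re, abs_le]; constructor <;> linarith
  obtain ⟨B, hB⟩ := RK_bound (2 * ζ) (by linarith) (by linarith) ζ (by linarith)
  have hc : Continuous fun l : ℝ => (Isinh (κ0 (2 * ζ)) (ζ - 2 * (v - l * Complex.I))).re := by
    have := RK_cont (2 * ζ) (by linarith) (by linarith) (ζ - 2 * v) 2 (fun l => by
      rw [show (ζ:ℂ) - 2 * v + 2 * (l * Complex.I) = ζ - 2 * (v - l * Complex.I) by ring]; exact (hw l).trans_lt (by linarith))
    refine this.congr fun l => ?_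
    congr 2; ring
  have h2 := (hμ _ hc ⟨B, fun l => hB _ (hw l)⟩).const_add (2 * (Real.log ‖Complex.sin v‖ - Real.log ‖Complex.sin (ζ - v)‖))
  have h3 : Tendsto (fun n => (Real.log ‖tB ζ (n+1) (lam n) v‖ - Real.log ‖tA ζ (n+1) (lam n) v‖) / ((n+1 : ℕ) : ℝ)) U (nhds (Dd ζ μ v)) := by
    refine h2.congr fun n => ?_
    rw [(tB_log ζ h0 hπ hζ2 _ _ v hv').2]
    have : (0:ℝ) < ((n+1 : ℕ) : ℝ) := by positivity
    generalize (∑ j, (Isinh (κ0 (2 * ζ)) (ζ - 2 * (v - (lam n j : ℂ) * Complex.I))).re) = S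
    field_simp
  have hbig : ∀ δ : ℝ, 0 < δ → ∀ᶠ n in (U : Filter ℕ), Real.log 2 ≤ δ * ((n+1 : ℕ) : ℝ) := fun δ hδ => by
    have : ∀ᶠ n : ℕ in atTop, Real.log 2 / δ ≤ (n : ℝ) := tendsto_natCast_atTop_atTop.eventually_ge_atTop _
    filter_upwards [hU this] with n hn
    rw [div_le_iff₀ hδ] at hn
    push_cast; nlinarith
  have hl2 : Real.log 2 = -Real.log (1/2) := by rw [one_div, Real.log_inv, neg_neg]
  rcases lt_or_gt_of_ne hD with hD | hD
  · filter_upwards [h3.eventually_lt_const (show Dd ζ μ v < Dd ζ μ v / 2 by linarith), hbig (-(Dd ζ μ v) / 2) (by linarith)] with n h4 h5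
    have hn : (0:ℝ) < ((n+1 : ℕ) : ℝ) := by positivity
    rw [div_lt_iff₀ hn] at h4
    have hA := norm_pos_iff.2 (tA_log ζ h0 hπ _ (lam n) v hv').1
    have hB := norm_pos_iff.2 (tB_log ζ h0 hπ hζ2 _ (lam n) v hv').1
    have h6 : Real.log ‖tB ζ (n+1) (lam n) v‖ ≤ Real.log (1/2 * ‖tA ζ (n+1) (lam n) v‖) := by
      rw [Real.log_mul (by norm_num) hA.ne']; linarith
    have h7 := (Real.log_le_log_iff hB (by positivity)).1 h6
    have h8 := norm_sub_le (tA ζ (n+1) (lam n) v + tB ζ (n+1) (lam n) v) (tB ζ (n+1) (lam n) v)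
    rw [add_sub_cancel_right] at h8
    linarith
  · filter_upwards [h3.eventually_const_lt (show Dd ζ μ v / 2 < Dd ζ μ v by linarith), hbig (Dd ζ μ v / 2) (by linarith)] with n h4 h5
    have hn : (0:ℝ) < ((n+1 : ℕ) : ℝ) := by positivity
    rw [lt_div_iff₀ hn] at h4
    have hA := norm_pos_iff.2 (tA_log ζ h0 hπ _ (lam n) v hv').1
    have hB := norm_pos_iff.2 (tB_log ζ h0 hπ hζ2 _ (lam n) v hv').1
    have h6 : Real.log (2 * ‖tA ζ (n+1) (lam n) v‖) ≤ Real.log ‖tB ζ (n+1) (lam n) v‖ := by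
      rw [Real.log_mul (by norm_num) hA.ne']; linarith
    have h7 := (Real.log_le_log_iff (by positivity) hB).1 h6
    have h8 := norm_sub_le (tA ζ (n+1) (lam n) v + tB ζ (n+1) (lam n) v) (tA ζ (n+1) (lam n) v)
    rw [add_sub_cancel_left] at h8
    linarith

include hU in
theorem good_ge (hζ2 : π / 2 ≤ ζ) (v : ℂ) (hv : v ∈ strip ζ) : Good ζ U lam v := by
  have hq := q_lt ζ h0 hπ v hv
  have hp := (norm_nonneg _).trans_lt hq
  have hq0 : 0 ≤ ‖Complex.sin v‖ / ‖Complex.sin (ζ - v)‖ := by positivity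
  have hq1 : ‖Complex.sin v‖ / ‖Complex.sin (ζ - v)‖ < 1 := (div_lt_one hp).2 hq
  have hl := (tendsto_pow_atTop_nhds_zero_of_lt_one hq0 hq1).eventually_lt_const (show (0:ℝ) < 1/2 by norm_num)
  filter_upwards [hU hl] with n hn
  have h7 := tB_le ζ h0 hπ hζ2 (n+1) (lam n) v hv
  have h9 : (‖Complex.sin v‖ / ‖Complex.sin (ζ - v)‖) ^ (2 * (n+1)) ≤ 1/2 :=
    (pow_le_pow_of_le_one hq0 hq1.le (by omega)).trans hn.le
  have h8 := norm_sub_le (tA ζ (n+1) (lam n) v + tB ζ (n+1) (lam n) v) (tB ζ (n+1) (lam n) v)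
  rw [add_sub_cancel_right] at h8
  have := mul_le_mul_of_nonneg_right h9 (norm_nonneg (tA ζ (n+1) (lam n) v))
  linarith

include hU in
theorem const_div_lim (C : ℝ) : Tendsto (fun n : ℕ => C / (2 * ((n+1 : ℕ) : ℝ))) U (nhds 0) := by
  refine Tendsto.mono_left ?_ hU
  refine Tendsto.const_div_atTop (Tendsto.const_mul_atTop two_pos ?_) C
  exact tendsto_natCast_atTop_atTop.comp (tendsto_add_atTop_nat 1)

theorem EE_pos (v : ℂ) (hv0 : 0 ≤ v.re) (hv1 : v.re ≤ ζ) : 0 < ‖EE ζ v‖ := by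
  obtain ⟨A, C, -, -, h⟩ := EE_lower ζ h0 hπ
  have := h v hv0 hv1
  refine lt_of_le_of_ne (norm_nonneg _) fun h' => ?_
  rw [← h', zero_mul] at this; linarith

include hμ hU hsp in
theorem hR_nonneg_good (v : ℂ) (hv : v ∈ strip ζ) (hg : Good ζ U lam v) : 0 ≤ hR ζ μ v := by
  have h1 := tA_lim ζ h0 hπ U lam μ hμ v hv
  have h2 := (const_div_lim ζ h0 hπ U hU (Real.log 4)).add_const (Real.log ‖EE ζ v‖)
  rw [zero_add] at h2
  have hE := EE_pos ζ h0 hπ v hv.1.le (by linarith [hv.2])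
  have := le_of_tendsto_of_tendsto h1 h2 (by
    filter_upwards [hg] with n hn
    have h3 := eig_bound ζ h0 hπ _ v hv.1.le (by linarith [hv.2]) _ (hsp n v hv.1 hv.2)
    rw [norm_mul, norm_pow, norm_neg, norm_one, one_pow, one_mul] at h3
    have hA := norm_pos_iff.2 (tA_log ζ h0 hπ _ (lam n) v hv).1
    have h4 : ‖tA ζ (n+1) (lam n) v‖ ≤ 4 * ‖EE ζ v‖ ^ (2 * (n+1)) := by linarith
    have h5 := Real.log_le_log hA h4
    rw [Real.log_mul (by norm_num) (by positivity), Real.log_pow] at h5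
    have hn : (0:ℝ) < ((n+1 : ℕ) : ℝ) := by positivity
    rw [div_le_iff₀ (by positivity), add_mul, div_mul_cancel₀ _ (by positivity)]
    push_cast at h5 ⊢; linarith)
  linarith

include hμ hU hsp in
theorem hR_zero (r : ℝ) (hr : r ∈ Set.Ioo 0 (ζ/2)) : hR ζ μ r = 0 := by
  refine rigid ζ h0 hπ μ r hr.1 hr.2 fun y => ?_
  have hv : ((r:ℂ) + y * Complex.I) ∈ strip ζ := by simpa [strip] using hr
  by_contra hn
  push Not at hn
  have hc := (hR_cont ζ h0 hπ μ _ hv).eventually_lt_const hn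
  have hf : ∃ᶠ w in nhds ((r:ℂ) + y * Complex.I), w ∈ strip ζ ∧ Good ζ U lam w := by
    rcases lt_or_ge ζ (π/2) with h | h
    · exact (Dd_dense ζ h0 hπ μ h _ hv).mono fun w hw => ⟨hw.1, good_lt ζ h0 hπ U hU lam μ hμ h w hw.1 hw.2⟩
    · exact (show ∀ᶠ w in nhds ((r:ℂ) + y * Complex.I), w ∈ strip ζ ∧ Good ζ U lam w from by
        filter_upwards [(strip_open ζ).mem_nhds hv] with w hw
        exact ⟨hw, good_ge ζ h0 hπ U hU lam h w hw⟩).frequently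
  obtain ⟨w, ⟨hw1, hw2⟩, hw3⟩ := (hf.and_eventually hc).exists
  linarith [hR_nonneg_good ζ h0 hπ U hU lam μ hμ hsp w hw1 hw2]

def LB (ζ : ℝ) (U : Ultrafilter ℕ) (x : ℝ) : Prop := ∀ ε > 0, ∀ᶠ n in (U : Filter ℕ), Real.log ‖EE ζ x‖ - ε ≤ gN (Real.sin (ζ - x)) (Real.sin x) (Real.sin ζ) (2 * (n+1))

include hμ hU hsp in
theorem lb_good (r : ℝ) (hr : r ∈ Set.Ioo 0 (ζ/2)) (hg : Good ζ U lam r) : LB ζ U r := by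
  intro ε hε
  have hv : (r:ℂ) ∈ strip ζ := by simpa [strip] using hr
  have h1 := tA_lim ζ h0 hπ U lam μ hμ r hv
  rw [hR_zero ζ h0 hπ U hU lam μ hμ hsp r hr, sub_zero] at h1
  have h2 := (const_div_lim ζ h0 hπ U hU (Real.log (1/2))).add h1
  rw [zero_add] at h2
  filter_upwards [h2.eventually_const_lt (show Real.log ‖EE ζ r‖ - ε < Real.log ‖EE ζ r‖ by linarith), hg] with n h3 h4
  refine h3.le.trans ?_
  have hA := norm_pos_iff.2 (tA_log ζ h0 hπ _ (lam n) r hv).1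
  have hs := hsp n r hv.1 hv.2
  have e : TT (Complex.sin (ζ - r)) (Complex.sin r) (Complex.sin ζ) (2 * (n+1)) = TT ((Real.sin (ζ - r) : ℝ) : ℂ) ((Real.sin r : ℝ) : ℂ) ((Real.sin ζ : ℝ) : ℂ) (2 * (n+1)) := by
    push_cast; rfl
  rw [e] at hs
  have hpos : 0 < ‖tA ζ (n+1) (lam n) r + tB ζ (n+1) (lam n) r‖ := by linarith
  have h5 := (g_all (Real.sin (ζ - r)) (Real.sin r) (Real.sin ζ)
    (Real.sin_pos_of_pos_of_lt_pi (by linarith [hr.2]) (by linarith [hr.1]))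
    (Real.sin_pos_of_pos_of_lt_pi hr.1 (by linarith [hr.2]))
    (Real.sin_pos_of_pos_of_lt_pi h0 hπ) (2 * (n+1)) (by omega)).2.2 _ hs (mul_ne_zero (by simp) (norm_pos_iff.1 hpos))
  refine le_trans ?_ h5
  rw [norm_mul, norm_pow, norm_neg, norm_one, one_pow, one_mul, ← add_div]
  have h6 := Real.log_le_log (by positivity) h4
  rw [Real.log_mul (by norm_num) hA.ne'] at h6
  push_cast
  push_cast at h6
  gcongr

include hμ hU hsp in
theorem lb_dense : Set.Icc 0 (ζ/2) ⊆ closure {x : ℝ | x ∈ Set.Ioo 0 (ζ/2) ∧ LB ζ U x} := by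
  rw [← closure_Ioo (show (0:ℝ) ≠ ζ / 2 by linarith)]
  refine closure_minimal (fun r hr => mem_closure_iff_frequently.2 ?_) isClosed_closure
  rcases lt_or_ge ζ (π/2) with h | h
  · exact (Dd_dense_real ζ h0 hπ μ h r hr).mono fun w hw => ⟨hw.1, lb_good ζ h0 hπ U hU lam μ hμ hsp w hw.1 (good_lt ζ h0 hπ U hU lam μ hμ h w (by simpa [strip] using hw.1) hw.2)⟩
  · exact (show ∀ᶠ w in nhds r, w ∈ {x : ℝ | x ∈ Set.Ioo 0 (ζ/2) ∧ LB ζ U x} from by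
        filter_upwards [isOpen_Ioo.mem_nhds hr] with w hw
        exact ⟨hw, lb_good ζ h0 hπ U hU lam μ hμ hsp w hw (good_ge ζ h0 hπ U hU lam h w (by simpa [strip] using hw))⟩).frequently

include hU in
theorem lb_all (v : ℝ) (hv0 : 0 < v) (hv1 : v ≤ ζ / 2) : LB ζ U v := by
  obtain ⟨lam, hB, hsp⟩ := lam_exists ζ h0 hπ
  obtain ⟨μ, hμp, hμ⟩ := emp_lim ζ h0 hπ U lam hB
  have hd := lb_dense ζ h0 hπ U hU lam μ hμ hsp ⟨hv0.le, hv1⟩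
  intro ε hε
  set k := Real.exp (ε / 3) with hk
  have hk1 : 1 < k := Real.one_lt_exp_iff.2 (by linarith)
  have s1 : 0 < Real.sin (ζ - v) := Real.sin_pos_of_pos_of_lt_pi (by linarith) (by linarith)
  have s2 : 0 < Real.sin v := Real.sin_pos_of_pos_of_lt_pi hv0 (by linarith)
  have s3 : 0 < Real.sin ζ := Real.sin_pos_of_pos_of_lt_pi h0 hπ
  have c1 : ∀ᶠ x in nhds v, Real.sin (ζ - x) < k * Real.sin (ζ - v) :=
    (show ContinuousAt (fun x => Real.sin (ζ - x)) v by fun_prop).eventually_lt_const (by nlinarith)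
  have c2 : ∀ᶠ x in nhds v, Real.sin x < k * Real.sin v :=
    (show ContinuousAt (fun x => Real.sin x) v by fun_prop).eventually_lt_const (by nlinarith)
  have c3 : ∀ᶠ x : ℝ in nhds v, Real.log ‖EE ζ v‖ - ε / 3 < Real.log ‖EE ζ x‖ := by
    have h1 : ContinuousAt (EE ζ) (v:ℂ) := (EE_diff ζ h0 hπ v (by simpa using hv0.le) (by simp; linarith)).continuousAt
    have h2 : ContinuousAt (fun x : ℝ => ‖EE ζ x‖) v := (ContinuousAt.comp (g := EE ζ) (f := fun x : ℝ => (x:ℂ)) h1 (by fun_prop)).norm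
    have h3 := h2.log (EE_pos ζ h0 hπ v (by simpa using hv0.le) (by simp; linarith)).ne'
    exact h3.eventually_const_lt (by linarith)
  obtain ⟨x, ⟨⟨hx, hL⟩, h1, h2⟩, h3⟩ := ((mem_closure_iff_frequently.1 hd).and_eventually (c1.and c2) |>.and_eventually c3).exists
  filter_upwards [hL (ε/3) (by linarith)] with n hn
  have := gN_mono (Real.sin (ζ - x)) (Real.sin x) (Real.sin ζ) (Real.sin (ζ - v)) (Real.sin v) (Real.sin ζ) k
    (Real.sin_pos_of_pos_of_lt_pi (by linarith [hx.2]) (by linarith [hx.1]))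
    (Real.sin_pos_of_pos_of_lt_pi hx.1 (by linarith [hx.2])) s3 s1 s2 s3 (by linarith) h1.le h2.le (by nlinarith) (2 * (n+1)) (by omega)
  rw [hk, Real.log_exp] at this
  linarith
end G

theorem gN_lim (ζ : ℝ) (h0 : 0 < ζ) (hπ : ζ < π) (v : ℝ) (hv0 : 0 < v) (hv1 : v ≤ ζ / 2) :
    Tendsto (fun n : ℕ => gN (Real.sin (ζ - v)) (Real.sin v) (Real.sin ζ) (2 * (n+1))) atTop (nhds (Real.log ‖EE ζ v‖)) := by
  have s1 : 0 < Real.sin (ζ - v) := Real.sin_pos_of_pos_of_lt_pi (by linarith) (by linarith)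
  have s2 : 0 < Real.sin v := Real.sin_pos_of_pos_of_lt_pi hv0 (by linarith)
  have s3 : 0 < Real.sin ζ := Real.sin_pos_of_pos_of_lt_pi h0 hπ
  have hE := EE_pos ζ h0 hπ v (by simpa using hv0.le) (by simp; linarith)
  rw [tendsto_iff_ultrafilter]
  intro U hU
  have hup : ∀ n : ℕ, gN (Real.sin (ζ - v)) (Real.sin v) (Real.sin ζ) (2 * (n+1)) ≤ Real.log 2 / (2 * ((n+1 : ℕ) : ℝ)) + Real.log ‖EE ζ v‖ := by
    intro n
    have h1 := (g_all _ _ _ s1 s2 s3 (2 * (n+1)) (by omega)).2.1 (2 * ‖EE ζ v‖ ^ (2 * (n+1))) (by positivity) (fun w hw => by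
      refine eig_bound ζ h0 hπ _ v (by simpa using hv0.le) (by simp; linarith) w ?_
      convert hw using 2 <;> push_cast <;> rfl)
    rw [Real.log_mul (by norm_num) (by positivity), Real.log_pow, add_div, mul_div_cancel_left₀ _ (by positivity)] at h1
    push_cast at h1 ⊢; exact h1
  rw [Metric.tendsto_nhds]
  intro ε hε
  have h3 := const_div_lim ζ h0 hπ U hU (Real.log 2)
  filter_upwards [lb_all ζ h0 hπ U hU v hv0 hv1 (ε/2) (by linarith), h3.eventually_lt_const hε] with n h4 h5
  rw [Real.dist_eq, abs_lt]
  constructor <;> linarith [hup n]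

/-- **Free energy of the six-vertex model in the regime `-1 < Δ < 1`** (Theorem 1.1,
disordered/massless case): for `a ≥ b > 0`, `c > 0` with `Δ := (a²+b²-c²)/(2ab) ∈ (-1,1)`,
parameterised by `ζ ∈ (0,π)` with `Δ = -cos ζ` and `θ ∈ (0,π)` with
`a sin(θζ/π) = b sin((1-θ/π)ζ)`, the free energy exists and equals
`log b + ∫_{-∞}^{∞} (1/(2t)) · sinh(2(π-θ)ζt/π)/cosh(ζt) · sinh((π-ζ)t)/sinh(πt) dt`. -/
theorem free_energy_massless (a b c ζ θ : ℝ)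
    (hb : 0 < b) (hab : b ≤ a) (hc : 0 < c)
    (hΔl : -1 < (a ^ 2 + b ^ 2 - c ^ 2) / (2 * a * b))
    (hΔr : (a ^ 2 + b ^ 2 - c ^ 2) / (2 * a * b) < 1)
    (hζ0 : 0 < ζ) (hζπ : ζ < π)
    (hζ : (a ^ 2 + b ^ 2 - c ^ 2) / (2 * a * b) = -Real.cos ζ)
    (hθ0 : 0 < θ) (hθπ : θ < π)
    (hθ : a * Real.sin (θ * ζ / π) = b * Real.sin ((1 - θ / π) * ζ)) :
    FreeEnergyIs a b c (Real.log b + ∫ t : ℝ, masslessIntegrand ζ θ t) := by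
  have hπ0 := Real.pi_pos
  have ha : 0 < a := by linarith
  set v := θ * ζ / π with hv
  have hv0 : 0 < v := by positivity
  have hvζ : v < ζ := by rw [hv, div_lt_iff₀ hπ0]; nlinarith
  rw [show (1 - θ / π) * ζ = ζ - v by rw [hv]; ring] at hθ
  have s1 : 0 < Real.sin (ζ - v) := Real.sin_pos_of_pos_of_lt_pi (by linarith) (by linarith)
  have s2 : 0 < Real.sin v := Real.sin_pos_of_pos_of_lt_pi hv0 (by linarith)
  have s3 : 0 < Real.sin ζ := Real.sin_pos_of_pos_of_lt_pi hζ0 hζπ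
  have hv1 : v ≤ ζ / 2 := by
    by_contra hn
    push Not at hn
    have e : Real.sin v - Real.sin (ζ - v) = 2 * Real.sin (v - ζ / 2) * Real.cos (ζ / 2) := by
      rw [Real.sin_sub_sin]; congr 3 <;> ring
    have p1 : 0 < Real.sin (v - ζ / 2) := Real.sin_pos_of_pos_of_lt_pi (by linarith) (by linarith)
    have p2 : 0 < Real.cos (ζ / 2) := Real.cos_pos_of_mem_Ioo ⟨by linarith, by linarith⟩
    have p3 := mul_pos p1 p2
    have : Real.sin (ζ - v) < Real.sin v := by nlinarith
    nlinarith [mul_lt_mul_of_pos_left this hb, mul_le_mul_of_nonneg_right hab s2.le]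
  set ρ := b / Real.sin v with hρ
  have hρ0 : 0 < ρ := by positivity
  have eb : b = ρ * Real.sin v := by rw [hρ]; field_simp
  have ea : a = ρ * Real.sin (ζ - v) := by rw [hρ]; field_simp; linarith
  have ec : c = ρ * Real.sin ζ := by
    have e1 : a ^ 2 + b ^ 2 - c ^ 2 = -Real.cos ζ * (2 * a * b) := by
      rw [div_eq_iff (by positivity)] at hζ; exact hζ
    have e2 : Real.sin (ζ - v) ^ 2 + Real.sin v ^ 2 + 2 * Real.sin (ζ - v) * Real.sin v * Real.cos ζ = Real.sin ζ ^ 2 := by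
      rw [Real.sin_sub]
      have t1 := Real.sin_sq_add_cos_sq v
      have t2 := Real.sin_sq_add_cos_sq ζ
      linear_combination (Real.sin ζ ^ 2) * t1 - (Real.sin v ^ 2) * t2
    have e3 : c ^ 2 = (ρ * Real.sin ζ) ^ 2 := by
      rw [mul_pow, ← e2]
      rw [ea, eb] at e1
      linear_combination -e1
    exact (sq_eq_sq₀ hc.le (by positivity)).1 e3
  have hg : ∀ N, 0 < N → gN a b c N = Real.log ρ + gN (Real.sin (ζ - v)) (Real.sin v) (Real.sin ζ) N := by
    intro N hN
    refine le_antisymm (gN_mono _ _ _ _ _ _ ρ ha hb hc s1 s2 s3 hρ0 ea.le eb.le ec.le N hN) ?_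
    have := gN_mono (Real.sin (ζ - v)) (Real.sin v) (Real.sin ζ) a b c ρ⁻¹ s1 s2 s3 ha hb hc (by positivity)
      (by rw [ea, inv_mul_cancel_left₀ hρ0.ne']) (by rw [eb, inv_mul_cancel_left₀ hρ0.ne']) (by rw [ec, inv_mul_cancel_left₀ hρ0.ne']) N hN
    rw [Real.log_inv] at this
    linarith
  have hF : Real.log b + ∫ t : ℝ, masslessIntegrand ζ θ t = Real.log ρ + Real.log ‖EE ζ v‖ := by
    have hn : ‖Complex.sin (ζ - (ζ - v))‖ = Real.sin v := by
      rw [sub_sub_cancel, ← Complex.ofReal_sin, Complex.norm_real, Real.norm_of_nonneg s2.le]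
    rw [EE_eq' ζ hζ0 hζπ v (by simpa using hv0), EL, norm_mul, hn, Real.log_mul s2.ne' (norm_ne_zero_iff.2 (Complex.exp_ne_zero _)), Complex.norm_exp, Real.log_exp, ← add_assoc, ← Real.log_mul hρ0.ne' s2.ne', ← eb]
    rw [Isinh_re (kk ζ) (kk_meas ζ) 1 (2 * ζ) (kk_bound ζ hζ0 hζπ) _ (by simp [abs_lt]; constructor <;> linarith)]
    congr 1
    refine integral_congr_ae ?_
    filter_upwards [compl_mem_ae_iff.2 (measure_singleton (0:ℝ))] with t ht
    have ht : t ≠ 0 := ht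
    rw [masslessIntegrand, if_neg ht, kk, κ0]
    have e1 : 2 * (π - θ) / π * ζ * t = 2 * (ζ - v) * t := by rw [hv]; field_simp
    have e2 : (2 * ((ζ:ℂ) - v)).re = 2 * (ζ - v) := by simp
    have e3 : (2 * ((ζ:ℂ) - v)).im = 0 := by simp
    rw [e1, e2, e3, zero_mul, Real.cos_zero, mul_one]
    have := (Real.cosh_pos (ζ * t)).ne'
    have : Real.sinh (π * t) ≠ 0 := by
      rw [Ne, Real.sinh_eq_zero]; exact mul_ne_zero hπ0.ne' ht
    generalize Real.sinh (2 * (ζ - v) * t) = S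
    field_simp
  refine ⟨gN a b c, fun N _ hN => (g_all a b c ha hb hc N (by omega)).1, ?_⟩
  rw [hF]
  have hlim := (gN_lim ζ hζ0 hζπ v hv0 hv1).const_add (Real.log ρ)
  rw [Metric.tendsto_nhds]
  intro ε hε
  rw [eventually_inf_principal]
  obtain ⟨n0, hn0⟩ := eventually_atTop.1 (Metric.tendsto_nhds.1 hlim ε hε)
  filter_upwards [Ici_mem_atTop (2 * (n0 + 1))] with N (hN : 2 * (n0 + 1) ≤ N) hE
  obtain ⟨m, rfl⟩ := even_iff_two_dvd.1 hE
  have := hn0 (m - 1) (by omega)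
  rw [show m - 1 + 1 = m by omega] at this
  rw [hg _ (by omega)]; exact this

end SixVertexFE
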